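/- Let X, Y, U be real finite-dimensional vector spaces with linear coordinates x, y, u, and let h_j(x,y,u), 1 ≤ j ≤ j_0, be germs of functions in the ring R_ℝ(X × Y × U, X). Then for any integer κ ≥ 1 there exists an integer η ≥ 1 such that: for any germs at 0 of real-analytic maps x^a : (U,0) → X and y^a : (U,0) → Y satisfying y^a(0) = 0 and h_j(x^a(u), y^a(u), u) = O(|u|^η) for 1 ≤ j ≤ j_0, there exist germs at 0 of real-analytic maps x^c : (U,0) → X and y^c : (U,0) → Y satisfying x^c(u) = x^a(u) + O(|u|^κ), y^c(u) = y^a(u) + O(|u|^κ), and h_j(x^c(u), y^c(u), u) ≡ 0 for 1 ≤ j ≤ j_0. -/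

import Mathlib

open scoped BigOperators

noncomputable section

/-- Iterated directional (real) derivative along a list of directions. -/
def iterDerivR {E F : Type*} [NormedAddCommGroup E] [NormedSpace ℝ E]
    [NormedAddCommGroup F] [NormedSpace ℝ F] : List E → (E → F) → E → F
  | [], f => f
  | v :: vs, f => iterDerivR vs fun x => fderiv ℝ f x v

/-- Real polynomial functions on a real vector space. -/
inductive IsPolyFunR {V : Type*} [AddCommGroup V] [Module ℝ V] : (V → ℝ) → Prop
  | const (c : ℝ) : IsPolyFunR fun _ => c
  | linear (φ : V →ₗ[ℝ] ℝ) : IsPolyFunR fun x => φ x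
  | add {f g : V → ℝ} : IsPolyFunR f → IsPolyFunR g → IsPolyFunR fun x => f x + g x
  | mul {f g : V → ℝ} : IsPolyFunR f → IsPolyFunR g → IsPolyFunR fun x => f x * g x

/-- The ring `R_ℝ(W₀ × W₁, W₀)` of germs along `W₀ × {0}` of real-analytic functions all
of whose partial derivatives restrict to real polynomial functions on `W₀ × {0}`. -/
def MemRingR (W0 W1 : Type*) [NormedAddCommGroup W0] [NormedSpace ℝ W0]
    [NormedAddCommGroup W1] [NormedSpace ℝ W1] (f : W0 × W1 → ℝ) : Prop :=
  (∃ Ω : Set (W0 × W1), IsOpen Ω ∧ (∀ x0 : W0, ((x0, 0) : W0 × W1) ∈ Ω) ∧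
    AnalyticOnNhd ℝ f Ω) ∧
  ∀ vs : List (W0 × W1), IsPolyFunR fun x0 : W0 => iterDerivR vs f ((x0, 0) : W0 × W1)

namespace Artin
open MvPowerSeries

section Formal

variable {R : Type*} [CommRing R] {σ τ ρ : Type*}

/-- Power series all of whose monomials have degree at least `N`. -/
def ordIdeal (σ R : Type*) [CommRing R] (N : ℕ) : Ideal (MvPowerSeries σ R) where
  carrier := {F | ∀ d : σ →₀ ℕ, d.degree < N → coeff d F = 0}
  add_mem' {F G} hF hG d hd := by rw [map_add, hF d hd, hG d hd, add_zero]
  zero_mem' d _ := map_zero _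
  smul_mem' F G hG d hd := by
    classical
    rw [smul_eq_mul, coeff_mul]
    refine Finset.sum_eq_zero fun p hp => ?_
    rw [hG, mul_zero]
    have := congrArg Finsupp.degree (Finset.HasAntidiagonal.mem_antidiagonal.1 hp)
    rw [map_add] at this
    omega

theorem mem_ordIdeal_iff_order {N : ℕ} {F : MvPowerSeries σ R} :
    F ∈ ordIdeal σ R N ↔ (N : ℕ∞) ≤ F.order :=
  ⟨fun h => nat_le_order h, fun h d hd =>
    coeff_of_lt_order (lt_of_lt_of_le (by exact_mod_cast hd) h)⟩

theorem ordIdeal_anti {M N : ℕ} (h : M ≤ N) {F : MvPowerSeries σ R}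
    (hF : F ∈ ordIdeal σ R N) : F ∈ ordIdeal σ R M :=
  fun d hd => hF d (hd.trans_le h)

theorem mem_ordIdeal_one {F : MvPowerSeries σ R} :
    F ∈ ordIdeal σ R 1 ↔ constantCoeff F = 0 := by
  constructor
  · intro h; exact h 0 (by simp)
  · intro h d hd
    have : d = 0 := by rw [← Finsupp.degree_eq_zero_iff]; omega
    rw [this]; exact h

theorem mem_ordIdeal_zero (F : MvPowerSeries σ R) : F ∈ ordIdeal σ R 0 :=
  fun _ hd => absurd hd (Nat.not_lt_zero _)

theorem mul_mem_ordIdeal {M N : ℕ} {F G : MvPowerSeries σ R} (hF : F ∈ ordIdeal σ R M)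
    (hG : G ∈ ordIdeal σ R N) : F * G ∈ ordIdeal σ R (M + N) := by
  rw [mem_ordIdeal_iff_order] at *
  refine le_trans ?_ le_order_mul
  push_cast
  gcongr

theorem pow_mem_ordIdeal {M : ℕ} {F : MvPowerSeries σ R} (hF : F ∈ ordIdeal σ R M) (n : ℕ) :
    F ^ n ∈ ordIdeal σ R (n * M) := by
  induction n with
  | zero => rw [zero_mul]; exact mem_ordIdeal_zero _
  | succ n ih => rw [pow_succ, add_mul, one_mul]; exact mul_mem_ordIdeal ih hF

theorem X_mem_ordIdeal (s : σ) : (X s : MvPowerSeries σ R) ∈ ordIdeal σ R 1 := by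
  rw [mem_ordIdeal_one]; simp

theorem eq_zero_of_forall_mem_ordIdeal {F : MvPowerSeries σ R}
    (h : ∀ N, F ∈ ordIdeal σ R N) : F = 0 := by
  ext d
  exact h (d.degree + 1) d (Nat.lt_succ_self _)

theorem sub_truncTotal_mem [Finite τ] (F : MvPowerSeries τ R) (N : ℕ) :
    F - (truncTotal N F : MvPolynomial τ R) ∈ ordIdeal τ R N := by
  intro d hd
  rw [map_sub, MvPolynomial.coeff_coe, coeff_truncTotal _ hd, sub_self]

theorem ext_of_poly [Finite τ] (L : MvPowerSeries τ R →+ MvPowerSeries σ R) (c : ℕ)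
    (hL : ∀ F N, F ∈ ordIdeal τ R (N + c) → L F ∈ ordIdeal σ R N)
    (h0 : ∀ P : MvPolynomial τ R, L P = 0) (F : MvPowerSeries τ R) : L F = 0 := by
  refine eq_zero_of_forall_mem_ordIdeal fun N => ?_
  have h := hL _ N (sub_truncTotal_mem F (N + c))
  rwa [map_sub, h0, sub_zero] at h

theorem hasSubst_zero [Finite τ] {a : τ → MvPowerSeries σ R}
    (ha : ∀ t, constantCoeff (a t) = 0) : HasSubst a :=
  hasSubst_of_constantCoeff_zero ha

theorem subst_mem_ordIdeal [Finite τ] {a : τ → MvPowerSeries σ R}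
    (ha : ∀ t, constantCoeff (a t) = 0) {F : MvPowerSeries τ R} {N : ℕ}
    (hF : F ∈ ordIdeal τ R N) : F.subst a ∈ ordIdeal σ R N := by
  rw [mem_ordIdeal_iff_order] at *
  refine hF.trans (le_trans ?_ (le_order_subst (hasSubst_zero ha) F))
  have : (1 : ℕ∞) ≤ ⨅ i, (a i).order :=
    le_iInf fun i => one_le_order_iff_constCoeff_eq_zero.2 (ha i)
  calc F.order = 1 * F.order := (one_mul _).symm
    _ ≤ _ := by gcongr

theorem constantCoeff_subst' [Finite τ] {a : τ → MvPowerSeries σ R}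
    (ha : ∀ t, constantCoeff (a t) = 0) (F : MvPowerSeries τ R) :
    constantCoeff (F.subst a) = constantCoeff F := by
  have h : F - C (constantCoeff F) ∈ ordIdeal τ R 1 := by
    rw [mem_ordIdeal_one]; simp
  have h2 := subst_mem_ordIdeal ha h
  rw [mem_ordIdeal_one, subst_sub (hasSubst_zero ha), subst_C, map_sub, sub_eq_zero] at h2
  rw [h2]; simp

theorem pderiv_mem_ordIdeal (i : σ) {F : MvPowerSeries σ R} {N : ℕ}
    (h : F ∈ ordIdeal σ R (N + 1)) : pderiv R i F ∈ ordIdeal σ R N := by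
  intro d hd
  rw [coeff_pderiv, h, zero_mul]
  rw [map_add, Finsupp.degree_single]; omega

theorem pderiv_subst [Fintype τ] {a : τ → MvPowerSeries σ R}
    (ha : ∀ t, constantCoeff (a t) = 0) (F : MvPowerSeries τ R) (i : σ) :
    pderiv R i (F.subst a) = ∑ t, (pderiv R t F).subst a * pderiv R i (a t) := by
  have hs := hasSubst_zero ha
  let L : MvPowerSeries τ R →+ MvPowerSeries σ R :=
    { toFun := fun F => pderiv R i (F.subst a) - ∑ t, (pderiv R t F).subst a * pderiv R i (a t)
      map_zero' := by
        simp only [← substAlgHom_apply hs, map_zero, zero_mul, Finset.sum_const_zero, sub_zero]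
      map_add' := fun F G => by
        simp only [← substAlgHom_apply hs, map_add, add_mul, Finset.sum_add_distrib]
        ring }
  have hL : ∀ F, L F = pderiv R i (F.subst a) -
    ∑ t, (pderiv R t F).subst a * pderiv R i (a t) := fun _ => rfl
  refine sub_eq_zero.1 ((hL F).symm.trans (ext_of_poly L 1 ?_ ?_ F))
  · intro F N h
    rw [hL]
    refine sub_mem (pderiv_mem_ordIdeal _ (subst_mem_ordIdeal ha h)) (sum_mem fun t _ => ?_)
    exact Ideal.mul_mem_right _ _ (subst_mem_ordIdeal ha (pderiv_mem_ordIdeal _ h))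
  · intro P
    rw [hL, sub_eq_zero]
    induction P using MvPolynomial.induction_on with
    | C r =>
      simp only [MvPolynomial.coe_C, pderiv_C, ← substAlgHom_apply hs, map_zero, zero_mul,
        Finset.sum_const_zero]
      rw [substAlgHom_apply hs, subst_C]
      exact pderiv_C
    | add p q hp hq =>
      simp only [MvPolynomial.coe_add, map_add, ← substAlgHom_apply hs, add_mul,
        Finset.sum_add_distrib] at *
      rw [hp, hq]
    | mul_X p t hp =>
      classical
      simp only [MvPolynomial.coe_mul, MvPolynomial.coe_X, Derivation.leibniz, smul_eq_mul,
        ← substAlgHom_apply hs, map_add, map_mul, add_mul, Finset.sum_add_distrib] at *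
      rw [hp, substAlgHom_X hs]
      congr 1
      · rw [Finset.sum_eq_single t]
        · rw [pderiv_X_self, map_one, mul_one]
        · intro b _ hb
          rw [pderiv_X_of_ne hb.symm, map_zero, mul_zero, zero_mul]
        · simp
      · rw [Finset.mul_sum]
        exact Finset.sum_congr rfl fun _ _ => by ring

/-- The power series `(F - F|_{X_s = 0}) / X_s`. -/
def shift (s : σ) : MvPowerSeries σ R →ₗ[R] MvPowerSeries σ R where
  toFun F := fun d => coeff (d + Finsupp.single s 1) F
  map_add' F G := by ext d; exact map_add (coeff (d + Finsupp.single s 1)) F G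
  map_smul' r F := by ext d; exact map_smul (coeff (d + Finsupp.single s 1)) r F

theorem coeff_shift (s : σ) (F : MvPowerSeries σ R) (d : σ →₀ ℕ) :
    coeff d (shift s F) = coeff (d + Finsupp.single s 1) F := rfl

theorem shift_mem_ordIdeal (i : σ) {F : MvPowerSeries σ R} {N : ℕ}
    (h : F ∈ ordIdeal σ R (N + 1)) : shift i F ∈ ordIdeal σ R N := by
  intro d hd
  rw [coeff_shift, h]
  rw [map_add, Finsupp.degree_single]; omega

theorem coeff_X_mul (s : σ) (F : MvPowerSeries σ R) (d : σ →₀ ℕ) :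
    coeff d (X s * F) = if d s = 0 then 0 else coeff (d - Finsupp.single s 1) F := by
  classical
  rw [X, coeff_monomial_mul, one_mul]
  by_cases h : d s = 0
  · rw [if_pos h, if_neg]
    intro h2
    have := h2 s
    simp [h] at this
  · rw [if_neg h, if_pos]
    intro t
    by_cases ht : s = t
    · subst ht; simp; omega
    · simp [ht]

theorem shift_X_mul_self (s : σ) (F : MvPowerSeries σ R) : shift s (X s * F) = F := by
  ext d
  rw [coeff_shift, coeff_X_mul]
  simp

theorem shift_X_mul_of_ne {s t : σ} (h : t ≠ s) (F : MvPowerSeries σ R) :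
    shift s (X t * F) = X t * shift s F := by
  ext d
  rw [coeff_shift, coeff_X_mul, coeff_X_mul, coeff_shift]
  have h1 : (d + (Finsupp.single s 1 : σ →₀ ℕ)) t = d t := by
    simp [h.symm]
  rw [h1]
  by_cases h0 : d t = 0
  · simp [h0]
  · rw [if_neg h0, if_neg h0]
    congr 2
    ext x
    simp only [Finsupp.coe_tsub, Finsupp.coe_add, Pi.sub_apply, Pi.add_apply]
    by_cases hx : x = s
    · subst hx; simp [h]
    · simp [Ne.symm hx]

theorem shift_C (s : σ) (r : R) : shift s (C r : MvPowerSeries σ R) = 0 := by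
  classical
  ext d
  rw [coeff_shift, coeff_C, if_neg, map_zero]
  intro h
  have := DFunLike.congr_fun h s
  simp at this

theorem subst_eq_add_shift [Finite τ] [DecidableEq τ] {a : τ → MvPowerSeries σ R}
    (ha : ∀ t, constantCoeff (a t) = 0) (s : τ) (F : MvPowerSeries τ R) :
    F.subst a = F.subst (Function.update a s 0) + a s * (shift s F).subst a := by
  have ha' : ∀ t, constantCoeff (Function.update a s 0 t) = 0 := by
    intro t
    by_cases h : t = s
    · subst h; simp
    · rw [Function.update_of_ne h, ha]
  have hs := hasSubst_zero ha
  have hs' := hasSubst_zero ha'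
  let L : MvPowerSeries τ R →+ MvPowerSeries σ R :=
    { toFun := fun F => F.subst a - (F.subst (Function.update a s 0) + a s * (shift s F).subst a)
      map_zero' := by
        simp only [← substAlgHom_apply hs, ← substAlgHom_apply hs', map_zero]; ring
      map_add' := fun F G => by
        simp only [← substAlgHom_apply hs, ← substAlgHom_apply hs', map_add]; ring }
  have hL : ∀ F, L F = F.subst a -
    (F.subst (Function.update a s 0) + a s * (shift s F).subst a) := fun _ => rfl
  refine sub_eq_zero.1 ((hL F).symm.trans (ext_of_poly L 1 ?_ ?_ F))
  · intro F N h
    rw [hL]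
    have h' := ordIdeal_anti (Nat.le_succ N) h
    exact sub_mem (subst_mem_ordIdeal ha h') (add_mem (subst_mem_ordIdeal ha' h')
      (Ideal.mul_mem_left _ _ (subst_mem_ordIdeal ha (shift_mem_ordIdeal _ h))))
  · intro P
    rw [hL, sub_eq_zero]
    induction P using MvPolynomial.induction_on with
    | C r =>
      rw [MvPolynomial.coe_C, shift_C, subst_C, subst_C, ← substAlgHom_apply hs, map_zero]; ring
    | add p q hp hq =>
      simp only [MvPolynomial.coe_add, map_add, ← substAlgHom_apply hs,
        ← substAlgHom_apply hs'] at *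
      rw [hp, hq]; ring
    | mul_X p t hp =>
      rw [MvPolynomial.coe_mul, MvPolynomial.coe_X, mul_comm]
      by_cases h : t = s
      · subst h
        rw [shift_X_mul_self, subst_mul hs, subst_mul hs', subst_X hs, subst_X hs']
        simp
      · rw [shift_X_mul_of_ne h, subst_mul hs, subst_mul hs', subst_mul hs, subst_X hs,
          subst_X hs', hp, Function.update_of_ne h]
        ring

theorem pderiv_eq_shift (s : σ) (F : MvPowerSeries σ R) :
    pderiv R s F = shift s F + X s * pderiv R s (shift s F) := by
  ext d
  rw [map_add, coeff_pderiv, coeff_X_mul, coeff_shift]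
  by_cases h : d s = 0
  · simp [h]
  · rw [if_neg h, coeff_pderiv, coeff_shift]
    have : d - Finsupp.single s 1 + Finsupp.single s 1 = d := by
      ext t
      by_cases ht : s = t
      · subst ht; simp; omega
      · simp [ht]
    rw [this]
    have h2 : ((d s : ℕ) : R) = (((d - (Finsupp.single s 1 : σ →₀ ℕ)) s : ℕ) : R) + 1 := by
      rw [← Nat.cast_add_one]; congr 1; simp; omega
    rw [h2]; ring

theorem subst_pderiv_eq_subst_shift [Finite τ] {a : τ → MvPowerSeries σ R}
    (ha : ∀ t, constantCoeff (a t) = 0) {s : τ} (h : a s = 0) (F : MvPowerSeries τ R) :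
    (pderiv R s F).subst a = (shift s F).subst a := by
  have hs := hasSubst_zero ha
  rw [pderiv_eq_shift, subst_add hs, subst_mul hs, subst_X hs, h, zero_mul, add_zero]

end Formal
end Artin

namespace Artin
open MvPowerSeries

section Formal2

variable {R : Type*} [CommRing R] {σ τ ρ : Type*}

theorem subst_sum' [Finite τ] {a : τ → MvPowerSeries σ R}
    (ha : ∀ t, constantCoeff (a t) = 0) {ι : Type*} (s : Finset ι) (F : ι → MvPowerSeries τ R) :
    (∑ i ∈ s, F i).subst a = ∑ i ∈ s, (F i).subst a := by
  simp only [← substAlgHom_apply (hasSubst_zero ha), map_sum]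

theorem subst_subst [Finite τ] [Finite σ] {a : τ → MvPowerSeries σ R}
    {b : σ → MvPowerSeries ρ R} (ha : ∀ t, constantCoeff (a t) = 0)
    (hb : ∀ t, constantCoeff (b t) = 0) (F : MvPowerSeries τ R) :
    (F.subst a).subst b = F.subst fun t => (a t).subst b :=
  subst_comp_subst_apply (hasSubst_zero ha) (hasSubst_zero hb) F

/-- View a power series as a power series in more variables. -/
def ren (e : σ → τ) (F : MvPowerSeries σ R) : MvPowerSeries τ R :=
  F.subst fun s => (X (e s) : MvPowerSeries τ R)

theorem constantCoeff_X' (s : σ) : constantCoeff (X s : MvPowerSeries σ R) = 0 := by simp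

theorem constantCoeff_ren [Finite σ] (e : σ → τ) (F : MvPowerSeries σ R) :
    constantCoeff (ren e F) = constantCoeff F :=
  constantCoeff_subst' (fun _ => constantCoeff_X' _) F

theorem ren_subst [Finite σ] [Finite τ] (e : σ → τ) {b : τ → MvPowerSeries ρ R}
    (hb : ∀ t, constantCoeff (b t) = 0) (F : MvPowerSeries σ R) :
    (ren e F).subst b = F.subst fun s => b (e s) := by
  rw [ren, subst_subst (fun _ => constantCoeff_X' _) hb]
  congr 1; funext t; exact subst_X (hasSubst_zero hb) _

theorem subst_X_self (F : MvPowerSeries σ R) :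
    F.subst (X : σ → MvPowerSeries σ R) = F := by
  rw [subst_self]; rfl

theorem pderiv_ren [Finite σ] (e : σ → τ) (F : MvPowerSeries σ R) {t : τ}
    (ht : ∀ s, e s ≠ t) : pderiv R t (ren e F) = 0 := by
  have := Fintype.ofFinite σ
  rw [ren, pderiv_subst (fun _ => constantCoeff_X' _)]
  refine Finset.sum_eq_zero fun s _ => ?_
  rw [pderiv_X_of_ne (ht s), mul_zero]

/-- Substitute a power series for the distinguished variable. -/
def spec (p : MvPowerSeries σ R) : Option σ → MvPowerSeries σ R := fun o => o.elim p X

theorem constantCoeff_spec {p : MvPowerSeries σ R} (hp : constantCoeff p = 0) (o : Option σ) :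
    constantCoeff (spec p o) = 0 := by
  cases o with
  | none => exact hp
  | some s => exact constantCoeff_X' s

theorem ren_some_subst_spec [Finite σ] {p : MvPowerSeries σ R} (hp : constantCoeff p = 0)
    (F : MvPowerSeries σ R) : (ren some F).subst (spec p) = F := by
  rw [ren_subst _ (constantCoeff_spec hp)]
  exact subst_X_self F

/-- The generic point of the line through `a` with direction `c`. -/
def line (a c : τ → MvPowerSeries σ R) : τ → MvPowerSeries (Option σ) R :=
  fun t => ren some (a t) + X none * ren some (c t)

theorem constantCoeff_line [Finite σ] {a : τ → MvPowerSeries σ R}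
    (ha : ∀ t, constantCoeff (a t) = 0) (c : τ → MvPowerSeries σ R) (t : τ) :
    constantCoeff (line a c t) = 0 := by
  rw [line, map_add, map_mul, constantCoeff_ren, ha, constantCoeff_X', zero_mul, add_zero]

theorem line_subst_spec [Finite σ] {p : MvPowerSeries σ R} (hp : constantCoeff p = 0)
    (a c : τ → MvPowerSeries σ R) (t : τ) : (line a c t).subst (spec p) = a t + p * c t := by
  have hs := hasSubst_zero (constantCoeff_spec hp)
  rw [line, subst_add hs, subst_mul hs, subst_X hs, ren_some_subst_spec hp,
    ren_some_subst_spec hp]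
  rfl

theorem update_spec [DecidableEq (Option σ)] (p : MvPowerSeries σ R) :
    Function.update (spec p) none 0 = spec 0 := by
  funext o
  cases o with
  | none => simp [spec]
  | some s => rw [Function.update_of_ne (by simp)]; rfl

/-- The second order remainder in the Taylor expansion along a line. -/
def taylorRem (a c : τ → MvPowerSeries σ R) (p : MvPowerSeries σ R) (F : MvPowerSeries τ R) :
    MvPowerSeries σ R :=
  (shift none (shift none (F.subst (line a c)))).subst (spec p)

theorem taylor_two [Finite σ] [Fintype τ] {a : τ → MvPowerSeries σ R}
    (ha : ∀ t, constantCoeff (a t) = 0) (c : τ → MvPowerSeries σ R) {p : MvPowerSeries σ R}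
    (hp : constantCoeff p = 0) (F : MvPowerSeries τ R) :
    F.subst (fun t => a t + p * c t) = F.subst a +
      p * ∑ t, (pderiv R t F).subst a * c t + p ^ 2 * taylorRem a c p F := by
  classical
  have hl := constantCoeff_line ha c
  have h0 : constantCoeff (0 : MvPowerSeries σ R) = 0 := map_zero _
  have key : ∀ {q : MvPowerSeries σ R} (hq : constantCoeff q = 0) (G : MvPowerSeries τ R),
      (G.subst (line a c)).subst (spec q) = G.subst (fun t => a t + q * c t) := by
    intro q hq G
    rw [subst_subst hl (constantCoeff_spec hq)]
    congr 1; funext t; exact line_subst_spec hq a c t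
  have key0 : ∀ G : MvPowerSeries τ R, (G.subst (line a c)).subst (spec 0) = G.subst a := by
    intro G
    rw [key h0]; simp
  rw [← key hp, subst_eq_add_shift (constantCoeff_spec hp) none, update_spec, key0,
    subst_eq_add_shift (constantCoeff_spec hp) none (shift none _), update_spec,
    ← subst_pderiv_eq_subst_shift (constantCoeff_spec h0) rfl, pderiv_subst hl]
  rw [subst_sum' (constantCoeff_spec h0)]
  have h1 : ∀ t, ((pderiv R t F).subst (line a c) * pderiv R none (line a c t)).subst (spec 0)
      = (pderiv R t F).subst a * c t := by
    intro t
    have hs := hasSubst_zero (constantCoeff_spec h0)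
    rw [subst_mul hs, key0, line, map_add, Derivation.leibniz, pderiv_ren _ _ (by simp),
      pderiv_ren _ _ (by simp), pderiv_X_self, smul_zero, zero_add, zero_add, smul_eq_mul,
      mul_one, ren_some_subst_spec h0]
  rw [Finset.sum_congr rfl fun t _ => h1 t]
  have h2 : spec p none = p := rfl
  rw [h2, taylorRem]; ring

theorem taylor_one [Finite σ] [Finite τ] {a : τ → MvPowerSeries σ R}
    (ha : ∀ t, constantCoeff (a t) = 0) (c : τ → MvPowerSeries σ R) {p : MvPowerSeries σ R}
    (hp : constantCoeff p = 0) (F : MvPowerSeries τ R) :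
    p ∣ F.subst (fun t => a t + p * c t) - F.subst a := by
  have := Fintype.ofFinite τ
  rw [taylor_two ha c hp]
  exact ⟨∑ t, (pderiv R t F).subst a * c t + p * taylorRem a c p F, by ring⟩

theorem subst_sub_subst_mem_ordIdeal [Finite τ] {a b : τ → MvPowerSeries σ R}
    (ha : ∀ t, constantCoeff (a t) = 0) (hb : ∀ t, constantCoeff (b t) = 0) {N : ℕ}
    (h : ∀ t, a t - b t ∈ ordIdeal σ R N) (F : MvPowerSeries τ R) :
    F.subst a - F.subst b ∈ ordIdeal σ R N := by
  have hs := hasSubst_zero ha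
  have hs' := hasSubst_zero hb
  have h1 := sub_truncTotal_mem F N
  set P := truncTotal N F
  have h2 : F.subst a - F.subst b = (F - (P : MvPowerSeries τ R)).subst a -
      (F - (P : MvPowerSeries τ R)).subst b +
      ((P : MvPowerSeries τ R).subst a - (P : MvPowerSeries τ R).subst b) := by
    rw [subst_sub hs, subst_sub hs']; ring
  rw [h2]
  refine add_mem (sub_mem (subst_mem_ordIdeal ha h1) (subst_mem_ordIdeal hb h1)) ?_
  clear_value P
  clear h1 h2
  induction P using MvPolynomial.induction_on with
  | C r => rw [MvPolynomial.coe_C, subst_C, subst_C, sub_self]; exact zero_mem _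
  | add p q hp hq =>
    rw [MvPolynomial.coe_add, subst_add hs, subst_add hs']
    convert add_mem hp hq using 1; ring
  | mul_X p t hp =>
    rw [MvPolynomial.coe_mul, MvPolynomial.coe_X, subst_mul hs, subst_mul hs', subst_X hs,
      subst_X hs']
    convert add_mem (Ideal.mul_mem_right (a t) _ hp)
      (Ideal.mul_mem_left _ (subst b (p : MvPowerSeries τ R)) (h t)) using 1
    ring

variable {ι : Type*}

theorem constantCoeff_elim_X {z : ι → MvPowerSeries ρ R}
    (hz : ∀ i, constantCoeff (z i) = 0) (x : ρ ⊕ ι) :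
    constantCoeff (Sum.elim X z x) = 0 := by
  cases x with
  | inl r => exact constantCoeff_X' r
  | inr i => exact hz i

theorem subst_sub_linear_mem_ordIdeal [Fintype τ] {a b : τ → MvPowerSeries σ R}
    (ha : ∀ t, constantCoeff (a t) = 0) (hb : ∀ t, constantCoeff (b t) = 0) {N : ℕ}
    (h : ∀ t, a t - b t ∈ ordIdeal σ R N) (F : MvPowerSeries τ R) :
    F.subst a - F.subst b - ∑ t, coeff (Finsupp.single t 1) F • (a t - b t)
      ∈ ordIdeal σ R (N + 1) := by
  classical
  have hs := hasSubst_zero ha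
  have hs' := hasSubst_zero hb
  have h1 := sub_truncTotal_mem F (N + 2)
  set P := truncTotal (N + 2) F with hP
  have hc : ∀ t, coeff (Finsupp.single t 1) F = coeff (Finsupp.single t 1)
      (P : MvPowerSeries τ R) := by
    intro t
    rw [MvPolynomial.coeff_coe, hP, coeff_truncTotal]
    rw [Finsupp.degree_single]; omega
  have h2 : F.subst a - F.subst b - ∑ t, coeff (Finsupp.single t 1) F • (a t - b t) =
      (F - (P : MvPowerSeries τ R)).subst a - (F - (P : MvPowerSeries τ R)).subst b +
      ((P : MvPowerSeries τ R).subst a - (P : MvPowerSeries τ R).subst b -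
        ∑ t, coeff (Finsupp.single t 1) (P : MvPowerSeries τ R) • (a t - b t)) := by
    rw [subst_sub hs, subst_sub hs', Finset.sum_congr rfl fun t _ => by rw [hc t]]; ring
  rw [h2]
  have h1' := ordIdeal_anti (Nat.le_succ (N + 1)) h1
  refine add_mem (sub_mem (subst_mem_ordIdeal ha h1') (subst_mem_ordIdeal hb h1')) ?_
  clear_value P
  clear h1 h2 hc hP h1'
  induction P using MvPolynomial.induction_on with
  | C r =>
    rw [MvPolynomial.coe_C, subst_C, subst_C, sub_self, Finset.sum_eq_zero, sub_zero]
    · exact zero_mem _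
    · intro t _
      rw [coeff_C, if_neg (by simp), zero_smul]
  | add p q hp hq =>
    rw [MvPolynomial.coe_add, subst_add hs, subst_add hs']
    simp only [map_add, add_smul, Finset.sum_add_distrib]
    convert add_mem hp hq using 1; ring
  | mul_X p t hp =>
    have h3 : ∀ s, coeff (Finsupp.single s 1) ((p : MvPowerSeries τ R) * X t) =
        if s = t then constantCoeff (p : MvPowerSeries τ R) else 0 := by
      intro s
      rw [mul_comm, coeff_X_mul, Finsupp.single_apply]
      by_cases hst : s = t
      · subst hst; simp [← coeff_zero_eq_constantCoeff_apply]
      · simp [hst]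
    rw [MvPolynomial.coe_mul, MvPolynomial.coe_X, subst_mul hs, subst_mul hs', subst_X hs,
      subst_X hs']
    simp only [h3, ite_smul, zero_smul, Finset.sum_ite_eq', Finset.mem_univ, if_true]
    have h4 := mul_mem_ordIdeal
      (subst_sub_subst_mem_ordIdeal ha hb h (p : MvPowerSeries τ R)) (mem_ordIdeal_one.2 (ha t))
    have h5 : subst b (p : MvPowerSeries τ R) - C (constantCoeff (p : MvPowerSeries τ R)) ∈
        ordIdeal σ R 1 := by
      rw [mem_ordIdeal_one, map_sub, constantCoeff_subst' hb]; simp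
    have h6 := mul_mem_ordIdeal (h t) h5
    convert add_mem h4 h6 using 1
    rw [smul_eq_C_mul]; ring

theorem contraction [Finite ρ] [Finite ι] {G : MvPowerSeries (ρ ⊕ ι) R}
    (hG : ∀ i, coeff (Finsupp.single (Sum.inr i) 1) G = 0)
    {z z' : ι → MvPowerSeries ρ R} (hz : ∀ i, constantCoeff (z i) = 0)
    (hz' : ∀ i, constantCoeff (z' i) = 0) {N : ℕ} (h : ∀ i, z i - z' i ∈ ordIdeal ρ R N) :
    G.subst (Sum.elim X z) - G.subst (Sum.elim X z') ∈ ordIdeal ρ R (N + 1) := by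
  have := Fintype.ofFinite ρ
  have := Fintype.ofFinite ι
  have hd : ∀ x, Sum.elim (X : ρ → MvPowerSeries ρ R) z x - Sum.elim X z' x ∈
      ordIdeal ρ R N := by
    rintro (r | i)
    · simp
    · exact h i
  have h1 := subst_sub_linear_mem_ordIdeal (constantCoeff_elim_X hz)
    (constantCoeff_elim_X hz') hd G
  rwa [Finset.sum_eq_zero, sub_zero] at h1
  rintro (r | i) _
  · simp
  · rw [hG, zero_smul]

/-- Hypotheses of the formal implicit function theorem for the system `z = G(u, z)`. -/
structure IFTData (G : ι → MvPowerSeries (ρ ⊕ ι) R) : Prop where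
  const : ∀ i, constantCoeff (G i) = 0
  lin : ∀ i j, coeff (Finsupp.single (Sum.inr j) 1) (G i) = 0

theorem IFTData.unique [Finite ρ] [Finite ι] {G : ι → MvPowerSeries (ρ ⊕ ι) R} (hG : IFTData G)
    {z z' : ι → MvPowerSeries ρ R} (hz : ∀ i, constantCoeff (z i) = 0)
    (hz' : ∀ i, constantCoeff (z' i) = 0) (h : ∀ i, z i = (G i).subst (Sum.elim X z))
    (h' : ∀ i, z' i = (G i).subst (Sum.elim X z')) : z = z' := by
  have key : ∀ N i, z i - z' i ∈ ordIdeal ρ R N := by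
    intro N
    induction N with
    | zero => exact fun i => mem_ordIdeal_zero _
    | succ N ih =>
      intro i
      rw [h i, h' i]
      exact contraction (hG.lin i) hz hz' ih
  funext i
  exact sub_eq_zero.1 (eq_zero_of_forall_mem_ordIdeal fun N => key N i)

/-- The iterates of the map `z ↦ G(u, z)`. -/
def iftIter (G : ι → MvPowerSeries (ρ ⊕ ι) R) : ℕ → ι → MvPowerSeries ρ R
  | 0 => 0
  | n + 1 => fun i => (G i).subst (Sum.elim X (iftIter G n))

theorem IFTData.exists_solution [Finite ρ] [Finite ι] {G : ι → MvPowerSeries (ρ ⊕ ι) R}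
    (hG : IFTData G) : ∃ z : ι → MvPowerSeries ρ R, (∀ i, constantCoeff (z i) = 0) ∧
      ∀ i, z i = (G i).subst (Sum.elim X z) := by
  have hc : ∀ n i, constantCoeff (iftIter G n i) = 0 := by
    intro n
    induction n with
    | zero => intro i; exact map_zero _
    | succ n ih =>
      intro i
      rw [iftIter, constantCoeff_subst' (constantCoeff_elim_X ih), hG.const]
  have h1 : ∀ n i, iftIter G (n + 1) i - iftIter G n i ∈ ordIdeal ρ R (n + 1) := by
    intro n
    induction n with
    | zero =>
      intro i
      rw [mem_ordIdeal_one, map_sub, hc, hc, sub_zero]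
    | succ n ih =>
      intro i
      exact contraction (hG.lin i) (hc _) (hc _) ih
  have h2 : ∀ n k i, iftIter G (n + k) i - iftIter G n i ∈ ordIdeal ρ R (n + 1) := by
    intro n k i
    induction k with
    | zero => simp
    | succ k ih =>
      have := add_mem (ordIdeal_anti (by omega) (h1 (n + k) i)) ih
      rwa [sub_add_sub_cancel] at this
  let z : ι → MvPowerSeries ρ R := fun i d => coeff d (iftIter G d.degree i)
  have hzd : ∀ i d, coeff d (z i) = coeff d (iftIter G d.degree i) := fun _ _ => rfl
  have h3 : ∀ n i, z i - iftIter G n i ∈ ordIdeal ρ R (n + 1) := by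
    intro n i d hd
    obtain ⟨k, rfl⟩ := Nat.exists_eq_add_of_le (Nat.lt_succ_iff.1 hd)
    have := h2 d.degree k i d (Nat.lt_succ_self _)
    rw [map_sub, sub_eq_zero] at this
    rw [map_sub, hzd, this, sub_self]
  have hz0 : ∀ i, constantCoeff (z i) = 0 := by
    intro i
    have := mem_ordIdeal_one.1 (h3 0 i)
    rwa [map_sub, hc, sub_zero] at this
  refine ⟨z, hz0, fun i => sub_eq_zero.1 (eq_zero_of_forall_mem_ordIdeal fun N => ?_)⟩
  have h4 := ordIdeal_anti (by omega : N ≤ N + 1 + 1) (h3 (N + 1) i)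
  have h5 := contraction (hG.lin i) hz0 (hc N) (fun i => ordIdeal_anti (Nat.le_succ N) (h3 N i))
  have h6 := sub_mem h4 (ordIdeal_anti (Nat.le_succ N) h5)
  convert h6 using 1
  rw [iftIter]; ring

end Formal2
end Artin

namespace Artin
open MvPowerSeries

section Formal3

variable {R : Type*} [CommRing R] {σ τ ρ : Type*}

/-- Reindexing of the coefficients of a power series, with integer weights. -/
def reindex (N : (ρ →₀ ℕ) → ℤ) (φ : (ρ →₀ ℕ) → (σ →₀ ℕ)) (F : MvPowerSeries σ R) :
    MvPowerSeries ρ R := fun β => (N β : R) * coeff (φ β) F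

theorem coeff_reindex (N : (ρ →₀ ℕ) → ℤ) (φ : (ρ →₀ ℕ) → (σ →₀ ℕ)) (F : MvPowerSeries σ R)
    (β : ρ →₀ ℕ) : coeff β (reindex N φ F) = (N β : R) * coeff (φ β) F := rfl

theorem coeff_single_one (s : σ) (F : MvPowerSeries σ R) :
    coeff (Finsupp.single s 1) F = constantCoeff (pderiv R s F) := by
  rw [← coeff_zero_eq_constantCoeff_apply, coeff_pderiv]; simp

end Formal3

/-- A system of rings of power series closed under composition, linear operations on
coefficients of controlled growth, and the implicit function theorem. -/
structure System (K : Type) [Field K] where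
  A : ∀ (σ : Type) [Finite σ], Subalgebra K (MvPowerSeries σ K)
  X_mem : ∀ {σ : Type} [Finite σ] (s : σ), X s ∈ A σ
  subst_mem : ∀ {σ τ : Type} [Finite σ] [Finite τ] {a : τ → MvPowerSeries σ K},
    (∀ t, a t ∈ A σ) → (∀ t, constantCoeff (a t) = 0) →
    ∀ {F : MvPowerSeries τ K}, F ∈ A τ → F.subst a ∈ A σ
  reindex_mem : ∀ {σ ρ : Type} [Finite σ] [Finite ρ] (N : (ρ →₀ ℕ) → ℤ)
    (φ : (ρ →₀ ℕ) → (σ →₀ ℕ)) (B : ℕ), (∀ β, |N β| ≤ (B : ℤ) ^ (β.degree + 1)) →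
    (∀ β, (φ β).degree ≤ B * (β.degree + 1)) →
    ∀ {F : MvPowerSeries σ K}, F ∈ A σ → reindex N φ F ∈ A ρ
  ift_mem : ∀ {ρ ι : Type} [Finite ρ] [Finite ι] {G : ι → MvPowerSeries (ρ ⊕ ι) K},
    IFTData G → (∀ i, G i ∈ A (ρ ⊕ ι)) → ∀ {z : ι → MvPowerSeries ρ K},
    (∀ i, constantCoeff (z i) = 0) → (∀ i, z i = (G i).subst (Sum.elim X z)) →
    ∀ i, z i ∈ A ρ

/-- The system of all formal power series. -/
def System.formal (K : Type) [Field K] : System K where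
  A _ _ := ⊤
  X_mem _ := Algebra.mem_top
  subst_mem _ _ _ _ := Algebra.mem_top
  reindex_mem _ _ _ _ _ _ _ := Algebra.mem_top
  ift_mem _ _ _ _ _ _ := Algebra.mem_top

namespace System

variable {K : Type} [Field K] (S : System K) {σ τ ρ ι : Type} [Finite σ] [Finite τ] [Finite ρ]
  [Finite ι]

theorem C_mem (r : K) : (C r : MvPowerSeries σ K) ∈ S.A σ := (S.A σ).algebraMap_mem r

theorem ren_mem (e : σ → τ) {F : MvPowerSeries σ K} (hF : F ∈ S.A σ) : ren e F ∈ S.A τ :=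
  S.subst_mem (fun _ => S.X_mem _) (fun _ => constantCoeff_X' _) hF

theorem shift_mem (s : σ) {F : MvPowerSeries σ K} (hF : F ∈ S.A σ) : shift s F ∈ S.A σ := by
  convert S.reindex_mem (fun _ => 1) (fun d => d + Finsupp.single s 1) 1 ?_ ?_ hF using 1
  · ext d; rw [coeff_reindex, coeff_shift]; simp
  · intro β; simp
  · intro β; rw [map_add, Finsupp.degree_single]; omega

theorem pderiv_mem (s : σ) {F : MvPowerSeries σ K} (hF : F ∈ S.A σ) : pderiv K s F ∈ S.A σ := by
  convert S.reindex_mem (fun d => d s + 1) (fun d => d + Finsupp.single s 1) 2 ?_ ?_ hF using 1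
  · ext d; rw [coeff_reindex, coeff_pderiv]; push_cast; ring
  · intro β
    have h1 : β s < 2 ^ β.degree :=
      lt_of_le_of_lt (Finsupp.le_degree s β) Nat.lt_two_pow_self
    have h2 : (β s : ℤ) < 2 ^ β.degree := by exact_mod_cast h1
    rw [abs_of_nonneg (by positivity), pow_succ]
    push_cast
    have : (1:ℤ) ≤ 2 ^ β.degree := one_le_pow₀ (by norm_num)
    linarith
  · intro β; rw [map_add, Finsupp.degree_single]; omega

theorem det_mem {n : ℕ} {M : Matrix (Fin n) (Fin n) (MvPowerSeries σ K)}
    (h : ∀ i j, M i j ∈ S.A σ) : M.det ∈ S.A σ := by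
  rw [Matrix.det_apply]
  refine sum_mem fun p _ => ?_
  rw [Units.smul_def]
  exact zsmul_mem (prod_mem fun i _ => h _ _) _

theorem adjugate_mem {n : ℕ} {M : Matrix (Fin n) (Fin n) (MvPowerSeries σ K)}
    (h : ∀ i j, M i j ∈ S.A σ) (i j : Fin n) : M.adjugate i j ∈ S.A σ := by
  rw [Matrix.adjugate_apply]
  refine S.det_mem fun k l => ?_
  rw [Matrix.updateRow_apply]
  split_ifs
  · by_cases hl : l = i
    · subst hl; rw [Pi.single_eq_same]; exact one_mem _
    · rw [Pi.single_eq_of_ne hl]; exact zero_mem _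
  · exact h _ _

theorem taylorRem_mem {a c : τ → MvPowerSeries σ K} (ha0 : ∀ t, constantCoeff (a t) = 0)
    (ha : ∀ t, a t ∈ S.A σ)
    (hc : ∀ t, c t ∈ S.A σ) {p : MvPowerSeries σ K} (hp0 : constantCoeff p = 0)
    (hp : p ∈ S.A σ) {F : MvPowerSeries τ K} (hF : F ∈ S.A τ) :
    taylorRem a c p F ∈ S.A σ := by
  refine S.subst_mem ?_ (constantCoeff_spec hp0) (S.shift_mem _ (S.shift_mem _
    (S.subst_mem (fun t => ?_) (constantCoeff_line ha0 c) hF)))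
  · rintro (_ | s)
    · exact hp
    · exact S.X_mem s
  · exact add_mem (S.ren_mem _ (ha t)) (mul_mem (S.X_mem _) (S.ren_mem _ (hc t)))

theorem inv_mem {F : MvPowerSeries σ K} (hF : F ∈ S.A σ) (h0 : constantCoeff F ≠ 0) :
    F⁻¹ ∈ S.A σ := by
  set c := constantCoeff F with hc
  let G : Unit → MvPowerSeries (σ ⊕ Unit) K := fun _ =>
    - C c⁻¹ * (ren Sum.inl F - C c) * (C c⁻¹ + X (Sum.inr ()))
  have hG : IFTData G := by
    refine ⟨fun _ => ?_, fun _ j => ?_⟩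
    · simp [G, constantCoeff_ren, hc]
    · rw [coeff_single_one]
      simp only [G, Derivation.leibniz, map_add, map_sub, map_neg, pderiv_C, smul_eq_mul,
        constantCoeff_ren, map_mul]
      rw [pderiv_ren _ _ (by simp)]
      simp [hc]
  have hGA : ∀ i, G i ∈ S.A _ := fun _ =>
    mul_mem (mul_mem (neg_mem (S.C_mem _)) (sub_mem (S.ren_mem _ hF) (S.C_mem _)))
      (add_mem (S.C_mem _) (S.X_mem _))
  have hFi : F⁻¹ * F = 1 := MvPowerSeries.inv_mul_cancel _ h0
  let z : Unit → MvPowerSeries σ K := fun _ => F⁻¹ - C c⁻¹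
  have hz0 : ∀ i, constantCoeff (z i) = 0 := fun _ => by simp [z, hc]
  have hzA := S.ift_mem hG hGA hz0 ?_ ()
  · have : F⁻¹ = z () + C c⁻¹ := by simp [z]
    rw [this]; exact add_mem hzA (S.C_mem _)
  · intro i
    have hs := hasSubst_zero (constantCoeff_elim_X hz0)
    simp only [G]
    rw [subst_mul hs, subst_mul hs, subst_add hs, subst_sub hs, subst_X hs, ← substAlgHom_apply hs (-C c⁻¹),
      map_neg, substAlgHom_apply hs, subst_C, subst_C, ren_subst _ (constantCoeff_elim_X hz0)]
    have h1 : (subst (fun s : σ => Sum.elim (X : σ → MvPowerSeries σ K) z (Sum.inl s)) F) = F :=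
      subst_X_self F
    have h2 : (C c⁻¹ * C c : MvPowerSeries σ K) = 1 := by
      rw [← map_mul, inv_mul_cancel₀ h0, map_one]
    rw [h1]
    simp only [z, Sum.elim_inr]
    linear_combination C c⁻¹ * hFi - (F⁻¹) * h2


/-- Newton's lemma of Tougeron: an approximate solution of a system with Jacobian minor `δ`,
with error divisible by `δ ^ 2`, can be corrected to a solution. -/
theorem tougeron {n : ℕ} {f : Fin n → MvPowerSeries τ K} (hf : ∀ i, f i ∈ S.A τ)
    {a : τ → MvPowerSeries σ K} (ha0 : ∀ t, constantCoeff (a t) = 0) (ha : ∀ t, a t ∈ S.A σ)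
    (e : Fin n → τ) {δ : MvPowerSeries σ K}
    (hδ : δ = (Matrix.of fun i b => (pderiv K (e b) (f i)).subst a).det)
    {p : MvPowerSeries σ K} (hp0 : constantCoeff p = 0) (hp : p ∈ S.A σ)
    {ε : Fin n → MvPowerSeries σ K} (hε : ∀ i, ε i ∈ S.A σ)
    (hfa : ∀ i, (f i).subst a = δ ^ 2 * p * ε i) :
    ∃ c : τ → MvPowerSeries σ K, (∀ t, c t ∈ S.A σ) ∧ (∀ t, (∀ b, e b ≠ t) → c t = 0) ∧
      ∀ i, (f i).subst (fun t => a t + δ * p * c t) = 0 := by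
  classical
  have := Fintype.ofFinite τ
  -- pass to the ring with additional unknowns `z`
  let u : MvPowerSeries σ K →ₐ[K] MvPowerSeries (σ ⊕ Fin n) K :=
    substAlgHom (hasSubst_zero fun s : σ => constantCoeff_X' (R := K) (Sum.inl s : σ ⊕ Fin n))
  have hu : ∀ F, u F = ren Sum.inl F := fun F => substAlgHom_apply _ F
  have huA : ∀ {F}, F ∈ S.A σ → u F ∈ S.A _ := fun {F} hF => by rw [hu]; exact S.ren_mem _ hF
  have hu0 : ∀ F, constantCoeff (u F) = constantCoeff F := fun F => by
    rw [hu, constantCoeff_ren]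
  let J : Matrix (Fin n) (Fin n) (MvPowerSeries σ K) :=
    Matrix.of fun i b => (pderiv K (e b) (f i)).subst a
  have hJA : ∀ i b, J i b ∈ S.A σ := fun i b => S.subst_mem ha ha0 (S.pderiv_mem _ (hf i))
  have hδA : δ ∈ S.A σ := by rw [hδ]; exact S.det_mem hJA
  let w : Fin n → MvPowerSeries (σ ⊕ Fin n) K := fun i => X (Sum.inr i) - u (ε i)
  let cb : Fin n → MvPowerSeries (σ ⊕ Fin n) K := (u.mapMatrix J.adjugate).mulVec w
  let c : τ → MvPowerSeries (σ ⊕ Fin n) K := fun t => ∑ b, if e b = t then cb b else 0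
  have hcb : ∀ b, cb b = ∑ i, u (J.adjugate b i) * w i := fun _ => rfl
  have hcbA : ∀ b, cb b ∈ S.A _ := fun b => by
    rw [hcb]
    exact sum_mem fun i _ => mul_mem
      (huA (S.adjugate_mem hJA _ _)) (sub_mem (S.X_mem _) (huA (hε i)))
  have hcA : ∀ t, c t ∈ S.A _ := fun t => sum_mem fun b _ => by
    split_ifs
    · exact hcbA b
    · exact zero_mem _
  have hua0 : ∀ t, constantCoeff (u (a t)) = 0 := fun t => by rw [hu0, ha0]
  have hq0 : constantCoeff (u (δ * p)) = 0 := by rw [hu0, map_mul, hp0, mul_zero]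
  have hqA : u (δ * p) ∈ S.A _ := huA (mul_mem hδA hp)
  let Q : Fin n → MvPowerSeries (σ ⊕ Fin n) K := fun i =>
    taylorRem (fun t => u (a t)) c (u (δ * p)) (f i)
  have hQA : ∀ i, Q i ∈ S.A _ := fun i =>
    S.taylorRem_mem hua0 (fun t => huA (ha t)) hcA hq0 hqA (hf i)
  have hsu : ∀ F : MvPowerSeries τ K, F.subst (fun t => u (a t)) = u (F.subst a) := by
    intro F
    simp only [hu]
    exact (subst_subst ha0 (fun _ => constantCoeff_X' _) F).symm
  have expand : ∀ i, (f i).subst (fun t => u (a t) + u (δ * p) * c t) =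
      u (δ ^ 2 * p) * (X (Sum.inr i) + u p * Q i) := by
    intro i
    rw [taylor_two hua0 c hq0]
    have h1 : ∑ t, (pderiv K t (f i)).subst (fun t => u (a t)) * c t = u δ * w i := by
      have h2 : ∑ t, (pderiv K t (f i)).subst (fun t => u (a t)) * c t =
          ∑ b, u (J i b) * cb b := by
        simp only [c, Finset.mul_sum]
        rw [Finset.sum_comm]
        refine Finset.sum_congr rfl fun b _ => ?_
        rw [Finset.sum_eq_single (e b)]
        · rw [if_pos rfl, hsu]; rfl
        · intro t _ ht; rw [if_neg ht.symm, mul_zero]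
        · simp
      rw [h2]
      have h3 : ((u.mapMatrix J).mulVec cb) i = u δ * w i := by
        simp only [cb]
        rw [Matrix.mulVec_mulVec, ← map_mul, Matrix.mul_adjugate, ← hδ]
        have h4 : u.mapMatrix (δ • (1 : Matrix (Fin n) (Fin n) (MvPowerSeries σ K))) =
            u δ • (1 : Matrix (Fin n) (Fin n) (MvPowerSeries (σ ⊕ Fin n) K)) := by
          ext i j
          simp [Matrix.one_apply, apply_ite u]
        rw [h4, Matrix.smul_mulVec, Matrix.one_mulVec]; rfl
      exact h3
    rw [h1, hsu, hfa]
    simp only [w, map_mul, map_pow, Q]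
    ring
  let G : Fin n → MvPowerSeries (σ ⊕ Fin n) K := fun i => - (u p * Q i)
  have hG : IFTData G := by
    refine ⟨fun i => ?_, fun i j => ?_⟩
    · simp only [G, map_neg, map_mul, hu0, hp0, zero_mul, neg_zero]
    · rw [coeff_single_one]
      simp only [G, map_neg, Derivation.leibniz, smul_eq_mul, map_add, map_mul, hu0, hp0]
      rw [hu, pderiv_ren _ _ (by simp)]
      simp
  have hGA : ∀ i, G i ∈ S.A _ := fun i => neg_mem (mul_mem (huA hp) (hQA i))
  obtain ⟨z, hz0, hz⟩ := hG.exists_solution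
  have hzA := S.ift_mem hG hGA hz0 hz
  have hE := constantCoeff_elim_X (ρ := σ) hz0
  have hsE := hasSubst_zero hE
  have hEA : ∀ x, Sum.elim (X : σ → MvPowerSeries σ K) z x ∈ S.A σ := by
    rintro (s | i)
    · exact S.X_mem s
    · exact hzA i
  have huE : ∀ F, (u F).subst (Sum.elim (X : σ → MvPowerSeries σ K) z) = F := by
    intro F
    rw [hu, ren_subst _ hE]
    exact subst_X_self F
  refine ⟨fun t => (c t).subst (Sum.elim X z), fun t => S.subst_mem hEA hE (hcA t), ?_, ?_⟩
  · intro t ht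
    have : c t = 0 := Finset.sum_eq_zero fun b _ => if_neg (ht b)
    simp only [this]
    rw [← substAlgHom_apply hsE, map_zero]
  · intro i
    have h1 := congrArg (subst (Sum.elim (X : σ → MvPowerSeries σ K) z)) (expand i)
    rw [subst_subst _ hE, subst_mul hsE, subst_add hsE, subst_mul hsE, huE, huE,
      subst_X hsE] at h1
    · simp only [subst_add hsE, subst_mul hsE, huE] at h1
      rw [h1, Sum.elim_inr]
      have h2 := hz i
      simp only [G] at h2
      rw [← substAlgHom_apply hsE, map_neg, substAlgHom_apply hsE, subst_mul hsE, huE] at h2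
      rw [h2]; ring
    · intro t
      rw [map_add, map_mul, hua0, hq0, zero_mul, add_zero]

end System
end Artin

namespace Artin
open MvPowerSeries

section Formal4

variable {R : Type*} [CommRing R] {σ τ ρ : Type*}

theorem ren_eq_rename [Finite σ] (e : σ → τ) (F : MvPowerSeries σ R) :
    ren e F = rename e F := by
  rw [rename_eq_subst]; rfl

theorem coeff_ren_mapDomain [Finite σ] {e : σ → τ} (he : Function.Injective e)
    (F : MvPowerSeries σ R) (d : σ →₀ ℕ) :
    coeff (Finsupp.mapDomain e d) (ren e F) = coeff d F := by
  rw [ren_eq_rename]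
  have := coeff_embDomain_rename ⟨e, he⟩ F d
  rw [Finsupp.embDomain_eq_mapDomain] at this
  exact this

theorem coeff_ren_eq_zero [Finite σ] (e : σ → τ) (F : MvPowerSeries σ R) {d : τ →₀ ℕ} {t : τ}
    (ht : ∀ s, e s ≠ t) (hd : d t ≠ 0) : coeff d (ren e F) = 0 := by
  rw [ren_eq_rename]
  refine coeff_rename_eq_zero _ _ ?_
  rintro ⟨x, rfl⟩
  refine hd (Finsupp.mapDomain_of_notMem_range _ _ ?_)
  rintro ⟨s, hs⟩
  exact ht s hs

theorem coeff_X_pow_mul (s : σ) (k : ℕ) (F : MvPowerSeries σ R) (d : σ →₀ ℕ) :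
    coeff d (X s ^ k * F) = if k ≤ d s then coeff (d - Finsupp.single s k) F else 0 := by
  classical
  rw [X_pow_eq, coeff_monomial_mul, one_mul]
  congr 1
  rw [eq_iff_iff]
  constructor
  · intro h; simpa using h s
  · intro h t
    by_cases ht : s = t
    · subst ht; simpa using h
    · simp [ht]

/-- The generic monic polynomial of degree `D` in the distinguished variable, with coefficients
`a` -/
def monicW (D : ℕ) (a : Fin D → MvPowerSeries σ R) : MvPowerSeries (Option σ) R :=
  X none ^ D + ∑ j : Fin D, ren some (a j) * X none ^ (j : ℕ)

/-- The polynomial of degree less than `D` in the distinguished variable with coefficients `a`. -/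
def lowPoly (D : ℕ) (a : Fin D → MvPowerSeries σ R) : MvPowerSeries (Option σ) R :=
  ∑ j : Fin D, ren some (a j) * X none ^ (j : ℕ)

theorem constantCoeff_lowPoly [Finite σ] {D : ℕ} {a : Fin D → MvPowerSeries σ R}
    (h : ∀ j : Fin D, (j : ℕ) = 0 → constantCoeff (a j) = 0) :
    constantCoeff (lowPoly D a) = 0 := by
  rw [lowPoly, map_sum]
  refine Finset.sum_eq_zero fun j _ => ?_
  rw [map_mul, constantCoeff_ren, map_pow, constantCoeff_X']
  by_cases hj : (j : ℕ) = 0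
  · rw [h j hj, zero_mul]
  · rw [zero_pow hj, mul_zero]

theorem eq_lowPoly [Finite σ] (D : ℕ) {E : MvPowerSeries (Option σ) R}
    (hE : ∀ d : Option σ →₀ ℕ, D ≤ d none → coeff d E = 0) :
    E = lowPoly D fun j => ((shift none)^[(j : ℕ)] E).subst (spec 0) := by
  classical
  have h0 : constantCoeff (0 : MvPowerSeries σ R) = 0 := map_zero _
  have step : ∀ F : MvPowerSeries (Option σ) R,
      F = ren some (F.subst (spec 0)) + X none * shift none F := by
    intro F
    have h := subst_eq_add_shift (fun o : Option σ => constantCoeff_X' (R := R) o) none F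
    rw [subst_X_self, subst_X_self] at h
    rw [ren, subst_subst (constantCoeff_spec h0) (fun _ => constantCoeff_X' _)]
    convert h using 3
    funext o
    have hs := hasSubst_zero fun s : σ => constantCoeff_X' (R := R) (some s)
    cases o with
    | none =>
      rw [Function.update_self]
      change subst _ (0 : MvPowerSeries σ R) = 0
      rw [← substAlgHom_apply hs, map_zero]
    | some s =>
      rw [Function.update_of_ne (by simp)]
      exact subst_X hs s
  have key : ∀ n, E = (∑ j ∈ Finset.range n,
      ren some (((shift none)^[j] E).subst (spec 0)) * X none ^ j) +
      X none ^ n * (shift none)^[n] E := by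
    intro n
    induction n with
    | zero => simp
    | succ n ih =>
      rw [Finset.sum_range_succ]
      conv_lhs => rw [ih, step ((shift none)^[n] E)]
      rw [Function.iterate_succ_apply']
      ring
  have hco : ∀ n (F : MvPowerSeries (Option σ) R) d,
      coeff d ((shift none)^[n] F) = coeff (d + Finsupp.single none n) F := by
    intro n
    induction n with
    | zero => intro F d; simp
    | succ n ih =>
      intro F d
      rw [Function.iterate_succ_apply', coeff_shift, ih, add_assoc, ← Finsupp.single_add,
        add_comm 1 n]
  have hz : (shift none)^[D] E = 0 := by
    ext d
    rw [hco, hE _ (by simp)]; simp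
  have h1 := key D
  rw [hz, mul_zero, add_zero] at h1
  rw [lowPoly]
  conv_lhs => rw [h1]
  exact (Finset.sum_range _)

end Formal4
end Artin

namespace Artin
open MvPowerSeries

section Division

/-- The coefficients of the inverse of `1 + X_0 + ... + X_{D-1}`. -/
def altCoeff (D : ℕ) (γ : Fin D →₀ ℕ) : ℤ :=
  coeff γ (invOfUnit (1 + ∑ j : Fin D, X j : MvPowerSeries (Fin D) ℤ) 1)

theorem altCoeff_rec (D : ℕ) (γ : Fin D →₀ ℕ) :
    altCoeff D γ + ∑ j : Fin D,
      (if γ j = 0 then 0 else altCoeff D (γ - Finsupp.single j 1)) = if γ = 0 then 1 else 0 := by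
  have h := mul_invOfUnit (1 + ∑ j : Fin D, X j : MvPowerSeries (Fin D) ℤ) 1 (by simp)
  have h2 := congrArg (coeff γ) h
  rw [add_mul, one_mul, Finset.sum_mul, map_add, map_sum, coeff_one] at h2
  simp only [coeff_X_mul] at h2
  exact h2

theorem abs_altCoeff_le (D : ℕ) (γ : Fin D →₀ ℕ) : |altCoeff D γ| ≤ (D : ℤ) ^ γ.degree := by
  induction hn : γ.degree generalizing γ with
  | zero =>
    have h0 : γ = 0 := (Finsupp.degree_eq_zero_iff _).1 hn
    subst h0
    have := altCoeff_rec D 0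
    simp at this
    simp [this]
  | succ n ih =>
    have hγ : γ ≠ 0 := by rintro rfl; simp at hn
    have h := altCoeff_rec D γ
    rw [if_neg hγ] at h
    rw [eq_neg_of_add_eq_zero_left h, abs_neg]
    refine (Finset.abs_sum_le_sum_abs _ _).trans ?_
    have : ∀ j ∈ (Finset.univ : Finset (Fin D)),
        |(if γ j = 0 then (0:ℤ) else altCoeff D (γ - Finsupp.single j 1))| ≤ (D : ℤ) ^ n := by
      intro j _
      split_ifs with hj
      · simp
      · apply ih
        have h1 : γ - Finsupp.single j 1 + Finsupp.single j 1 = γ :=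
          tsub_add_cancel_of_le (by simpa using Nat.one_le_iff_ne_zero.2 hj)
        have h2 := congrArg Finsupp.degree h1
        rw [map_add, Finsupp.degree_single, hn] at h2
        omega
    refine (Finset.sum_le_sum this).trans ?_
    rw [Finset.sum_const, Finset.card_univ, Fintype.card_fin, pow_succ, nsmul_eq_mul, mul_comm]

variable {R : Type*} [CommRing R] {σ : Type*} [Finite σ] {D : ℕ}

/-- The part of an exponent belonging to the generic coefficients. -/
def genPart (d : Option (σ ⊕ Fin D) →₀ ℕ) : Fin D →₀ ℕ :=
  Finsupp.equivFunOnFinite.symm fun j => d (some (Sum.inr j))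

/-- The exponent of the dividend contributing to a given exponent. -/
def divExp (d : Option (σ ⊕ Fin D) →₀ ℕ) : Option σ →₀ ℕ :=
  Finsupp.equivFunOnFinite.symm fun o => o.elim
    (d none + ∑ j : Fin D, d (some (Sum.inr j)) * (D - j)) (fun s => d (some (Sum.inl s)))

omit [Finite σ] in
theorem genPart_apply (d : Option (σ ⊕ Fin D) →₀ ℕ) (j : Fin D) :
    genPart d j = d (some (Sum.inr j)) := rfl

theorem divExp_none (d : Option (σ ⊕ Fin D) →₀ ℕ) :
    divExp d none = d none + ∑ j : Fin D, d (some (Sum.inr j)) * (D - j) := rfl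

theorem divExp_some (d : Option (σ ⊕ Fin D) →₀ ℕ) (s : σ) :
    divExp d (some s) = d (some (Sum.inl s)) := rfl

/-- The quotient of the division by the generic monic polynomial. -/
def divQ (D : ℕ) (F : MvPowerSeries (Option σ) R) : MvPowerSeries (Option (σ ⊕ Fin D)) R :=
  reindex (fun d => altCoeff D (genPart d)) (fun d => divExp (d + Finsupp.single none D)) F

theorem genPart_degree_le (d : Option (σ ⊕ Fin D) →₀ ℕ) : (genPart d).degree ≤ d.degree := by
  classical
  have := Fintype.ofFinite σ
  rw [Finsupp.degree_eq_sum, Finsupp.degree_eq_sum, Fintype.sum_option, Fintype.sum_sum_type]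
  simp only [genPart_apply]
  omega

theorem divExp_degree_le (d : Option (σ ⊕ Fin D) →₀ ℕ) :
    (divExp d).degree ≤ (D + 1) * d.degree := by
  classical
  have := Fintype.ofFinite σ
  rw [Finsupp.degree_eq_sum, Finsupp.degree_eq_sum, Fintype.sum_option, Fintype.sum_option,
    Fintype.sum_sum_type]
  simp only [divExp_none, divExp_some]
  have : ∑ j : Fin D, d (some (Sum.inr j)) * (D - j) ≤
      D * ∑ j : Fin D, d (some (Sum.inr j)) := by
    rw [Finset.mul_sum]
    refine Finset.sum_le_sum fun j _ => ?_
    rw [mul_comm]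
    exact Nat.mul_le_mul_right _ (Nat.sub_le _ _)
  revert this
  generalize (∑ j : Fin D, d (some (Sum.inr j)) * (D - (j : ℕ))) = x
  generalize (∑ j : Fin D, d (some (Sum.inr j))) = y
  generalize (∑ s, d (some (Sum.inl s : σ ⊕ Fin D))) = z
  intro h
  nlinarith [Nat.zero_le (D * d none), Nat.zero_le (D * z)]

theorem coeff_divQ_mul (F : MvPowerSeries (Option σ) R) (d : Option (σ ⊕ Fin D) →₀ ℕ) :
    coeff d (divQ D F * monicW D fun j => X (Sum.inr j)) =
      (if D ≤ d none then coeff (d - Finsupp.single none D) (divQ D F) else 0) +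
      ∑ j : Fin D, if d (some (Sum.inr j)) = 0 then 0 else if (j : ℕ) ≤ d none then
        coeff (d - Finsupp.single (some (Sum.inr j)) 1 - Finsupp.single none (j : ℕ)) (divQ D F)
        else 0 := by
  rw [mul_comm, monicW, add_mul, Finset.sum_mul, map_add, map_sum, coeff_X_pow_mul]
  congr 1
  refine Finset.sum_congr rfl fun j _ => ?_
  rw [ren, subst_X (hasSubst_zero fun _ => constantCoeff_X' _), mul_assoc, coeff_X_mul]
  refine if_congr Iff.rfl rfl ?_
  rw [coeff_X_pow_mul]
  simp

theorem coeff_ren_inl (F : MvPowerSeries (Option σ) R) (d : Option (σ ⊕ Fin D) →₀ ℕ) :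
    coeff d (ren (Option.map Sum.inl) F) = if genPart d = 0 then coeff (divExp d) F else 0 := by
  split_ifs with h
  · have hg : ∀ j, d (some (Sum.inr j)) = 0 := fun j => by
      rw [← genPart_apply, h]; rfl
    have hinj : Function.Injective (Option.map (Sum.inl : σ → σ ⊕ Fin D)) :=
      Option.map_injective Sum.inl_injective
    have : d = Finsupp.mapDomain (Option.map Sum.inl) (divExp d) := by
      ext o
      rcases o with _ | s | j
      · have := Finsupp.mapDomain_apply hinj (divExp d) none
        rw [Option.map_none] at this
        rw [this, divExp_none]; simp [hg]
      · have := Finsupp.mapDomain_apply hinj (divExp d) (some s)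
        rw [Option.map_some] at this
        rw [this, divExp_some]
      · rw [hg, Finsupp.mapDomain_of_notMem_range]
        rintro ⟨_ | s, hs⟩ <;> simp at hs
    conv_lhs => rw [this, coeff_ren_mapDomain hinj]
  · obtain ⟨j, hj⟩ := DFunLike.ne_iff.1 h
    refine coeff_ren_eq_zero _ _ (t := some (Sum.inr j)) ?_ hj
    rintro (_ | s) <;> simp

theorem coeff_divQ_mul_of_le (F : MvPowerSeries (Option σ) R) (d : Option (σ ⊕ Fin D) →₀ ℕ)
    (hd : D ≤ d none) :
    coeff d (divQ D F * monicW D fun j => X (Sum.inr j)) =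
      coeff d (ren (Option.map Sum.inl) F) := by
  rw [coeff_divQ_mul, if_pos hd, coeff_ren_inl]
  have key := congrArg (fun z : ℤ => (z : R) * coeff (divExp d) F) (altCoeff_rec D (genPart d))
  simp only [Int.cast_add, add_mul, Int.cast_sum, Finset.sum_mul, Int.cast_ite, Int.cast_one,
    Int.cast_zero, ite_mul, zero_mul, one_mul] at key
  rw [← key]
  congr 1
  · have h1 : d - Finsupp.single none D + Finsupp.single none D = d :=
      tsub_add_cancel_of_le (by simpa using hd)
    rw [divQ, coeff_reindex, h1]
    congr 3
    ext j; simp [genPart_apply]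
  · refine Finset.sum_congr rfl fun j _ => ?_
    rw [genPart_apply]
    split_ifs with h1 h2
    · rfl
    · rw [divQ, coeff_reindex]
      have h3 : d - Finsupp.single (some (Sum.inr j)) 1 + Finsupp.single (some (Sum.inr j)) 1 = d :=
        tsub_add_cancel_of_le (by simpa using Nat.one_le_iff_ne_zero.2 h1)
      set d1 := d - Finsupp.single (some (Sum.inr j)) 1 with hd1
      have h4 : d1 - Finsupp.single none (j : ℕ) + Finsupp.single none (j : ℕ) = d1 := by
        refine tsub_add_cancel_of_le ?_
        rw [Finsupp.single_le_iff, hd1]; simpa using h2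
      set d2 := d1 - Finsupp.single none (j : ℕ) with hd2
      have hD : (j : ℕ) < D := j.2
      have hv : ∀ o, d o = d2 o + Finsupp.single none (j : ℕ) o +
          Finsupp.single (some (Sum.inr j)) 1 o := by
        intro o; rw [← Finsupp.add_apply, h4, ← Finsupp.add_apply, h3]
      congr 3
      · ext i
        rw [Finsupp.tsub_apply, genPart_apply, genPart_apply, hv]
        by_cases hij : i = j
        · subst hij; simp
        · simp [Ne.symm hij]
      · ext o
        rcases o with _ | s
        · rw [divExp_none, divExp_none]
          have : ∀ i : Fin D, d (some (Sum.inr i)) * (D - i) =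
              (d2 + Finsupp.single none D : Option (σ ⊕ Fin D) →₀ ℕ) (some (Sum.inr i)) * (D - i) +
                if j = i then D - (i : ℕ) else 0 := by
            intro i
            rw [hv]
            by_cases hij : j = i
            · subst hij; simp [add_mul]
            · simp [hij]
          rw [Finset.sum_congr rfl fun i _ => this i, Finset.sum_add_distrib, hv]
          simp
          omega
        · rw [divExp_some, divExp_some, hv]
          simp
    · omega

variable (D) in
/-- The remainder of the division by the generic monic polynomial. -/
def divR (F : MvPowerSeries (Option σ) R) (j : Fin D) : MvPowerSeries (σ ⊕ Fin D) R :=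
  ((shift none)^[(j : ℕ)] (ren (Option.map Sum.inl) F -
    divQ D F * monicW D fun j => X (Sum.inr j))).subst (spec 0)

theorem generic_division (F : MvPowerSeries (Option σ) R) :
    ren (Option.map Sum.inl) F = (divQ D F * monicW D fun j => X (Sum.inr j)) +
      lowPoly D (divR D F) := by
  rw [← sub_eq_iff_eq_add']
  refine eq_lowPoly D fun d hd => ?_
  rw [map_sub, coeff_divQ_mul_of_le F d hd, sub_self]

theorem coeff_single_none_divQ (F : MvPowerSeries (Option σ) R) (k : ℕ) :
    coeff (Finsupp.single none k) (divQ D F) = coeff (Finsupp.single none (D + k)) F := by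
  rw [divQ, coeff_reindex]
  have h := altCoeff_rec D 0
  have h0 : genPart (Finsupp.single none k : Option (σ ⊕ Fin D) →₀ ℕ) = 0 := by
    ext j; simp [genPart_apply]
  have h1 : altCoeff D (genPart (Finsupp.single none k : Option (σ ⊕ Fin D) →₀ ℕ)) = 1 := by
    rw [h0]; simpa using h
  rw [h1, Int.cast_one, one_mul]
  congr 2
  ext o
  rcases o with _ | s
  · rw [divExp_none]; simp; omega
  · rw [divExp_some]; simp

theorem constantCoeff_divQ (F : MvPowerSeries (Option σ) R) :
    constantCoeff (divQ D F) = coeff (Finsupp.single none D) F := by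
  have := coeff_single_none_divQ (D := D) F 0
  rwa [Finsupp.single_zero, coeff_zero_eq_constantCoeff_apply] at this

omit [Finite σ] in
theorem shift_iterate_coeff (n : ℕ) (s : σ) (F : MvPowerSeries σ R) (d : σ →₀ ℕ) :
    coeff d ((shift s)^[n] F) = coeff (d + Finsupp.single s n) F := by
  induction n generalizing F d with
  | zero => simp
  | succ n ih =>
    rw [Function.iterate_succ_apply', coeff_shift, ih, add_assoc, ← Finsupp.single_add,
      add_comm 1 n]

theorem coeff_single_spec_zero (F : MvPowerSeries (Option σ) R) (s : σ) :
    coeff (Finsupp.single s 1) (F.subst (spec 0)) = coeff (Finsupp.single (some s) 1) F := by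
  classical
  have := Fintype.ofFinite σ
  have h0 : constantCoeff (0 : MvPowerSeries σ R) = 0 := map_zero _
  rw [coeff_single_one, coeff_single_one, pderiv_subst (constantCoeff_spec h0), map_sum,
    Fintype.sum_option]
  simp only [spec, Option.elim, map_zero, mul_zero, zero_add, map_mul]
  rw [Finset.sum_eq_single s]
  · rw [pderiv_X_self, map_one, mul_one]
    exact constantCoeff_subst' (constantCoeff_spec h0) _
  · intro t _ hts
    rw [pderiv_X_of_ne hts, map_zero, mul_zero]
  · simp

theorem constantCoeff_divR (F : MvPowerSeries (Option σ) R) (j : Fin D) :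
    constantCoeff (divR D F j) = coeff (Finsupp.single none (j : ℕ)) F := by
  have h0 : constantCoeff (0 : MvPowerSeries (σ ⊕ Fin D) R) = 0 := map_zero _
  rw [divR, constantCoeff_subst' (constantCoeff_spec h0), ← coeff_zero_eq_constantCoeff_apply,
    shift_iterate_coeff, zero_add, map_sub, coeff_divQ_mul, coeff_ren_inl, if_pos, if_neg,
    Finset.sum_eq_zero]
  · simp only [add_zero, sub_zero]
    congr 2
    ext o
    rcases o with _ | s
    · rw [divExp_none]; simp
    · rw [divExp_some]; simp
  · intro i _; simp
  · simp
  · ext i; simp [genPart_apply]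

theorem coeff_inr_divR (F : MvPowerSeries (Option σ) R) (i j : Fin D) :
    coeff (Finsupp.single (Sum.inr i) 1) (divR D F j) =
      if (i : ℕ) ≤ j then - coeff (Finsupp.single none (D + (j - i))) F else 0 := by
  rw [divR, coeff_single_spec_zero, shift_iterate_coeff, map_sub, coeff_divQ_mul, coeff_ren_inl,
    if_neg, if_neg, zero_add, zero_sub, Finset.sum_eq_single i, if_neg]
  · simp only [Finsupp.add_apply, Finsupp.single_apply]
    simp only [reduceCtorEq, if_false, if_true, zero_add]
    split_ifs with h
    · congr 1
      rw [← coeff_single_none_divQ]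
      congr 2
      ext o
      rcases o with _ | _ | k <;> simp
    · simp
  · simp
  · intro k _ hk
    rw [if_pos]
    simp [Ne.symm hk]
  · simp
  · simp
  · intro h
    have := DFunLike.congr_fun h i
    simp [genPart_apply] at this

end Division
end Artin

namespace Artin
open MvPowerSeries

section Lift

variable {R : Type*} [CommRing R] {σ τ ρ : Type*} {D : ℕ}

theorem coeff_ren_some [Finite σ] (F : MvPowerSeries σ R) (d : Option σ →₀ ℕ) :
    coeff d (ren some F) = if d none = 0 then coeff d.some F else 0 := by
  split_ifs with h
  · have : d = Finsupp.mapDomain some d.some := by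
      ext o
      rcases o with _ | s
      · rw [h, Finsupp.mapDomain_of_notMem_range]; simp
      · rw [Finsupp.mapDomain_apply (Option.some_injective _)]; simp
    conv_lhs => rw [this, coeff_ren_mapDomain (Option.some_injective _)]
  · exact coeff_ren_eq_zero _ _ (t := none) (by simp) h

theorem coeff_lowPoly [Finite σ] (a : Fin D → MvPowerSeries σ R) (d : Option σ →₀ ℕ) :
    coeff d (lowPoly D a) = if h : d none < D then coeff d.some (a ⟨d none, h⟩) else 0 := by
  classical
  have key : ∀ j : Fin D, coeff d (ren some (a j) * X none ^ (j : ℕ)) =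
      if (j : ℕ) = d none then coeff d.some (a j) else 0 := by
    intro j
    rw [mul_comm, coeff_X_pow_mul, coeff_ren_some]
    split_ifs with h1 h2 h3 h3 h3
    · congr 2; ext s; simp
    · simp at h2; omega
    · simp at h2; omega
    · rfl
    · omega
    · rfl
  rw [lowPoly, map_sum, Finset.sum_congr rfl fun j _ => key j]
  split_ifs with h
  · rw [Finset.sum_eq_single ⟨d none, h⟩]
    · simp
    · intro j _ hj; rw [if_neg]; intro h1; exact hj (Fin.ext h1)
    · simp
  · refine Finset.sum_eq_zero fun j _ => ?_
    rw [if_neg]; have := j.2; omega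

theorem lowPoly_eq_zero [Finite σ] {a : Fin D → MvPowerSeries σ R} (h : lowPoly D a = 0) :
    a = 0 := by
  funext j
  ext d
  have := congrArg (coeff (Finsupp.mapDomain some d + Finsupp.single none (j : ℕ))) h
  rw [coeff_lowPoly] at this
  have h1 : (Finsupp.mapDomain some d + Finsupp.single none (j : ℕ) : Option σ →₀ ℕ) none = j := by
    rw [Finsupp.add_apply, Finsupp.mapDomain_of_notMem_range _ _ (by simp)]; simp
  have h2 : (Finsupp.mapDomain some d + Finsupp.single none (j : ℕ) : Option σ →₀ ℕ).some = d := by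
    ext s
    rw [Finsupp.some_apply, Finsupp.add_apply, Finsupp.mapDomain_apply (Option.some_injective _)]
    simp
  rw [dif_pos (by rw [h1]; exact j.2), h2] at this
  simp only [h1] at this
  simpa using this

/-- Uniqueness of Weierstrass division. -/
theorem division_unique [Finite σ] {a r : Fin D → MvPowerSeries σ R}
    (ha : ∀ j, constantCoeff (a j) = 0) {q : MvPowerSeries (Option σ) R}
    (h : q * monicW D a + lowPoly D r = 0) : q = 0 ∧ r = 0 := by
  classical
  have key : ∀ N : ℕ, ∀ d : Option σ →₀ ℕ, d.some.degree < N → coeff d q = 0 := by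
    intro N
    induction N with
    | zero => intro d hd; omega
    | succ N ih =>
      intro d hd
      have h1 := congrArg (coeff (d + Finsupp.single none D)) h
      rw [map_add, coeff_lowPoly, dif_neg (by simp), add_zero, monicW, mul_add, map_add,
        mul_comm q, coeff_X_pow_mul, if_pos (by simp), add_tsub_cancel_right, map_zero,
        Finset.mul_sum, map_sum, Finset.sum_eq_zero, add_zero] at h1
      · exact h1
      · intro j _
        rw [mul_left_comm, coeff_mul]
        refine Finset.sum_eq_zero fun x hx => ?_
        rw [Finset.HasAntidiagonal.mem_antidiagonal] at hx
        have hx2 : x.1.some + x.2.some = d.some := by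
          have := congrArg Finsupp.some hx
          rw [Finsupp.some_add, Finsupp.some_add] at this
          rw [this]; ext s; simp
        have hx3 := congrArg Finsupp.degree hx2
        rw [map_add] at hx3
        by_cases hx1 : x.1.some = 0
        · rw [coeff_ren_some]
          split_ifs
          · rw [hx1, coeff_zero_eq_constantCoeff_apply, ha, zero_mul]
          · rw [zero_mul]
        · have : x.1.some.degree ≠ 0 := by rwa [Ne, Finsupp.degree_eq_zero_iff]
          rw [mul_comm q, coeff_X_pow_mul]
          split_ifs
          · rw [ih _, mul_zero]
            have : (x.2 - Finsupp.single none (j : ℕ)).some = x.2.some := by ext s; simp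
            rw [this]; omega
          · rw [mul_zero]
  have hq : q = 0 := by ext d; rw [key _ d (Nat.lt_succ_self _)]; simp
  refine ⟨hq, lowPoly_eq_zero ?_⟩
  rwa [hq, zero_mul, zero_add] at h

/-- Extension of a substitution by the identity on the distinguished variable. -/
def lift (b : τ → MvPowerSeries σ R) : Option τ → MvPowerSeries (Option σ) R :=
  fun o => o.elim (X none) fun t => ren some (b t)

theorem constantCoeff_lift [Finite σ] {b : τ → MvPowerSeries σ R}
    (hb : ∀ t, constantCoeff (b t) = 0) (o : Option τ) : constantCoeff (lift b o) = 0 := by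
  rcases o with _ | t
  · exact constantCoeff_X' _
  · exact (constantCoeff_ren _ _).trans (hb t)

theorem ren_some_subst_lift [Finite σ] [Finite τ] {b : τ → MvPowerSeries σ R}
    (hb : ∀ t, constantCoeff (b t) = 0) (F : MvPowerSeries τ R) :
    (ren some F).subst (lift b) = ren some (F.subst b) := by
  rw [ren_subst _ (constantCoeff_lift hb), ren, subst_subst hb (fun _ => constantCoeff_X' _)]
  rfl

theorem lowPoly_subst_lift [Finite σ] [Finite τ] {b : τ → MvPowerSeries σ R}
    (hb : ∀ t, constantCoeff (b t) = 0) (a : Fin D → MvPowerSeries τ R) :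
    (lowPoly D a).subst (lift b) = lowPoly D fun j => (a j).subst b := by
  have hs := hasSubst_zero (constantCoeff_lift hb)
  rw [lowPoly, subst_sum' (constantCoeff_lift hb)]
  refine Finset.sum_congr rfl fun j _ => ?_
  rw [subst_mul hs, subst_pow hs, subst_X hs, ren_some_subst_lift hb]
  rfl

theorem monicW_eq (a : Fin D → MvPowerSeries σ R) : monicW D a = X none ^ D + lowPoly D a := rfl

theorem monicW_subst_lift [Finite σ] [Finite τ] {b : τ → MvPowerSeries σ R}
    (hb : ∀ t, constantCoeff (b t) = 0) (a : Fin D → MvPowerSeries τ R) :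
    (monicW D a).subst (lift b) = monicW D fun j => (a j).subst b := by
  have hs := hasSubst_zero (constantCoeff_lift hb)
  rw [monicW_eq, subst_add hs, subst_pow hs, subst_X hs, lowPoly_subst_lift hb]
  rfl

theorem division_subst [Finite σ] [Finite τ] {b : τ → MvPowerSeries σ R}
    {α : Fin D → MvPowerSeries σ R}
    (hb : ∀ t, constantCoeff (b t) = 0) (hα : ∀ t, constantCoeff (α t) = 0)
    (F : MvPowerSeries (Option τ) R) :
    F.subst (lift b) = (divQ D F).subst (lift (Sum.elim b α)) * monicW D α +
      lowPoly D fun j => (divR D F j).subst (Sum.elim b α) := by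
  have hbα : ∀ t, constantCoeff (Sum.elim b α t) = 0 := by rintro (t | t); exacts [hb t, hα t]
  have h := congrArg (subst (lift (Sum.elim b α))) (generic_division (D := D) F)
  have hs := hasSubst_zero (constantCoeff_lift hbα)
  rw [ren_subst _ (constantCoeff_lift hbα), subst_add hs, subst_mul hs, monicW_subst_lift hbα,
    lowPoly_subst_lift hbα] at h
  have h1 : (fun s => lift (Sum.elim b α) (Option.map Sum.inl s)) = lift b := by
    funext o; rcases o with _ | o <;> rfl
  have h2 : (fun j : Fin D => subst (Sum.elim b α) (X (Sum.inr j) : MvPowerSeries (τ ⊕ Fin D) R))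
      = α := by
    funext j; exact subst_X (hasSubst_zero hbα) _
  rwa [h1, h2] at h

theorem lift_X [Finite σ] : lift (X : σ → MvPowerSeries σ R) = X := by
  funext o
  rcases o with _ | s
  · rfl
  · exact subst_X (hasSubst_zero fun _ => constantCoeff_X' _) s

theorem coeff_single_mul_congr {F F' : MvPowerSeries (Option σ) R}
    (h : ∀ k, coeff (Finsupp.single none k) F = coeff (Finsupp.single none k) F')
    (G : MvPowerSeries (Option σ) R) (k : ℕ) :
    coeff (Finsupp.single none k) (G * F) = coeff (Finsupp.single none k) (G * F') := by
  classical
  rw [coeff_mul, coeff_mul]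
  refine Finset.sum_congr rfl fun x hx => ?_
  rw [Finset.HasAntidiagonal.mem_antidiagonal] at hx
  have : x.2 = Finsupp.single none (x.2 none) := by
    ext o
    rcases o with _ | s
    · simp
    · have := DFunLike.congr_fun hx (some s)
      simp at this ⊢
      omega
  rw [this, h]

end Lift

namespace System

variable {K : Type} [Field K] (S : System K) {σ τ ρ ι : Type} [Finite σ] [Finite τ] [Finite ρ]
  [Finite ι] {D : ℕ}

theorem divQ_mem {F : MvPowerSeries (Option σ) K} (hF : F ∈ S.A _) : divQ D F ∈ S.A _ := by
  refine S.reindex_mem _ _ ((D + 1) * (D + 1)) ?_ ?_ hF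
  · intro β
    refine (abs_altCoeff_le _ _).trans ?_
    have h1 : (D : ℤ) ^ (genPart β).degree ≤ (((D + 1) * (D + 1) : ℕ) : ℤ) ^ (genPart β).degree := by
      refine pow_le_pow_left₀ (by positivity) ?_ _
      push_cast; nlinarith
    refine h1.trans (pow_le_pow_right₀ ?_ ((genPart_degree_le β).trans (Nat.le_succ _)))
    push_cast; nlinarith
  · intro β
    refine (divExp_degree_le _).trans ?_
    rw [map_add, Finsupp.degree_single, mul_assoc]
    refine Nat.mul_le_mul_left _ ?_
    nlinarith [Nat.zero_le (D * β.degree)]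

theorem lowPoly_mem {a : Fin D → MvPowerSeries σ K} (ha : ∀ j, a j ∈ S.A σ) :
    lowPoly D a ∈ S.A _ :=
  sum_mem fun j _ => mul_mem (S.ren_mem _ (ha j)) (pow_mem (S.X_mem _) _)

theorem monicW_mem {a : Fin D → MvPowerSeries σ K} (ha : ∀ j, a j ∈ S.A σ) :
    monicW D a ∈ S.A _ :=
  add_mem (pow_mem (S.X_mem _) _) (S.lowPoly_mem ha)

theorem shift_iterate_mem (s : σ) (n : ℕ) {F : MvPowerSeries σ K} (hF : F ∈ S.A σ) :
    (shift s)^[n] F ∈ S.A σ := by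
  induction n with
  | zero => exact hF
  | succ n ih => rw [Function.iterate_succ_apply']; exact S.shift_mem _ ih

theorem divR_mem {F : MvPowerSeries (Option σ) K} (hF : F ∈ S.A _) (j : Fin D) :
    divR D F j ∈ S.A _ := by
  refine S.subst_mem ?_ (constantCoeff_spec (map_zero _)) (S.shift_iterate_mem _ _
    (sub_mem (S.ren_mem _ hF) (mul_mem (S.divQ_mem hF) (S.monicW_mem fun j => S.X_mem _))))
  rintro (_ | s)
  · exact zero_mem _
  · exact S.X_mem _

omit [Finite τ] in
theorem lift_mem {b : τ → MvPowerSeries σ K} (hb : ∀ t, b t ∈ S.A σ) (o : Option τ) :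
    lift b o ∈ S.A (Option σ) := by
  rcases o with _ | t
  · exact S.X_mem _
  · exact S.ren_mem _ (hb t)

/-- Weierstrass preparation. -/
theorem preparation {Δ : MvPowerSeries (Option σ) K} (hΔ : Δ ∈ S.A _)
    (h0 : ∀ k < D, coeff (Finsupp.single none k) Δ = 0)
    (hD : coeff (Finsupp.single none D) Δ ≠ 0) :
    ∃ α : Fin D → MvPowerSeries σ K, (∀ j, α j ∈ S.A σ) ∧ (∀ j, constantCoeff (α j) = 0) ∧
      ∃ w ∈ S.A (Option σ), constantCoeff w ≠ 0 ∧ Δ = w * monicW D α := by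
  classical
  set v := (shift none)^[D] Δ with hv
  have hvA : v ∈ S.A _ := S.shift_iterate_mem _ _ hΔ
  have hv0 : constantCoeff v ≠ 0 := by
    rwa [← coeff_zero_eq_constantCoeff_apply, hv, shift_iterate_coeff, zero_add]
  set Δ' := v⁻¹ * Δ with hΔ'
  have hΔ'A : Δ' ∈ S.A _ := mul_mem (S.inv_mem hvA hv0) hΔ
  have hco : ∀ k, coeff (Finsupp.single none k) Δ' = if k = D then 1 else 0 := by
    intro k
    rw [hΔ', coeff_single_mul_congr (F' := X none ^ D * v), mul_left_comm,
      MvPowerSeries.inv_mul_cancel _ hv0, mul_one, X_pow_eq, coeff_monomial]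
    · congr 1; rw [eq_iff_iff]; exact (Finsupp.single_injective (none : Option σ)).eq_iff
    · intro k
      rw [coeff_X_pow_mul]
      split_ifs with h
      · rw [hv, shift_iterate_coeff, tsub_add_cancel_of_le]; simpa using h
      · exact h0 _ (by simpa using h)
  let G : Fin D → MvPowerSeries (σ ⊕ Fin D) K := fun j => X (Sum.inr j) + divR D Δ' j
  have hG : IFTData G := by
    refine ⟨fun j => ?_, fun j i => ?_⟩
    · simp only [G, map_add, constantCoeff_X', constantCoeff_divR, hco]
      rw [if_neg (by have := j.2; omega), add_zero]
    · simp only [G, map_add, coeff_inr_divR, hco]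
      rw [coeff_single_one]
      by_cases hij : i = j
      · subst hij; simp [pderiv_X_self]
      · rw [pderiv_X_of_ne (by simpa using Ne.symm hij)]
        have : (i : ℕ) ≠ j := fun h => hij (Fin.ext h)
        split_ifs with h1 h2 <;> simp
        omega
  obtain ⟨z, hz0, hz⟩ := hG.exists_solution
  have hzA := S.ift_mem hG (fun j => add_mem (S.X_mem _) (S.divR_mem hΔ'A j)) hz0 hz
  have hs := hasSubst_zero (constantCoeff_elim_X hz0)
  have hr : ∀ j, (divR D Δ' j).subst (Sum.elim X z) = 0 := by
    intro j
    have := hz j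
    simp only [G] at this
    rw [subst_add hs, subst_X hs] at this
    simpa using this
  have hdiv := division_subst (b := X) (α := z) (fun _ => constantCoeff_X' _) hz0 Δ'
  rw [lift_X, subst_X_self] at hdiv
  have hl : (lowPoly D fun j => (divR D Δ' j).subst (Sum.elim X z)) = 0 := by
    simp only [hr]
    exact Finset.sum_eq_zero fun j _ => by
      rw [ren, ← substAlgHom_apply (hasSubst_zero fun _ => constantCoeff_X' _), map_zero, zero_mul]
  rw [hl, add_zero] at hdiv
  refine ⟨z, hzA, hz0, v * (divQ D Δ').subst (lift (Sum.elim X z)), mul_mem hvA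
    (S.subst_mem (S.lift_mem ?_) (constantCoeff_lift (constantCoeff_elim_X hz0))
      (S.divQ_mem hΔ'A)), ?_, ?_⟩
  · rintro (s | j)
    · exact S.X_mem _
    · exact hzA j
  · rw [map_mul, constantCoeff_subst' (constantCoeff_lift (constantCoeff_elim_X hz0)),
      constantCoeff_divQ, hco, if_pos rfl, mul_one]
    exact hv0
  · rw [mul_assoc, ← hdiv, hΔ', ← mul_assoc, MvPowerSeries.mul_inv_cancel _ hv0, one_mul]

end System
end Artin

namespace Artin
open MvPowerSeries

section Line

variable {R : Type*} [CommRing R] {σ τ ρ : Type*}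

theorem subst_zero' [Finite τ] {a : τ → MvPowerSeries σ R} (ha : ∀ t, constantCoeff (a t) = 0) :
    (0 : MvPowerSeries τ R).subst a = 0 := by
  rw [← substAlgHom_apply (hasSubst_zero ha), map_zero]

theorem sub_dvd_of_subst_spec_eq_zero [Finite σ] {p : MvPowerSeries σ R}
    (hp : constantCoeff p = 0) {F : MvPowerSeries (Option σ) R} (h : F.subst (spec p) = 0) :
    X none - ren some p ∣ F := by
  have hp' : constantCoeff (ren some p) = 0 := (constantCoeff_ren _ _).trans hp
  let a : Option σ → MvPowerSeries (Option σ) R := fun o => o.elim (ren some p) fun s => X (some s)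
  have ha : ∀ o, constantCoeff (a o) = 0 := by
    rintro (_ | s); exacts [hp', constantCoeff_X' _]
  have h1 := taylor_one ha (fun o => o.elim 1 fun _ => 0)
    (p := X none - ren some p) (by rw [map_sub, hp', constantCoeff_X', sub_zero]) F
  have h2 : (fun t : Option σ => a t + (X none - ren some p) *
      (fun o : Option σ => o.elim (1 : MvPowerSeries (Option σ) R) fun _ => 0) t) = X := by
    funext o
    rcases o with _ | s <;> simp [a]
  have h3 : F.subst a = 0 := by
    have : a = fun o => (spec p o).subst fun s => X (some s) := by
      funext o
      rcases o with _ | s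
      · rfl
      · exact (subst_X (hasSubst_zero fun s : σ => constantCoeff_X' (R := R) (some s)) s).symm
    rw [this, ← subst_subst (constantCoeff_spec hp) (fun _ => constantCoeff_X' _), h,
      subst_zero' fun _ => constantCoeff_X' _]
  rwa [h2, subst_X_self, h3, sub_zero] at h1

theorem X_none_dvd_iff [Finite σ] {F : MvPowerSeries (Option σ) R} :
    X none ∣ F ↔ F.subst (spec (0 : MvPowerSeries σ R)) = 0 := by
  have hs := hasSubst_zero (constantCoeff_spec (map_zero (constantCoeff (σ := σ) (R := R))))
  constructor
  · rintro ⟨G, rfl⟩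
    rw [subst_mul hs, subst_X hs]
    simp [spec]
  · intro h
    have := sub_dvd_of_subst_spec_eq_zero (map_zero _) h
    rwa [ren, subst_zero' fun _ => constantCoeff_X' _, sub_zero] at this

theorem prime_X_none [Finite σ] [IsDomain R] : Prime (X none : MvPowerSeries (Option σ) R) := by
  have hs := hasSubst_zero (constantCoeff_spec (map_zero (constantCoeff (σ := σ) (R := R))))
  refine ⟨fun h => ?_, fun h => ?_, fun F G h => ?_⟩
  · have := congrArg (coeff (Finsupp.single none 1)) h
    rw [coeff_single_one, pderiv_X_self] at this
    simp at this
  · have := (constantCoeff (σ := Option σ) (R := R)).isUnit_map h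
    rw [constantCoeff_X'] at this
    exact not_isUnit_zero this
  · rw [X_none_dvd_iff, subst_mul hs] at h
    rw [X_none_dvd_iff, X_none_dvd_iff]
    exact mul_eq_zero.1 h

theorem subst_const_zero [Finite τ] (F : MvPowerSeries τ R) :
    F.subst (fun _ => (0 : MvPowerSeries σ R)) = C (constantCoeff F) := by
  have hs := hasSubst_zero fun _ : τ => map_zero (constantCoeff (σ := σ) (R := R))
  have := ext_of_poly (((substAlgHom hs : MvPowerSeries τ R →ₐ[R] MvPowerSeries σ R) :
    MvPowerSeries τ R →+ MvPowerSeries σ R) - (((C : R →+* MvPowerSeries σ R).comp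
      (constantCoeff (σ := τ) (R := R)) : MvPowerSeries τ R →+* MvPowerSeries σ R) :
        MvPowerSeries τ R →+ MvPowerSeries σ R)) 0 ?_ ?_ F
  · have h2 : (substAlgHom hs) F - C (constantCoeff F) = 0 := this
    rw [substAlgHom_apply] at h2
    exact sub_eq_zero.1 h2
  · intro F N hF
    change (substAlgHom hs) F - C (constantCoeff F) ∈ _
    rw [substAlgHom_apply]
    refine sub_mem (subst_mem_ordIdeal (fun _ => map_zero _) hF) ?_
    rcases N with _ | N
    · exact mem_ordIdeal_zero _
    · have : constantCoeff F = 0 := mem_ordIdeal_one.1 (ordIdeal_anti (by omega) hF)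
      rw [this, map_zero]; exact zero_mem _
  · intro P
    change (substAlgHom hs) (P : MvPowerSeries τ R) - C (constantCoeff (P : MvPowerSeries τ R)) = 0
    rw [substAlgHom_apply, subst_coe]
    have h0 : (fun _ : τ => (0 : MvPowerSeries σ R)) = 0 := rfl
    rw [h0, MvPolynomial.aeval_zero, sub_eq_zero, ← coeff_zero_eq_constantCoeff_apply,
      MvPolynomial.coeff_coe]
    rfl

/-- A power series in one variable of order at least `N` is divisible by `X ^ N`. -/
theorem X_pow_dvd_of_mem_ordIdeal {F : MvPowerSeries Unit R} {N : ℕ} (h : F ∈ ordIdeal Unit R N) :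
    X () ^ N ∣ F := by
  rw [X_pow_dvd_iff]
  intro m hm
  refine h m ?_
  rw [Finsupp.degree_eq_sum]
  simpa using hm

variable {K : Type*} [Field K]

theorem constantCoeff_line_map (v : σ → K) (s : σ) :
    constantCoeff (C (v s) * X () : MvPowerSeries Unit K) = 0 := by
  rw [map_mul, constantCoeff_X', mul_zero]

theorem exists_line [Infinite K] [Finite σ] {F : MvPowerSeries σ K} {N : ℕ} (hN : F.order = N) :
    ∃ (v : σ → K) (w : MvPowerSeries Unit K), constantCoeff w ≠ 0 ∧
      F.subst (fun s => C (v s) * X ()) = X () ^ N * w := by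
  classical
  set P := truncTotal (N + 1) F with hP
  have hPc : ∀ d, MvPolynomial.coeff d P ≠ 0 → d.degree = N := by
    intro d hd
    by_contra h
    rcases lt_or_gt_of_ne h with h1 | h1
    · rw [hP, coeff_truncTotal _ (by omega)] at hd
      exact hd (coeff_of_lt_order (by rw [hN]; exact_mod_cast h1))
    · rw [hP] at hd
      exact hd (coeff_truncTotal_eq_zero _ (by omega))
  have hP0 : P ≠ 0 := by
    intro h
    have : F ∈ ordIdeal σ K (N + 1) := by
      have := sub_truncTotal_mem F (N + 1)
      rwa [← hP, h, MvPolynomial.coe_zero, sub_zero] at this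
    rw [mem_ordIdeal_iff_order, hN] at this
    have h2 : N + 1 ≤ N := by exact_mod_cast this
    omega
  obtain ⟨v, hv⟩ : ∃ v, MvPolynomial.eval v P ≠ 0 := by
    by_contra! h
    exact hP0 (MvPolynomial.funext fun x => by rw [h, map_zero])
  have hv0 := fun s => constantCoeff_line_map v s
  have hsub := subst_mem_ordIdeal hv0 (sub_truncTotal_mem F (N + 1))
  obtain ⟨G, hG⟩ := X_pow_dvd_of_mem_ordIdeal hsub
  rw [subst_sub (hasSubst_zero hv0), ← hP, subst_coe] at hG
  have hPa : MvPolynomial.aeval (fun s => (C (v s) * X () : MvPowerSeries Unit K)) P =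
      X () ^ N * C (MvPolynomial.eval v P) := by
    rw [MvPolynomial.aeval_def, MvPolynomial.eval₂_eq, MvPolynomial.eval_eq, map_sum,
      Finset.mul_sum]
    refine Finset.sum_congr rfl fun d hd => ?_
    rw [← hPc d (MvPolynomial.mem_support_iff.1 hd), map_mul, map_prod, Finsupp.degree_apply,
      ← Finset.prod_pow_eq_pow_sum, mul_left_comm, ← Finset.prod_mul_distrib]
    congr 1
    refine Finset.prod_congr rfl fun i _ => ?_
    rw [mul_pow, map_pow, mul_comm]
  refine ⟨v, C (MvPolynomial.eval v P) + X () * G, ?_, ?_⟩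
  · rw [map_add, map_mul, constantCoeff_X', zero_mul, add_zero, constantCoeff_C]
    exact hv
  · rw [mul_add, ← hPa, ← mul_assoc, ← pow_succ, ← hG]; ring

theorem coeff_single_subst_axis [Finite σ] (F : MvPowerSeries (Option σ) R) (k : ℕ) :
    coeff (Finsupp.single () k) (F.subst fun o => o.elim (X ()) fun _ => 0) =
      coeff (Finsupp.single none k) F := by
  classical
  set z : Option σ → MvPowerSeries Unit R := fun o => o.elim (X ()) fun _ => 0 with hz
  have hz0 : ∀ o, constantCoeff (z o) = 0 := by
    rintro (_ | s)
    exacts [constantCoeff_X' _, map_zero _]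
  have step : ∀ F : MvPowerSeries (Option σ) R,
      shift () (F.subst z) = (shift none F).subst z := by
    intro F
    have h1 := subst_eq_add_shift hz0 none F
    have h2 : Function.update z none 0 = fun _ => 0 := by
      funext o
      rcases o with _ | s <;> simp [hz]
    rw [h2, subst_const_zero] at h1
    conv_lhs => rw [h1]
    rw [map_add, shift_C, zero_add]
    exact shift_X_mul_self _ _
  have it : ∀ (n : ℕ) (F : MvPowerSeries (Option σ) R), (shift ())^[n] (subst z F) = ((shift none)^[n] F).subst z := by
    intro n
    induction n with
    | zero => intro F; rfl
    | succ n ih => intro F; rw [Function.iterate_succ_apply, step, ih, Function.iterate_succ_apply]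
  have h1 := shift_iterate_coeff k () (F.subst z) 0
  have h2 := shift_iterate_coeff k none F 0
  rw [zero_add] at h1 h2
  rw [← h1, ← h2, it, coeff_zero_eq_constantCoeff_apply, constantCoeff_subst' hz0]
  rfl

end Line
end Artin

namespace Artin
open MvPowerSeries

section Minor

variable {R : Type*} [CommRing R] {σ τ ν : Type*}

/-- A minor of the Jacobian matrix. -/
def minor {n : ℕ} (f : Fin n → MvPowerSeries ν R) (e : Fin n → ν) : MvPowerSeries ν R :=
  (Matrix.of fun i b => pderiv R (e b) (f i)).det

theorem minor_subst [Finite ν] {n : ℕ} (f : Fin n → MvPowerSeries ν R) (e : Fin n → ν)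
    {a : ν → MvPowerSeries σ R} (ha : ∀ t, constantCoeff (a t) = 0) :
    (minor f e).subst a = (Matrix.of fun i b => (pderiv R (e b) (f i)).subst a).det := by
  rw [← substAlgHom_apply (hasSubst_zero ha), minor, AlgHom.map_det]
  congr 1
  ext i b
  simp

theorem det_mul_sum_eq {B : Type*} [CommRing B] [Fintype ν] {n : ℕ} (g : Fin n → ν → B) (w ψ : ν → B)
    (h : ∀ i, ∑ t, g i t * ψ t = 0) (e : Fin n → ν) :
    (Matrix.of fun i b => g i (e b)).det * ∑ t, w t * ψ t =
      ∑ t, ψ t * (Matrix.of fun i b : Fin (n + 1) =>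
        (Fin.snoc g w : Fin (n + 1) → ν → B) i ((Fin.snoc e t : Fin (n + 1) → ν) b)).det := by
  set G : Fin (n + 1) → ν → B := Fin.snoc g w with hG
  let N : Matrix (Fin (n + 1)) (Fin (n + 1)) B :=
    Matrix.of fun i b => Fin.lastCases (motive := fun _ => B) 0 (fun b' => G i (e b')) b
  have h1 : ∀ t, (Matrix.of fun i b : Fin (n + 1) => G i ((Fin.snoc e t : Fin (n + 1) → ν) b)).det =
      N.cramer (fun i => G i t) (Fin.last n) := by
    intro t
    rw [Matrix.cramer_apply]
    congr 1
    ext i b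
    rw [Matrix.updateCol_apply]
    refine Fin.lastCases ?_ (fun b' => ?_) b
    · simp
    · rw [if_neg (Fin.castSucc_lt_last b').ne]
      simp [N]
  have h2 : ∑ t, ψ t * N.cramer (fun i => G i t) (Fin.last n) =
      N.cramer (fun i => ∑ t, ψ t * G i t) (Fin.last n) := by
    have : (fun i => ∑ t, ψ t * G i t) = ∑ t, ψ t • fun i => G i t := by
      ext i; simp
    rw [this, map_sum, Finset.sum_apply]
    refine Finset.sum_congr rfl fun t _ => ?_
    rw [map_smul]; rfl
  simp only [h1]
  rw [h2, Matrix.cramer_apply, Matrix.det_succ_column _ (Fin.last n), Fin.sum_univ_castSucc]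
  have h3 : ∀ i : Fin n, ∑ t, ψ t * G i.castSucc t = 0 := by
    intro i
    rw [← h i]
    refine Finset.sum_congr rfl fun t _ => ?_
    simp [hG, mul_comm]
  have h4 : ∑ t, ψ t * G (Fin.last n) t = ∑ t, w t * ψ t := by
    refine Finset.sum_congr rfl fun t _ => ?_
    simp [hG, mul_comm]
  simp only [Matrix.updateCol_self, h3, h4]
  rw [show ((-1 : B)) ^ ((Fin.last n : ℕ) + (Fin.last n : ℕ)) = 1 from Even.neg_one_pow ⟨_, rfl⟩]
  simp only [mul_zero, zero_mul, Finset.sum_const_zero, zero_add, one_mul]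
  rw [mul_comm]
  congr 2
  ext i b
  simp [N, hG, Fin.succAbove_last]

theorem minor_mul_pderiv_subst [Fintype ν] {n : ℕ} {f : Fin n → MvPowerSeries ν R}
    {Ψ : ν → MvPowerSeries σ R} (hΨ : ∀ t, constantCoeff (Ψ t) = 0)
    (hf : ∀ i, (f i).subst Ψ = 0) (e : Fin n → ν) (F : MvPowerSeries ν R) (s : σ) :
    (minor f e).subst Ψ * pderiv R s (F.subst Ψ) =
      ∑ t, pderiv R s (Ψ t) * (minor (Fin.snoc f F : Fin (n + 1) → _)
        (Fin.snoc e t : Fin (n + 1) → ν)).subst Ψ := by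
  have h := det_mul_sum_eq (fun i t => (pderiv R t (f i)).subst Ψ)
    (fun t => (pderiv R t F).subst Ψ) (fun t => pderiv R s (Ψ t)) (fun i => by
      rw [← pderiv_subst hΨ, hf, map_zero]) e
  rw [pderiv_subst hΨ, minor_subst _ _ hΨ, h]
  refine Finset.sum_congr rfl fun t _ => ?_
  rw [minor_subst _ _ hΨ]
  congr 3
  ext i b : 2
  refine Fin.lastCases ?_ (fun i' => ?_) i <;> simp

end Minor

section Path

variable {K : Type} [Field K] [CharZero K] {ν σ : Type} [Finite ν] [Finite σ]

theorem X_pow_succ_dvd {F : MvPowerSeries (Option σ) K} (h0 : F.subst (spec (0 : MvPowerSeries σ K)) = 0) {k : ℕ}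
    (h : X none ^ k ∣ pderiv K none F) : X none ^ (k + 1) ∣ F := by
  rw [X_pow_dvd_iff] at *
  intro m hm
  have h1 : X none ∣ F := X_none_dvd_iff.2 h0
  by_cases hm0 : m none = 0
  · rw [← pow_one (X none), X_pow_dvd_iff] at h1
    exact h1 m (by omega)
  · have h2 := h (m - Finsupp.single none 1) (by simp; omega)
    have h3 : m - Finsupp.single none 1 + Finsupp.single none 1 = m :=
      tsub_add_cancel_of_le (by simpa using Nat.one_le_iff_ne_zero.2 hm0)
    rw [coeff_pderiv, h3] at h2
    exact (mul_eq_zero.1 h2).resolve_right (Nat.cast_add_one_ne_zero _)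

/-- Elements of a set of series closed under extension of minors and vanishing at the origin
of a formal path of solutions with nonvanishing minor vanish along the path. -/
theorem subst_eq_zero_of_path {n : ℕ} {f : Fin n → MvPowerSeries ν K} {e : Fin n → ν}
    {Ψ : ν → MvPowerSeries (Option σ) K} (hΨ : ∀ t, constantCoeff (Ψ t) = 0)
    (hf : ∀ i, (f i).subst Ψ = 0)
    (hδ : ((minor f e).subst Ψ).subst (spec (0 : MvPowerSeries σ K)) ≠ 0)
    (J : Set ν) (hJ : ∀ t ∉ J, pderiv K none (Ψ t) = 0) (I : Set (MvPowerSeries ν K))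
    (hI : ∀ F ∈ I, (F.subst Ψ).subst (spec (0 : MvPowerSeries σ K)) = 0)
    (hD : ∀ F ∈ I, ∀ j ∈ J, minor (Fin.snoc f F : Fin (n + 1) → _)
      (Fin.snoc e j : Fin (n + 1) → ν) ∈ I) :
    ∀ F ∈ I, F.subst Ψ = 0 := by
  have := Fintype.ofFinite ν
  have key : ∀ k : ℕ, ∀ F ∈ I, X none ^ k ∣ F.subst Ψ := by
    intro k
    induction k with
    | zero => intro F _; simp
    | succ k ih =>
      intro F hF
      refine X_pow_succ_dvd (hI F hF) ?_
      have h1 := minor_mul_pderiv_subst hΨ hf e F none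
      refine prime_X_none.pow_dvd_of_dvd_mul_left k (fun h => hδ (X_none_dvd_iff.1 h)) ?_
      rw [h1]
      refine Finset.dvd_sum fun t _ => ?_
      by_cases ht : t ∈ J
      · exact Dvd.dvd.mul_left (ih _ (hD F hF t ht)) _
      · rw [hJ t ht, zero_mul]; exact dvd_zero _
  intro F hF
  ext m
  exact X_pow_dvd_iff.1 (key (m none + 1) F hF) m (Nat.lt_succ_self _)

theorem close_solution {a b : ν → MvPowerSeries σ K} (ha : ∀ t, constantCoeff (a t) = 0)
    (hb : ∀ t, constantCoeff (b t) = 0) {J : Set ν} (hJ : ∀ t ∉ J, a t = b t) {n : ℕ}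
    {f : Fin n → MvPowerSeries ν K} {e : Fin n → ν} (he : ∀ i, e i ∈ J)
    (hfa : ∀ i, (f i).subst a = 0) (hfb : ∀ i, (f i).subst b = 0) {d : ℕ}
    (hd : ((minor f e).subst a).order = d)
    (hab : ∀ t, b t - a t ∈ ordIdeal σ K (2 * d + 1)) {I : Set (MvPowerSeries ν K)}
    (hI : ∀ F ∈ I, F.subst a = 0)
    (hD : ∀ F ∈ I, ∀ j ∈ J, minor (Fin.snoc f F : Fin (n + 1) → _)
      (Fin.snoc e j : Fin (n + 1) → ν) ∈ I) :
    ∀ F ∈ I, F.subst b = 0 := by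
  classical
  intro F hF
  by_contra hG
  -- restrict to a line
  obtain ⟨g, hg⟩ := ENat.ne_top_iff_exists.1 (mt order_eq_top_iff.1 hG)
  obtain ⟨v, w, hw0, hw⟩ := exists_line (F := (minor f e).subst a * F.subst b) (N := d + g) (by
    rw [order_mul, hd, ← hg]; simp)
  have hv0 := fun s => constantCoeff_line_map v s
  set l : σ → MvPowerSeries Unit K := fun s => C (v s) * X () with hl
  obtain ⟨wd, hwd⟩ := X_pow_dvd_of_mem_ordIdeal
    (subst_mem_ordIdeal hv0 (mem_ordIdeal_iff_order.2 hd.ge))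
  obtain ⟨wg, hwg⟩ := X_pow_dvd_of_mem_ordIdeal
    (subst_mem_ordIdeal hv0 (mem_ordIdeal_iff_order.2 hg.le))
  rw [← hl] at hwd hwg
  have hX0 : (X () : MvPowerSeries Unit K) ≠ 0 := by
    intro h
    have := congrArg (coeff (Finsupp.single () 1)) h
    rw [coeff_single_one, pderiv_X_self] at this
    simp at this
  have hww : wd * wg = w := by
    rw [subst_mul (hasSubst_zero hv0), hwd, hwg] at hw
    refine mul_left_cancel₀ (pow_ne_zero (d + g) hX0) ?_
    rw [← hw]; ring
  have hwd0 : constantCoeff wd ≠ 0 := by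
    intro h; rw [← hww, map_mul, h, zero_mul] at hw0; exact hw0 rfl
  have hwg0 : wg ≠ 0 := by
    rintro rfl; rw [← hww, mul_zero, map_zero] at hw0; exact hw0 rfl
  let A : ν → MvPowerSeries Unit K := fun t => (a t).subst l
  let B : ν → MvPowerSeries Unit K := fun t => (b t).subst l
  have hA0 : ∀ t, constantCoeff (A t) = 0 := fun t => (constantCoeff_subst' hv0 _).trans (ha t)
  have hB0 : ∀ t, constantCoeff (B t) = 0 := fun t => (constantCoeff_subst' hv0 _).trans (hb t)
  have hsA : ∀ G : MvPowerSeries ν K, G.subst A = (G.subst a).subst l := fun G =>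
    (subst_subst ha hv0 G).symm
  have hsB : ∀ G : MvPowerSeries ν K, G.subst B = (G.subst b).subst l := fun G =>
    (subst_subst hb hv0 G).symm
  have hE : ∀ t, ∃ E : MvPowerSeries Unit K, B t - A t = X () ^ (2 * d + 1) * E ∧
      (t ∉ J → E = 0) := by
    intro t
    by_cases ht : t ∈ J
    · obtain ⟨E, hE⟩ := X_pow_dvd_of_mem_ordIdeal (subst_mem_ordIdeal hv0 (hab t))
      rw [subst_sub (hasSubst_zero hv0)] at hE
      exact ⟨E, hE, fun h => absurd ht h⟩
    · refine ⟨0, ?_, fun _ => rfl⟩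
      simp only [A, B, hJ t ht]; simp
  choose E hE hEJ using hE
  -- the linear path
  let T : MvPowerSeries (Option Unit) K := X none
  let s : MvPowerSeries (Option Unit) K := ren some (X ())
  have hT0 : constantCoeff T = 0 := constantCoeff_X' _
  have hs0 : constantCoeff s = 0 := (constantCoeff_ren _ _).trans (constantCoeff_X' _)
  have hrA0 : ∀ t, constantCoeff (ren some (A t)) = 0 := fun t => (constantCoeff_ren _ _).trans (hA0 t)
  have hp0 : constantCoeff (T * s ^ (2 * d)) = 0 := by rw [map_mul, hT0, zero_mul]
  let y0 : ν → MvPowerSeries (Option Unit) K := fun t =>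
    ren some (A t) + (T * s ^ (2 * d)) * ren some (E t)
  have hy0 : ∀ t, constantCoeff (y0 t) = 0 := fun t => by
    simp only [y0]; rw [map_add, map_mul, hp0, hrA0]; ring
  have hXu : constantCoeff (X () : MvPowerSeries Unit K) = 0 := constantCoeff_X' _
  have hsp := hasSubst_zero (constantCoeff_spec hXu)
  have hsz := hasSubst_zero (constantCoeff_spec (map_zero (constantCoeff (σ := Unit) (R := K))))
  have hTX : T.subst (spec (X ())) = (X () : MvPowerSeries Unit K) := subst_X hsp _
  have hTz : T.subst (spec (0 : MvPowerSeries Unit K)) = 0 := subst_X hsz _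
  have hsX : s.subst (spec (X ())) = (X () : MvPowerSeries Unit K) := ren_some_subst_spec hXu _
  have hy0X : ∀ t, (y0 t).subst (spec (X ())) = B t := by
    intro t
    simp only [y0]
    rw [subst_add hsp, subst_mul hsp, subst_mul hsp, subst_pow hsp, hTX, hsX,
      ren_some_subst_spec hXu, ren_some_subst_spec hXu, ← pow_succ', ← hE]
    ring
  have hy0z : ∀ t, (y0 t).subst (spec (0 : MvPowerSeries Unit K)) = A t := by
    intro t
    simp only [y0]
    rw [subst_add hsz, subst_mul hsz, subst_mul hsz, hTz,
      ren_some_subst_spec (map_zero _)]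
    ring
  have hrA : ∀ G : MvPowerSeries ν K, G.subst (fun t => ren some (A t)) = ren some (G.subst A) :=
    fun G => (subst_subst hA0 (fun _ => constantCoeff_X' _) G).symm
  have hf1 : ∀ i, ∃ q, (f i).subst y0 = T * s ^ (2 * d) * ((T - s) * q) := by
    intro i
    have h1 := taylor_one hrA0 (fun t => ren some (E t)) hp0 (f i)
    rw [hrA, hsA, hfa, subst_zero' hv0] at h1
    obtain ⟨q, hq⟩ := h1
    have hz : (ren some (0 : MvPowerSeries Unit K) : MvPowerSeries (Option Unit) K) = 0 :=
      subst_zero' fun _ => constantCoeff_X' _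
    rw [hz, sub_zero] at hq
    have h2 := congrArg (subst (spec (X () : MvPowerSeries Unit K))) hq
    rw [subst_subst hy0 (constantCoeff_spec hXu)] at h2
    simp only [hy0X] at h2
    rw [hsB, hfb, subst_zero' hv0, subst_mul hsp, subst_mul hsp, subst_pow hsp, hTX, hsX,
      ← pow_succ'] at h2
    have h3 := (mul_eq_zero.1 h2.symm).resolve_left (pow_ne_zero _ hX0)
    obtain ⟨q', rfl⟩ := sub_dvd_of_subst_spec_eq_zero hXu h3
    exact ⟨q', hq⟩
  choose q hq using hf1
  obtain ⟨W, hW0, hW⟩ : ∃ W, constantCoeff W ≠ 0 ∧ (minor f e).subst y0 = s ^ d * W := by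
    obtain ⟨c, hc⟩ := taylor_one hrA0 (fun t => ren some (E t)) hp0 (minor f e)
    rw [hrA, hsA, hwd] at hc
    have hm : (ren some (X () ^ d * wd) : MvPowerSeries (Option Unit) K) =
        s ^ d * ren some wd := by
      have := hasSubst_zero fun x : Unit => constantCoeff_X' (R := K) (some x)
      rw [ren, subst_mul this, subst_pow this]; rfl
    rw [hm] at hc
    refine ⟨ren some wd + T * s ^ d * c, ?_, ?_⟩
    · rw [map_add, map_mul, map_mul, hT0, constantCoeff_ren]; simpa using hwd0
    · refine (sub_eq_iff_eq_add.1 hc).trans ?_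
      ring
  -- correct it to a path of solutions
  have hpp : constantCoeff (T * (T - s)) = 0 := by rw [map_mul, hT0, zero_mul]
  obtain ⟨c, -, hcJ, hc⟩ := (System.formal K).tougeron (f := f) (fun _ => Algebra.mem_top) hy0
    (fun _ => Algebra.mem_top) e (minor_subst f e hy0) (p := T * (T - s)) hpp Algebra.mem_top
    (ε := fun i => W⁻¹ ^ 2 * q i) (fun _ => Algebra.mem_top) (by
      intro i
      rw [hq, hW]
      have : W * W⁻¹ = 1 := MvPowerSeries.mul_inv_cancel _ hW0
      linear_combination (-(T * s ^ (2 * d) * (T - s) * q i)) * (W * W⁻¹ + 1) * this)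
  set δ := (minor f e).subst y0 with hδ
  let Ψ : ν → MvPowerSeries (Option Unit) K := fun t => y0 t + δ * (T * (T - s)) * c t
  have hΨ0 : ∀ t, constantCoeff (Ψ t) = 0 := fun t => by
    simp only [Ψ]; rw [map_add, map_mul, map_mul, hpp, hy0]; ring
  have hΨz : ∀ t, (Ψ t).subst (spec (0 : MvPowerSeries Unit K)) = A t := by
    intro t
    simp only [Ψ]
    rw [subst_add hsz, subst_mul hsz, subst_mul hsz, subst_mul hsz, hTz, hy0z]; ring
  have hΨX : ∀ t, (Ψ t).subst (spec (X ())) = B t := by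
    intro t
    simp only [Ψ]
    rw [subst_add hsp, subst_mul hsp, subst_mul hsp, subst_mul hsp, subst_sub hsp, hTX, hsX, hy0X]
    ring
  have hsubz : ∀ G : MvPowerSeries ν K, (G.subst Ψ).subst (spec (0 : MvPowerSeries Unit K)) =
      (G.subst a).subst l := by
    intro G
    rw [subst_subst hΨ0 (constantCoeff_spec (map_zero _))]
    simp only [hΨz]
    exact hsA G
  have hfin := subst_eq_zero_of_path (σ := Unit) (f := f) (e := e) hΨ0 hc ?_ J ?_ I ?_ hD F hF
  · have h1 := congrArg (subst (spec (X () : MvPowerSeries Unit K))) hfin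
    rw [subst_subst hΨ0 (constantCoeff_spec hXu), subst_zero' (constantCoeff_spec hXu)] at h1
    simp only [hΨX] at h1
    rw [hsB, hwg] at h1
    exact mul_ne_zero (pow_ne_zero _ hX0) hwg0 h1
  · rw [hsubz, hwd]
    refine mul_ne_zero (pow_ne_zero _ hX0) ?_
    rintro rfl; exact hwd0 (map_zero _)
  · intro t ht
    have h1 : c t = 0 := hcJ t fun i hi => ht (hi ▸ he i)
    have h2 : (ren some (0 : MvPowerSeries Unit K) : MvPowerSeries (Option Unit) K) = 0 :=
      subst_zero' fun _ => constantCoeff_X' _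
    simp only [Ψ, y0, h1, hEJ t ht, h2, mul_zero, add_zero]
    exact pderiv_ren _ _ (by simp)
  · intro G hG
    rw [hsubz, hI G hG, subst_zero' hv0]

end Path
end Artin

namespace Artin
open MvPowerSeries

variable {K : Type} [Field K] (S : System K)

/-- Artin's approximation property for the system `S` in the variables `σ`. -/
def Approx (σ : Type) [Finite σ] : Prop :=
  ∀ (τ ι : Type) [Finite τ] (f : ι → MvPowerSeries (τ ⊕ σ) K), (∀ i, f i ∈ S.A (τ ⊕ σ)) →
    ∀ y : τ → MvPowerSeries σ K, (∀ t, constantCoeff (y t) = 0) →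
    (∀ i, (f i).subst (Sum.elim y X) = 0) → ∀ κ : ℕ,
    ∃ z : τ → MvPowerSeries σ K, (∀ t, z t ∈ S.A σ) ∧ (∀ t, constantCoeff (z t) = 0) ∧
      (∀ i, (f i).subst (Sum.elim z X) = 0) ∧ ∀ t, z t - y t ∈ ordIdeal σ K κ

variable {σ τ : Type} [Finite σ] [Finite τ]

theorem constantCoeff_elim_X' {R : Type*} [CommRing R] {σ τ : Type*} {z : τ → MvPowerSeries σ R}
    (hz : ∀ i, constantCoeff (z i) = 0) (x : τ ⊕ σ) : constantCoeff (Sum.elim z X x) = 0 := by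
  cases x with
  | inl i => exact hz i
  | inr r => exact constantCoeff_X' r

theorem lowPoly_mem_ordIdeal {D N : ℕ} {a : Fin D → MvPowerSeries σ K}
    (h : ∀ j, a j ∈ ordIdeal σ K N) : lowPoly D a ∈ ordIdeal (Option σ) K N := by
  refine sum_mem fun j _ => Ideal.mul_mem_right _ _ ?_
  exact subst_mem_ordIdeal (fun _ => constantCoeff_X' _) (h j)

theorem lowPoly_sub {D : ℕ} (a b : Fin D → MvPowerSeries σ K) :
    lowPoly D a - lowPoly D b = lowPoly D fun j => a j - b j := by
  simp only [lowPoly]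
  rw [← Finset.sum_sub_distrib]
  refine Finset.sum_congr rfl fun j _ => ?_
  rw [ren, ren, ren, subst_sub (hasSubst_zero fun _ => constantCoeff_X' _), sub_mul]

/-- The unknowns of the reduced system: coefficients of remainders and of the
Weierstrass polynomial. -/
abbrev Unk (τ : Type) (D : ℕ) : Type := (τ × Fin D) ⊕ Fin D

/-- Polynomials in the distinguished variable with undetermined coefficients. -/
def genY {D : ℕ} (c : τ → Fin D → K) :
    τ ⊕ Option σ → MvPowerSeries (Option (Unk τ D ⊕ σ)) K :=
  Sum.elim (fun k => lowPoly D fun j => C (c k j) + X (Sum.inl (Sum.inl (k, j))))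
    fun o => X (o.map Sum.inr)

/-- Specialization of `genY`. -/
def specY {D : ℕ} (c : τ → Fin D → K) (t : Unk τ D → MvPowerSeries σ K) :
    τ → MvPowerSeries (Option σ) K :=
  fun k => lowPoly D fun j => C (c k j) + t (Sum.inl (k, j))

variable {D : ℕ} {c : τ → Fin D → K}

theorem constantCoeff_specY (hc : ∀ k (j : Fin D), (j : ℕ) = 0 → c k j = 0)
    {t : Unk τ D → MvPowerSeries σ K} (ht : ∀ x, constantCoeff (t x) = 0) (k : τ) :
    constantCoeff (specY c t k) = 0 := by
  refine constantCoeff_lowPoly fun j hj => ?_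
  rw [map_add, ht, hc k j hj, map_zero, map_zero, add_zero]

omit [Finite τ] in
theorem constantCoeff_genY [Finite τ] (hc : ∀ k (j : Fin D), (j : ℕ) = 0 → c k j = 0) (x : τ ⊕ Option σ) :
    constantCoeff (genY (σ := σ) c x) = 0 := by
  rcases x with k | o
  · refine constantCoeff_lowPoly fun j hj => ?_
    rw [map_add, constantCoeff_X', hc k j hj, map_zero, map_zero, add_zero]
  · exact constantCoeff_X' _

theorem System.genY_mem (x : τ ⊕ Option σ) : genY (σ := σ) c x ∈ S.A (Option (Unk τ D ⊕ σ)) := by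
  rcases x with k | o
  · exact S.lowPoly_mem fun j => add_mem (S.C_mem _) (S.X_mem _)
  · exact S.X_mem _

theorem System.specY_mem {t : Unk τ D → MvPowerSeries σ K} (ht : ∀ x, t x ∈ S.A σ) (k : τ) :
    specY c t k ∈ S.A (Option σ) :=
  S.lowPoly_mem fun _ => add_mem (S.C_mem _) (ht _)

theorem genY_subst (hc : ∀ k (j : Fin D), (j : ℕ) = 0 → c k j = 0)
    {t : Unk τ D → MvPowerSeries σ K} (ht : ∀ x, constantCoeff (t x) = 0)
    (F : MvPowerSeries (τ ⊕ Option σ) K) :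
    (F.subst (genY c)).subst (lift (Sum.elim t X)) = F.subst (Sum.elim (specY c t) X) := by
  have h0 := constantCoeff_elim_X' ht
  have hs := hasSubst_zero (constantCoeff_lift h0)
  rw [subst_subst (constantCoeff_genY hc) (constantCoeff_lift h0)]
  congr 1
  funext x
  rcases x with k | o
  · simp only [genY, specY, Sum.elim_inl]
    rw [lowPoly_subst_lift h0]
    congr 1
    funext j
    rw [subst_add (hasSubst_zero h0), subst_X (hasSubst_zero h0), Sum.elim_inl,
      ← substAlgHom_apply (hasSubst_zero h0)]
    congr 1
    exact AlgHom.commutes _ _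
  · simp only [genY, Sum.elim_inr]
    rw [subst_X hs]
    rcases o with _ | s
    · rfl
    · exact subst_X (hasSubst_zero fun _ => constantCoeff_X' _) s

/-- The coefficients of the remainder in the division by the generic Weierstrass polynomial. -/
def remY (F : MvPowerSeries (Option (Unk τ D ⊕ σ)) K) (j : Fin D) :
    MvPowerSeries (Unk τ D ⊕ σ) K :=
  (divR D F j).subst (Sum.elim X fun j => X (Sum.inl (Sum.inr j)))

theorem System.remY_mem {F : MvPowerSeries (Option (Unk τ D ⊕ σ)) K} (hF : F ∈ S.A _) (j : Fin D) :
    remY F j ∈ S.A (Unk τ D ⊕ σ) := by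
  refine S.subst_mem ?_ (constantCoeff_elim_X fun _ => constantCoeff_X' _) (S.divR_mem hF j)
  rintro (x | x) <;> exact S.X_mem _

/-- Division of a specialization by the specialized Weierstrass polynomial. -/
theorem genY_division {t : Unk τ D → MvPowerSeries σ K} (ht : ∀ x, constantCoeff (t x) = 0)
    (F : MvPowerSeries (Option (Unk τ D ⊕ σ)) K) :
    F.subst (lift (Sum.elim t X)) =
      (divQ D F).subst (lift (Sum.elim (Sum.elim t X) fun j => t (Sum.inr j))) *
        monicW D (fun j => t (Sum.inr j)) +
      lowPoly D fun j => (remY F j).subst (Sum.elim t X) := by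
  have h0 := constantCoeff_elim_X' ht
  rw [division_subst (α := fun j => t (Sum.inr j)) h0 fun j => ht _]
  congr 2
  funext j
  rw [remY, subst_subst (constantCoeff_elim_X fun _ => constantCoeff_X' _) h0]
  congr 1
  funext x
  rcases x with x | x
  · exact (subst_X (hasSubst_zero h0) _).symm
  · exact (subst_X (R := K) (hasSubst_zero h0) (Sum.inl (Sum.inr x))).symm

theorem lowPoly_zero' : (lowPoly D fun _ => (0 : MvPowerSeries σ K)) = 0 :=
  Finset.sum_eq_zero fun j _ => by
    have : (ren some (0 : MvPowerSeries σ K) : MvPowerSeries (Option σ) K) = 0 :=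
      subst_zero' fun _ => constantCoeff_X' _
    rw [this, zero_mul]

theorem monicW_mem_ordIdeal_of {W w Δ : MvPowerSeries (Option σ) K} {κ : ℕ} (hw : constantCoeff w ≠ 0)
    (h : Δ = w * W) (hΔ : Δ ∈ ordIdeal (Option σ) K κ) : W ∈ ordIdeal (Option σ) K κ := by
  have : W = w⁻¹ * Δ := by
    rw [h, ← mul_assoc, MvPowerSeries.inv_mul_cancel _ hw, one_mul]
  rw [this]
  exact Ideal.mul_mem_left _ _ hΔ

/-- The restriction of a series to the axis of the distinguished variable. -/
def axis (F : MvPowerSeries (Option σ) K) : MvPowerSeries Unit K :=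
  F.subst fun o => o.elim (X ()) fun _ => 0

theorem constantCoeff_axis_map (o : Option σ) :
    constantCoeff (o.elim (X ()) fun _ => (0 : MvPowerSeries Unit K)) = 0 := by
  rcases o with _ | s
  exacts [constantCoeff_X' _, map_zero _]

theorem coeff_of_order_axis {F : MvPowerSeries (Option σ) K} {N : ℕ} (h : (axis F).order = N) :
    (∀ k < N, coeff (Finsupp.single none k) F = 0) ∧ coeff (Finsupp.single none N) F ≠ 0 := by
  obtain ⟨⟨d, hd, hdN⟩, h2⟩ := order_eq_nat.1 h
  have hd' : d = Finsupp.single () N := by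
    ext; rw [← hdN]; simp [Finsupp.degree_eq_sum]
  refine ⟨fun k hk => ?_, ?_⟩
  · rw [← coeff_single_subst_axis]
    exact h2 _ (by simpa using hk)
  · rw [← coeff_single_subst_axis]
    rw [hd'] at hd
    exact hd

theorem axis_ne_zero {F : MvPowerSeries (Option σ) K} {d : ℕ}
    (h : coeff (Finsupp.single none d) F ≠ 0) : axis F ≠ 0 := by
  intro h0
  rw [← coeff_single_subst_axis] at h
  exact h (by rw [show (F.subst fun o : Option σ => o.elim (X ()) fun _ => 0) = 0 from h0]; rfl)

theorem order_axis_sq_mul {F : MvPowerSeries (Option σ) K} {d : ℕ} (h : (axis F).order = d) (κ : ℕ) :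
    (axis (F ^ 2 * X none ^ κ)).order = (2 * d + κ : ℕ) := by
  have hs := hasSubst_zero (constantCoeff_axis_map (K := K) (σ := σ))
  rw [axis, subst_mul hs, subst_pow hs, subst_pow hs, subst_X hs, order_mul, pow_two, order_mul]
  rw [show (F.subst fun o : Option σ => o.elim (X ()) fun _ => 0) = axis F from rfl, h]
  have : ((X () : MvPowerSeries Unit K) ^ κ).order = κ := by
    rw [X_pow_eq, order_monomial_of_ne_zero one_ne_zero]
    simp
  change _ + ((X () : MvPowerSeries Unit K) ^ κ).order = _
  rw [this]
  push_cast; ring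

theorem approx_of_regular (hσ : Approx S σ) {n : ℕ} {f : Fin n → MvPowerSeries (τ ⊕ Option σ) K}
    (hf : ∀ i, f i ∈ S.A _) {e : Fin n → τ ⊕ Option σ} (he : ∀ i, e i ∈ Set.range Sum.inl)
    {y : τ → MvPowerSeries (Option σ) K} (hy0 : ∀ t, constantCoeff (y t) = 0)
    (hy : ∀ i, (f i).subst (Sum.elim y X) = 0) {d : ℕ}
    (hreg : coeff (Finsupp.single none d) ((minor f e).subst (Sum.elim y X)) ≠ 0)
    (κ : ℕ) (hκ : 1 ≤ κ) :
    ∃ z : τ → MvPowerSeries (Option σ) K, (∀ t, z t ∈ S.A _) ∧ (∀ t, constantCoeff (z t) = 0) ∧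
      (∀ i, (f i).subst (Sum.elim z X) = 0) ∧ ∀ t, z t - y t ∈ ordIdeal _ K κ := by
  classical
  set Y : τ ⊕ Option σ → MvPowerSeries (Option σ) K := Sum.elim y X with hY
  have hY0 : ∀ x, constantCoeff (Y x) = 0 := constantCoeff_elim_X' hy0
  set δ := (minor f e).subst Y with hδ
  obtain ⟨d', hd'⟩ := ENat.ne_top_iff_exists.1 (mt order_eq_top_iff.1 (axis_ne_zero hreg))
  set D := 2 * d' + κ with hD
  obtain ⟨hΔ0, hΔD⟩ := coeff_of_order_axis (order_axis_sq_mul hd'.symm κ)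
  obtain ⟨α, -, hα0, w, -, hw0, hw⟩ := (System.formal K).preparation (Δ := δ ^ 2 * X none ^ κ)
    Algebra.mem_top hΔ0 hΔD
  have hX0 : ∀ s : σ, constantCoeff (X s : MvPowerSeries σ K) = 0 := constantCoeff_X'
  set W := monicW D α with hW
  have hXκ : (X none : MvPowerSeries (Option σ) K) ^ κ ∈ ordIdeal (Option σ) K κ := by
    simpa using pow_mem_ordIdeal (X_mem_ordIdeal (R := K) (none : Option σ)) κ
  have hWκ : W ∈ ordIdeal (Option σ) K κ :=
    monicW_mem_ordIdeal_of hw0 hw (Ideal.mul_mem_left _ _ hXκ)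
  have hW0 : constantCoeff W = 0 := mem_ordIdeal_one.1 (ordIdeal_anti hκ hWκ)
  -- divide the formal solution
  have hdiv : ∀ k, ∃ q r, y k = q * W + lowPoly D r := fun k => by
    have := division_subst (b := X) hX0 hα0 (y k)
    rw [lift_X, subst_X_self] at this
    exact ⟨_, _, this⟩
  choose q r hqr using hdiv
  let c : τ → Fin D → K := fun k j => constantCoeff (r k j)
  have hc : ∀ k (j : Fin D), (j : ℕ) = 0 → c k j = 0 := by
    intro k j hj
    have h1 := hy0 k
    rw [hqr, map_add, map_mul, hW0, mul_zero, zero_add, lowPoly, map_sum,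
      Finset.sum_eq_single j] at h1
    · rwa [hj, pow_zero, mul_one, constantCoeff_ren] at h1
    · intro j' _ hj'
      rw [map_mul, map_pow, constantCoeff_X', zero_pow, mul_zero]
      intro h
      exact hj' (Fin.ext (h.trans hj.symm))
    · simp
  let t : Unk τ D → MvPowerSeries σ K :=
    Sum.elim (fun x => r x.1 x.2 - C (c x.1 x.2)) α
  have ht : ∀ x, constantCoeff (t x) = 0 := by
    rintro (x | j)
    · simp [t, c]
    · exact hα0 j
  have hrt : ∀ k, specY c t k = lowPoly D (r k) := by
    intro k
    simp only [specY, t, Sum.elim_inl]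
    congr 1
    funext j
    ring
  have hst0 := constantCoeff_elim_X' (constantCoeff_specY hc ht)
  have hsub : ∀ F : MvPowerSeries (τ ⊕ Option σ) K,
      W ∣ F.subst Y - F.subst (Sum.elim (specY c t) X) := by
    intro F
    have := taylor_one hst0 (Sum.elim q fun _ => 0) hW0 F
    convert this using 2
    congr 1
    funext x
    rcases x with k | o
    · simp only [hY, Sum.elim_inl]
      rw [hqr, hrt]; ring
    · simp [hY]
  -- the reduced system
  let G : Fin n → MvPowerSeries (Option (Unk τ D ⊕ σ)) K := fun i => (f i).subst (genY c)
  let E : MvPowerSeries (Option (Unk τ D ⊕ σ)) K := ((minor f e).subst (genY c)) ^ 2 * X none ^ κ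
  have hGA : ∀ i, G i ∈ S.A _ := fun i => S.subst_mem (S.genY_mem) (constantCoeff_genY hc) (hf i)
  have hmA : minor f e ∈ S.A _ := S.det_mem fun i b => S.pderiv_mem _ (hf i)
  have hEA : E ∈ S.A _ := mul_mem (pow_mem (S.subst_mem S.genY_mem (constantCoeff_genY hc) hmA) _)
    (pow_mem (S.X_mem _) _)
  have hEs : ∀ {t' : Unk τ D → MvPowerSeries σ K}, (∀ x, constantCoeff (t' x) = 0) →
      E.subst (lift (Sum.elim t' X)) =
        ((minor f e).subst (Sum.elim (specY c t') X)) ^ 2 * X none ^ κ := by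
    intro t' ht'
    have hs := hasSubst_zero (constantCoeff_lift (constantCoeff_elim_X' ht'))
    simp only [E]
    rw [subst_mul hs, subst_pow hs, subst_pow hs, genY_subst hc ht', subst_X hs]
    rfl
  have hGt : ∀ i, W ∣ (G i).subst (lift (Sum.elim t X)) := by
    intro i
    rw [genY_subst hc ht]
    have := hsub (f i)
    rwa [hy, zero_sub, dvd_neg] at this
  obtain ⟨u, hu⟩ := hsub (minor f e)
  have hEt : E.subst (lift (Sum.elim t X)) =
      (w + (u * (W * u - 2 * δ)) * X none ^ κ) * W := by
    rw [hEs ht, show (minor f e).subst (Sum.elim (specY c t) X) = δ - W * u by rw [← hu]; ring]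
    linear_combination hw
  have hdu : ∀ (F : MvPowerSeries (Option (Unk τ D ⊕ σ)) K) (v : MvPowerSeries (Option σ) K),
      F.subst (lift (Sum.elim t X)) = v * W → (divQ D F).subst
        (lift (Sum.elim (Sum.elim t X) fun j => t (Sum.inr j))) = v ∧
        ∀ j, (remY F j).subst (Sum.elim t X) = 0 := by
    intro F v hv
    have h1 := genY_division ht F
    rw [hv] at h1
    change _ = _ * W + _ at h1
    have h2 := division_unique (a := α) (r := fun j => (remY F j).subst (Sum.elim t X))
      (q := (divQ D F).subst (lift (Sum.elim (Sum.elim t X) fun j => t (Sum.inr j))) - v) hα0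
      (by linear_combination -h1)
    exact ⟨sub_eq_zero.1 h2.1, congrFun h2.2⟩
  let g : (Fin n × Fin D) ⊕ Fin D → MvPowerSeries (Unk τ D ⊕ σ) K :=
    Sum.elim (fun x => remY (G x.1) x.2) (remY E)
  obtain ⟨t', ht'A, ht', hgt', htt'⟩ := hσ (Unk τ D) ((Fin n × Fin D) ⊕ Fin D) g (by
      rintro (x | j)
      · exact S.remY_mem (hGA _) _
      · exact S.remY_mem hEA _) t ht (by
      rintro (x | j)
      · obtain ⟨v, hv⟩ := hGt x.1
        exact (hdu _ v (hv.trans (mul_comm _ _))).2 _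
      · exact (hdu _ _ hEt).2 _) κ
  have hred : ∀ F : MvPowerSeries (Option (Unk τ D ⊕ σ)) K,
      (∀ j, (remY F j).subst (Sum.elim t' X) = 0) → F.subst (lift (Sum.elim t' X)) =
      (divQ D F).subst (lift (Sum.elim (Sum.elim t' X) fun j => t' (Sum.inr j))) *
        monicW D (fun j => t' (Sum.inr j)) := by
    intro F hF
    rw [genY_division ht' F]
    simp only [hF, lowPoly_zero', add_zero]
  set W' := monicW D (fun j => t' (Sum.inr j)) with hW'
  have hll : ∀ {t' : Unk τ D → MvPowerSeries σ K}, (∀ x, constantCoeff (t' x) = 0) → ∀ o,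
      constantCoeff (lift (Sum.elim (Sum.elim t' X) fun j => t' (Sum.inr j)) o) = 0 := by
    intro t' ht'
    refine constantCoeff_lift ?_
    rintro (x | j)
    exacts [constantCoeff_elim_X' ht' x, ht' _]
  have hllA : ∀ o, lift (Sum.elim (Sum.elim t' X) fun j => t' (Sum.inr j)) o ∈ S.A (Option σ) := by
    refine S.lift_mem ?_
    rintro ((x | j) | j)
    exacts [ht'A x, S.X_mem _, ht'A _]
  set qE := (divQ D E).subst (lift (Sum.elim (Sum.elim t' X) fun j => t' (Sum.inr j))) with hqE
  have hqE0 : constantCoeff qE ≠ 0 := by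
    rw [hqE, constantCoeff_subst' (hll ht') (divQ D E), ← constantCoeff_subst' (hll ht) (divQ D E)]
    rw [(hdu _ _ hEt).1, map_add, map_mul, map_pow, constantCoeff_X', zero_pow (by omega),
      mul_zero, add_zero]
    exact hw0
  have hqEA : qE ∈ S.A (Option σ) := S.subst_mem hllA (hll ht') (S.divQ_mem hEA)
  -- the approximate solution
  have hz0 := constantCoeff_specY hc ht'
  have hzA : ∀ k, specY c t' k ∈ S.A (Option σ) := S.specY_mem ht'A
  set Z : τ ⊕ Option σ → MvPowerSeries (Option σ) K := Sum.elim (specY c t') X with hZ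
  have hZ0 : ∀ x, constantCoeff (Z x) = 0 := constantCoeff_elim_X' hz0
  have hZA : ∀ x, Z x ∈ S.A (Option σ) := by
    rintro (k | o)
    exacts [hzA k, S.X_mem _]
  have hEZ := hred E fun j => hgt' (Sum.inr j)
  rw [hEs ht'] at hEZ
  obtain ⟨v, hvA, hv0, hv⟩ := S.tougeron hf hZ0 hZA e (δ := (minor f e).subst Z)
    (minor_subst f e hZ0) (p := X none ^ κ)
    (by rw [map_pow, constantCoeff_X', zero_pow (by omega)]) (pow_mem (S.X_mem _) _)
    (ε := fun i => qE⁻¹ * (divQ D (G i)).subst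
      (lift (Sum.elim (Sum.elim t' X) fun j => t' (Sum.inr j))))
    (fun i => mul_mem (S.inv_mem hqEA hqE0) (S.subst_mem hllA (hll ht') (S.divQ_mem (hGA i)))) (by
      intro i
      have h1 := hred (G i) fun j => hgt' (Sum.inl (i, j))
      rw [genY_subst hc ht'] at h1
      rw [hEZ, h1]
      have h2 := MvPowerSeries.mul_inv_cancel _ hqE0
      linear_combination (-(W' * (divQ D (G i)).subst
        (lift (Sum.elim (Sum.elim t' X) fun j => t' (Sum.inr j))))) * h2)
  have hpκ : ∀ x, (minor f e).subst Z * X none ^ κ * v x ∈ ordIdeal (Option σ) K κ := fun x =>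
    Ideal.mul_mem_right _ _ (Ideal.mul_mem_left _ _ hXκ)
  refine ⟨fun k => specY c t' k + (minor f e).subst Z * X none ^ κ * v (Sum.inl k), fun k => ?_,
    fun k => ?_, fun i => ?_, fun k => ?_⟩
  · exact add_mem (hzA k) (mul_mem (mul_mem (S.subst_mem hZA hZ0 hmA) (pow_mem (S.X_mem _) _))
      (hvA _))
  · rw [map_add, hz0, mem_ordIdeal_one.1 (ordIdeal_anti hκ (hpκ _)), zero_add]
  · rw [← hv i]
    congr 1
    funext x
    rcases x with k | o
    · rfl
    · have : v (Sum.inr o) = 0 := hv0 _ fun b hb => by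
        obtain ⟨k, hk⟩ := he b
        rw [hb] at hk
        cases hk
      simp [hZ, this]
  · have h1 : specY c t' k - y k = (specY c t' k - specY c t k) - q k * W := by
      rw [hrt, hqr k]; ring
    rw [add_sub_right_comm, h1]
    refine add_mem (sub_mem ?_ (Ideal.mul_mem_left _ _ hWκ)) (hpκ _)
    simp only [specY]
    rw [lowPoly_sub]
    refine lowPoly_mem_ordIdeal fun j => ?_
    rw [add_sub_add_left_eq_sub]
    exact htt' _

end Artin

namespace Artin
open MvPowerSeries

variable {K : Type} [Field K] (S : System K)

/-- The system `f` has a solution in `S` close to `y`. -/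
def SolvesNear {σ τ ι : Type} [Finite σ] (f : ι → MvPowerSeries (τ ⊕ σ) K)
    (y : τ → MvPowerSeries σ K) (κ : ℕ) : Prop :=
  ∃ z : τ → MvPowerSeries σ K, (∀ t, z t ∈ S.A σ) ∧ (∀ t, constantCoeff (z t) = 0) ∧
      (∀ i, (f i).subst (Sum.elim z X) = 0) ∧ ∀ t, z t - y t ∈ ordIdeal σ K κ

section Change

variable {σ ρ τ ι : Type}

/-- The map of variables underlying `chg`. -/
def chgMap (τ : Type) (Λ : σ → MvPowerSeries ρ K) : τ ⊕ σ → MvPowerSeries (τ ⊕ ρ) K :=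
  Sum.elim (fun t => X (Sum.inl t)) fun s => ren Sum.inr (Λ s)

/-- Change of the independent variables in an equation. -/
def chg (Λ : σ → MvPowerSeries ρ K) (F : MvPowerSeries (τ ⊕ σ) K) : MvPowerSeries (τ ⊕ ρ) K :=
  F.subst (chgMap τ Λ)

variable [Finite σ] [Finite τ] [Finite ρ]

theorem constantCoeff_chgMap {Λ : σ → MvPowerSeries ρ K} (h : ∀ s, constantCoeff (Λ s) = 0)
    (x : τ ⊕ σ) : constantCoeff (chgMap τ Λ x) = 0 := by
  rcases x with t | s
  · exact constantCoeff_X' _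
  · exact (constantCoeff_ren _ _).trans (h s)

theorem chg_subst {Λ : σ → MvPowerSeries ρ K} (h : ∀ s, constantCoeff (Λ s) = 0)
    {z : τ → MvPowerSeries ρ K} (hz : ∀ t, constantCoeff (z t) = 0)
    (F : MvPowerSeries (τ ⊕ σ) K) :
    (chg Λ F).subst (Sum.elim z X) = F.subst (Sum.elim z Λ) := by
  have h0 := constantCoeff_elim_X' hz
  rw [chg, subst_subst (constantCoeff_chgMap h) h0]
  congr 1
  funext x
  rcases x with t | s
  · exact subst_X (R := K) (hasSubst_zero h0) (Sum.inl t)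
  · have := ren_subst (Sum.inr : ρ → τ ⊕ ρ) h0 (Λ s)
    refine this.trans ?_
    exact subst_X_self _

theorem subst_elim_subst {Λ : σ → MvPowerSeries ρ K} (h : ∀ s, constantCoeff (Λ s) = 0)
    {y : τ → MvPowerSeries σ K} (hy : ∀ t, constantCoeff (y t) = 0)
    (F : MvPowerSeries (τ ⊕ σ) K) :
    (F.subst (Sum.elim y X)).subst Λ = F.subst (Sum.elim (fun t => (y t).subst Λ) Λ) := by
  rw [subst_subst (constantCoeff_elim_X' hy) h]
  congr 1
  funext x
  rcases x with t | s
  · rfl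
  · exact subst_X (hasSubst_zero h) _

theorem System.chg_mem {Λ : σ → MvPowerSeries ρ K} (h : ∀ s, constantCoeff (Λ s) = 0)
    (hA : ∀ s, Λ s ∈ S.A ρ) {F : MvPowerSeries (τ ⊕ σ) K} (hF : F ∈ S.A _) :
    chg Λ F ∈ S.A (τ ⊕ ρ) := by
  refine S.subst_mem ?_ (constantCoeff_chgMap h) hF
  rintro (t | s)
  exacts [S.X_mem _, S.ren_mem _ (hA s)]

theorem solvesNear_of_change {Λ : σ → MvPowerSeries ρ K} (h : ∀ s, constantCoeff (Λ s) = 0)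
    {Λ' : ρ → MvPowerSeries σ K} (h' : ∀ s, constantCoeff (Λ' s) = 0)
    (hA' : ∀ r, Λ' r ∈ S.A σ) (hΛ : ∀ s, (Λ s).subst Λ' = X s)
    {f : ι → MvPowerSeries (τ ⊕ σ) K} {y : τ → MvPowerSeries σ K}
    {κ : ℕ} (hs : SolvesNear S (fun i => chg Λ (f i)) (fun t => (y t).subst Λ) κ) :
    SolvesNear S f y κ := by
  obtain ⟨z, hzA, hz0, hfz, hzy⟩ := hs
  refine ⟨fun t => (z t).subst Λ', fun t => S.subst_mem hA' h' (hzA t),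
    fun t => (constantCoeff_subst' h' _).trans (hz0 t), fun i => ?_, fun t => ?_⟩
  · have h1 := congrArg (subst Λ') (hfz i)
    have h2 : ∀ x, constantCoeff (Sum.elim z Λ x) = 0 := by
      rintro (x | x); exacts [hz0 x, h x]
    rw [chg_subst h hz0, subst_subst h2 h', subst_zero' h'] at h1
    rw [← h1]
    congr 1
    funext x
    rcases x with x | x
    · rfl
    · exact (hΛ x).symm
  · have h1 := subst_mem_ordIdeal h' (hzy t)
    rw [subst_sub (hasSubst_zero h'), subst_subst h h'] at h1
    simp only [hΛ] at h1
    rwa [subst_X_self] at h1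

theorem pderiv_chg {Λ : σ → MvPowerSeries ρ K} (h : ∀ s, constantCoeff (Λ s) = 0)
    (F : MvPowerSeries (τ ⊕ σ) K) (t : τ) :
    pderiv K (Sum.inl t) (chg Λ F) = chg Λ (pderiv K (Sum.inl t) F) := by
  classical
  have := Fintype.ofFinite τ
  have := Fintype.ofFinite σ
  rw [chg, pderiv_subst (constantCoeff_chgMap h), Fintype.sum_sum_type,
    Finset.sum_eq_single t, Finset.sum_eq_zero, add_zero]
  · simp [chgMap, chg]
  · intro s _
    simp only [chgMap, Sum.elim_inr]
    rw [pderiv_ren _ _ (by simp), mul_zero]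
  · intro t' _ ht'
    simp only [chgMap, Sum.elim_inl]
    rw [pderiv_X_of_ne, mul_zero]
    simpa using ht'
  · simp

theorem minor_chg {Λ : σ → MvPowerSeries ρ K} (h : ∀ s, constantCoeff (Λ s) = 0) {n : ℕ}
    (f : Fin n → MvPowerSeries (τ ⊕ σ) K) (e : Fin n → τ) :
    minor (fun i => chg Λ (f i)) (fun b => Sum.inl (e b)) =
      chg Λ (minor f fun b => Sum.inl (e b)) := by
  rw [chg, minor_subst _ _ (constantCoeff_chgMap h), minor]
  simp only [pderiv_chg h]
  rfl

end Change

section Main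

variable {σ τ : Type} [Finite σ] [Finite τ]

theorem exists_coeff_ne_zero_of_axis {F : MvPowerSeries (Option σ) K} (h : axis F ≠ 0) :
    ∃ d, coeff (Finsupp.single none d) F ≠ 0 := by
  by_contra! hc
  refine h (MvPowerSeries.ext fun d => ?_)
  have : d = Finsupp.single () (d ()) := by ext; simp
  rw [this, axis, coeff_single_subst_axis, hc]
  rfl

variable [CharZero K]

theorem approx_of_minor (hσ : Approx S σ) {n : ℕ} {f : Fin n → MvPowerSeries (τ ⊕ Option σ) K}
    (hf : ∀ i, f i ∈ S.A _) (e : Fin n → τ)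
    {y : τ → MvPowerSeries (Option σ) K} (hy0 : ∀ t, constantCoeff (y t) = 0)
    (hy : ∀ i, (f i).subst (Sum.elim y X) = 0)
    (hm : (minor f fun b => Sum.inl (e b)).subst (Sum.elim y X) ≠ 0)
    (κ : ℕ) (hκ : 1 ≤ κ) : SolvesNear S f y κ := by
  set δ := (minor f fun b => Sum.inl (e b)).subst (Sum.elim y X) with hδ
  have hXδ : (X none : MvPowerSeries (Option σ) K) * δ ≠ 0 := mul_ne_zero prime_X_none.1 hm
  obtain ⟨N, hN⟩ := ENat.ne_top_iff_exists.1 (mt order_eq_top_iff.1 hXδ)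
  obtain ⟨v, w, hw0, hw⟩ := exists_line hN.symm
  have hl0 := fun s => constantCoeff_line_map v s
  have hne : (X none * δ).subst (fun s => C (v s) * X ()) ≠ (0 : MvPowerSeries Unit K) := by
    rw [hw]
    refine mul_ne_zero (pow_ne_zero _ ?_) ?_
    · intro h
      have := congrArg (coeff (Finsupp.single () 1)) h
      rw [coeff_single_one, pderiv_X_self] at this
      simp at this
    · rintro rfl; exact hw0 (map_zero _)
  rw [subst_mul (hasSubst_zero hl0), subst_X (hasSubst_zero hl0)] at hne
  have hv : v none ≠ 0 := by
    intro h; simp [h] at hne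
  have hδl := right_ne_zero_of_mul hne
  let Λ : Option σ → MvPowerSeries (Option σ) K := fun o =>
    o.elim (C (v none) * X none) fun s => X (some s) + C (v (some s)) * X none
  let Λ' : Option σ → MvPowerSeries (Option σ) K := fun o =>
    o.elim (C (v none)⁻¹ * X none) fun s => X (some s) - C (v (some s) * (v none)⁻¹) * X none
  have hX0 : ∀ s : Option σ, constantCoeff (X s : MvPowerSeries (Option σ) K) = 0 := constantCoeff_X'
  have hΛ0 : ∀ s, constantCoeff (Λ s) = 0 := by
    rintro (_ | s) <;> simp [Λ]
  have hΛ'0 : ∀ s, constantCoeff (Λ' s) = 0 := by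
    rintro (_ | s) <;> simp [Λ']
  have hΛA : ∀ s, Λ s ∈ S.A _ := by
    rintro (_ | s)
    exacts [mul_mem (S.C_mem _) (S.X_mem _),
      add_mem (S.X_mem _) (mul_mem (S.C_mem _) (S.X_mem _))]
  have hΛ'A : ∀ s, Λ' s ∈ S.A _ := by
    rintro (_ | s)
    exacts [mul_mem (S.C_mem _) (S.X_mem _),
      sub_mem (S.X_mem _) (mul_mem (S.C_mem _) (S.X_mem _))]
  have hs' := hasSubst_zero hΛ'0
  have hC : ∀ (r : K), (C r : MvPowerSeries (Option σ) K).subst Λ' = C r := fun r => by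
    rw [← substAlgHom_apply hs']; exact AlgHom.commutes (substAlgHom hs') r
  have hvv : (C (v none) : MvPowerSeries (Option σ) K) * C (v none)⁻¹ = 1 := by
    rw [← map_mul, mul_inv_cancel₀ hv, map_one]
  have hΛΛ : ∀ s, (Λ s).subst Λ' = X s := by
    rintro (_ | s)
    · simp only [Λ, Option.elim_none]
      rw [subst_mul hs', hC, subst_X hs']
      simp only [Λ', Option.elim_none]
      rw [← mul_assoc, hvv, one_mul]
    · simp only [Λ, Option.elim_some]
      rw [subst_add hs', subst_mul hs', hC, subst_X hs', subst_X hs']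
      simp only [Λ', Option.elim_none, Option.elim_some, map_mul]
      ring
  refine solvesNear_of_change S hΛ0 hΛ'0 hΛ'A hΛΛ ?_
  have hyΛ0 : ∀ t, constantCoeff ((y t).subst Λ) = 0 := fun t =>
    (constantCoeff_subst' hΛ0 _).trans (hy0 t)
  have hch : ∀ F : MvPowerSeries (τ ⊕ Option σ) K,
      (chg Λ F).subst (Sum.elim (fun t => (y t).subst Λ) X) = (F.subst (Sum.elim y X)).subst Λ := by
    intro F
    rw [chg_subst hΛ0 hyΛ0, subst_elim_subst hΛ0 hy0]
  have hax : axis (δ.subst Λ) ≠ 0 := by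
    convert hδl using 1
    rw [axis, subst_subst hΛ0 constantCoeff_axis_map]
    congr 1
    have hsa := hasSubst_zero (constantCoeff_axis_map (K := K) (σ := σ))
    have hCa : ∀ (r : K), (C r : MvPowerSeries (Option σ) K).subst
        (fun o : Option σ => o.elim (X ()) fun _ => (0 : MvPowerSeries Unit K)) = C r := fun r => by
      rw [← substAlgHom_apply hsa]; exact AlgHom.commutes (substAlgHom hsa) r
    funext o
    rcases o with _ | s
    · simp only [Λ, Option.elim_none]
      rw [subst_mul hsa, hCa, subst_X hsa]
      rfl
    · simp only [Λ, Option.elim_some]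
      rw [subst_add hsa, subst_mul hsa, hCa, subst_X hsa, subst_X hsa]
      exact zero_add _
  obtain ⟨d, hd⟩ := exists_coeff_ne_zero_of_axis hax
  refine approx_of_regular S hσ (fun i => S.chg_mem hΛ0 hΛA (hf i))
    (e := fun b => Sum.inl (e b)) (fun i => ⟨_, rfl⟩) hyΛ0 (fun i => ?_) (d := d) ?_ κ hκ
  · rw [hch, hy, subst_zero' hΛ0]
  · rwa [minor_chg hΛ0, hch]

theorem approx_option (hσ : Approx S σ) : Approx S (Option σ) := by
  classical
  intro τ ι _ f hf y hy0 hy κ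
  have hY0 := constantCoeff_elim_X' hy0
  set Y : τ ⊕ Option σ → MvPowerSeries (Option σ) K := Sum.elim y X with hY
  let I : Set (MvPowerSeries (τ ⊕ Option σ) K) := {F | F ∈ S.A _ ∧ F.subst Y = 0}
  let P : ℕ → Prop := fun n => ∃ (g : Fin n → MvPowerSeries (τ ⊕ Option σ) K) (e : Fin n → τ),
    (∀ i, g i ∈ I) ∧ (minor g fun b => Sum.inl (e b)).subst Y ≠ 0
  have hP0 : P 0 := by
    refine ⟨Fin.elim0, Fin.elim0, fun i => i.elim0, ?_⟩
    rw [minor_subst _ _ hY0, Matrix.det_isEmpty]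
    exact one_ne_zero
  have hPb : ∀ n, P n → n ≤ Nat.card τ := by
    rintro n ⟨g, e, -, hm⟩
    have hinj : Function.Injective e := by
      intro i j hij
      by_contra hne
      refine hm ?_
      rw [minor_subst _ _ hY0]
      exact Matrix.det_zero_of_column_eq hne fun k => by simp [hij]
    simpa using Nat.card_le_card_of_injective e hinj
  set n := Nat.findGreatest P (Nat.card τ) with hn
  obtain ⟨g, e, hg, hm⟩ : P n := Nat.findGreatest_spec (Nat.zero_le _) hP0
  have hnP : ¬ P (n + 1) := fun h =>
    absurd (Nat.le_findGreatest (hPb _ h) h) (by omega)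
  have hD : ∀ F ∈ I, ∀ j ∈ Set.range (Sum.inl : τ → τ ⊕ Option σ),
      minor (Fin.snoc g F : Fin (n + 1) → _)
        (Fin.snoc (fun b => Sum.inl (e b)) j : Fin (n + 1) → τ ⊕ Option σ) ∈ I := by
    rintro F hF _ ⟨j, rfl⟩
    have hsI : ∀ i, (Fin.snoc g F : Fin (n + 1) → MvPowerSeries (τ ⊕ Option σ) K) i ∈ I := by
      intro i
      refine Fin.lastCases ?_ (fun i => ?_) i
      · simpa using hF
      · simpa using hg i
    have hse : (Fin.snoc (fun b => Sum.inl (e b)) (Sum.inl j) : Fin (n + 1) → τ ⊕ Option σ) =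
        fun b => Sum.inl ((Fin.snoc e j : Fin (n + 1) → τ) b) := by
      funext b
      refine Fin.lastCases ?_ (fun i => ?_) b <;> simp
    rw [hse]
    refine ⟨S.det_mem fun i b => S.pderiv_mem _ (hsI i).1, ?_⟩
    by_contra hne
    exact hnP ⟨_, _, hsI, hne⟩
  obtain ⟨d, hd⟩ := ENat.ne_top_iff_exists.1 (mt order_eq_top_iff.1 hm)
  obtain ⟨z, hzA, hz0, hgz, hzy⟩ := approx_of_minor S hσ (fun i => (hg i).1) e hy0
    (fun i => (hg i).2) hm (max κ (2 * d + 1)) (by omega)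
  refine ⟨z, hzA, hz0, fun i => ?_, fun t => ordIdeal_anti (le_max_left _ _) (hzy t)⟩
  refine close_solution (a := Y) (b := Sum.elim z X) hY0 (constantCoeff_elim_X' hz0)
    (J := Set.range Sum.inl) ?_ (f := g) (e := fun b => Sum.inl (e b)) (fun i => ⟨_, rfl⟩)
    (fun i => (hg i).2) hgz hd.symm ?_ (I := I) (fun F hF => hF.2) hD (f i) ⟨hf i, hy i⟩
  · rintro (t | s) ht
    · exact absurd ⟨t, rfl⟩ ht
    · rfl
  · rintro (t | s)
    · exact ordIdeal_anti (le_max_right _ _) (hzy t)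
    · simp [hY]

/-- Artin's approximation theorem. -/
theorem approx (σ : Type) [Finite σ] : Approx S σ := by
  suffices h : ∀ _ : Finite σ, Approx S σ from h inferInstance
  refine Finite.induction_empty_option (P := fun σ => ∀ _ : Finite σ, Approx S σ)
    ?_ ?_ ?_ σ
  · intro α β ee hα _
    have : Finite α := Finite.of_equiv β ee.symm
    intro τ ι _ f hf y hy0 hy κ
    have h1 : ∀ s : β, constantCoeff (X (ee.symm s) : MvPowerSeries α K) = 0 :=
      fun s => constantCoeff_X' _
    have h2 : ∀ s : α, constantCoeff (X (ee s) : MvPowerSeries β K) = 0 :=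
      fun s => constantCoeff_X' _
    refine solvesNear_of_change S (Λ := fun s => X (ee.symm s)) h1 h2
      (fun _ => S.X_mem _) (fun s => ?_) ?_
    · rw [subst_X (hasSubst_zero h2), ee.apply_symm_apply]
    · have h3 : ∀ t, constantCoeff ((y t).subst fun s => (X (ee.symm s) : MvPowerSeries α K)) = 0 :=
        fun t => (constantCoeff_subst' h1 _).trans (hy0 t)
      refine hα this τ ι _ (fun i => S.chg_mem h1 (fun _ => S.X_mem _) (hf i)) _ h3 (fun i => ?_) κ
      rw [chg_subst h1 h3, ← subst_elim_subst h1 hy0, hy, subst_zero' h1]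
  · intro _ τ ι _ f hf y hy0 hy κ
    have h1 : y = fun _ => 0 := by
      funext t
      refine MvPowerSeries.ext fun d => ?_
      rw [Subsingleton.elim d 0, coeff_zero_eq_constantCoeff_apply, hy0]
      rfl
    exact ⟨y, fun t => h1 ▸ zero_mem _, hy0, hy, fun t => by simp⟩
  · intro α _ hα _
    exact approx_option S (hα inferInstance)

end Main
end Artin

namespace Artin
open MvPowerSeries
open scoped Topology
open Asymptotics Filter

section Taylor

variable {σ τ : Type*} [Fintype σ] [Fintype τ]

/-- `F` is the Taylor series of `f` at the origin, in the sense of asymptotic expansions. -/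
def Tay (F : MvPowerSeries σ ℝ) (f : (σ → ℝ) → ℝ) : Prop :=
  ∀ N : ℕ, ∃ p : MvPolynomial σ ℝ, F - (p : MvPowerSeries σ ℝ) ∈ ordIdeal σ ℝ N ∧
    (fun u => f u - MvPolynomial.eval u p) =O[𝓝 0] fun u => ‖u‖ ^ N

theorem coe_sub_poly {σ : Type*} (p q : MvPolynomial σ ℝ) :
    ((p - q : MvPolynomial σ ℝ) : MvPowerSeries σ ℝ) = p - q :=
  map_sub (MvPolynomial.coeToMvPowerSeries.ringHom (R := ℝ) (σ := σ)) p q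

theorem eval_isBigO {p : MvPolynomial σ ℝ} {N : ℕ}
    (hp : (p : MvPowerSeries σ ℝ) ∈ ordIdeal σ ℝ N) :
    (fun u => MvPolynomial.eval u p) =O[𝓝 0] fun u => ‖u‖ ^ N := by
  simp only [MvPolynomial.eval_eq]
  refine IsBigO.fun_sum fun d hd => IsBigO.const_mul_left ?_ _
  have hd' : N ≤ d.degree := by
    by_contra h
    have := hp d (not_le.1 h)
    rw [MvPolynomial.coeff_coe] at this
    exact MvPolynomial.mem_support_iff.1 hd this
  refine IsBigO.of_bound 1 ?_
  filter_upwards [Metric.ball_mem_nhds (0 : σ → ℝ) one_pos] with u hu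
  rw [mem_ball_zero_iff] at hu
  rw [one_mul, norm_pow, norm_norm, norm_prod]
  calc ∏ i ∈ d.support, ‖u i ^ d i‖ ≤ ∏ i ∈ d.support, ‖u‖ ^ d i := by
        refine Finset.prod_le_prod (fun _ _ => norm_nonneg _) fun i _ => ?_
        rw [norm_pow]
        exact pow_le_pow_left₀ (norm_nonneg _) (norm_le_pi_norm u i) _
    _ = ‖u‖ ^ d.degree := by rw [Finset.prod_pow_eq_pow_sum]; rfl
    _ ≤ ‖u‖ ^ N := pow_le_pow_of_le_one (norm_nonneg _) hu.le hd'

theorem norm_pow_isBigO {M N : ℕ} (h : M ≤ N) :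
    (fun u : σ → ℝ => ‖u‖ ^ N) =O[𝓝 0] fun u => ‖u‖ ^ M := by
  refine IsBigO.of_bound 1 ?_
  filter_upwards [Metric.ball_mem_nhds (0 : σ → ℝ) one_pos] with u hu
  rw [mem_ball_zero_iff] at hu
  rw [one_mul, norm_pow, norm_norm, norm_pow, norm_norm]
  exact pow_le_pow_of_le_one (norm_nonneg _) hu.le h

theorem eq_zero_of_isHomogeneous_of_isBigO {q : MvPolynomial σ ℝ} {N : ℕ} (hq : q.IsHomogeneous N)
    (h : (fun u => MvPolynomial.eval u q) =O[𝓝 0] fun u => ‖u‖ ^ (N + 1)) : q = 0 := by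
  refine MvPolynomial.funext fun u => ?_
  rw [map_zero]
  have ht : Tendsto (fun t : ℝ => t • u) (𝓝[≠] 0) (𝓝 0) := by
    have : Tendsto (fun t : ℝ => t • u) (𝓝 0) (𝓝 ((0 : ℝ) • u)) :=
      (continuous_id.smul continuous_const).tendsto 0
    rw [zero_smul] at this
    exact this.mono_left nhdsWithin_le_nhds
  obtain ⟨C, hC⟩ := (h.comp_tendsto ht).bound
  have h1 : ∀ᶠ t : ℝ in 𝓝[≠] 0, ‖MvPolynomial.eval u q‖ ≤ C * (|t| * ‖u‖ ^ (N + 1)) := by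
    filter_upwards [hC, self_mem_nhdsWithin] with t ht ht0
    have ht0 : 0 < |t| := abs_pos.2 ht0
    simp only [Function.comp] at ht
    have e : MvPolynomial.eval (t • u) q = t ^ N * MvPolynomial.eval u q := by
      rw [MvPolynomial.eval_eq, MvPolynomial.eval_eq, Finset.mul_sum]
      refine Finset.sum_congr rfl fun d hd => ?_
      have hd' : d.degree = N := by
        rw [Finsupp.degree_eq_weight_one]
        exact hq (MvPolynomial.mem_support_iff.1 hd)
      simp only [Pi.smul_apply, smul_eq_mul, mul_pow, Finset.prod_mul_distrib]
      rw [Finset.prod_pow_eq_pow_sum, ← hd']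
      change _ * (t ^ d.degree * _) = _
      ring
    rw [e, norm_mul, norm_smul, norm_pow, norm_pow, norm_mul, norm_norm, norm_norm,
      Real.norm_eq_abs t, mul_pow, pow_succ |t|] at ht
    refine le_of_mul_le_mul_left (ht.trans (le_of_eq ?_)) (pow_pos ht0 N)
    ring
  have h2 : Tendsto (fun t : ℝ => C * (|t| * ‖u‖ ^ (N + 1))) (𝓝[≠] 0) (𝓝 0) := by
    have : Tendsto (fun t : ℝ => C * (|t| * ‖u‖ ^ (N + 1))) (𝓝 0)
        (𝓝 (C * (|0| * ‖u‖ ^ (N + 1)))) := (by fun_prop : Continuous _).tendsto 0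
    simp only [abs_zero, zero_mul, mul_zero] at this
    exact this.mono_left nhdsWithin_le_nhds
  exact norm_le_zero_iff.1 (ge_of_tendsto h2 h1)

theorem mem_ordIdeal_of_eval_isBigO {p : MvPolynomial σ ℝ} {N : ℕ}
    (h : (fun u => MvPolynomial.eval u p) =O[𝓝 0] fun u => ‖u‖ ^ N) :
    (p : MvPowerSeries σ ℝ) ∈ ordIdeal σ ℝ N := by
  induction N with
  | zero => exact mem_ordIdeal_zero _
  | succ N ih =>
    have hp := ih (h.trans (norm_pow_isBigO N.le_succ))
    set q := MvPolynomial.homogeneousComponent N p with hq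
    have h1 : (p : MvPowerSeries σ ℝ) - (q : MvPowerSeries σ ℝ) ∈ ordIdeal σ ℝ (N + 1) := by
      intro d hd
      rw [map_sub, MvPolynomial.coeff_coe, MvPolynomial.coeff_coe, hq,
        MvPolynomial.coeff_homogeneousComponent]
      split_ifs with hd'
      · rw [sub_self]
      · have := hp d (by omega)
        rw [MvPolynomial.coeff_coe] at this
        rw [this, sub_zero]
    rw [← coe_sub_poly] at h1
    have h2 : q = 0 := by
      refine eq_zero_of_isHomogeneous_of_isBigO
        (MvPolynomial.homogeneousComponent_isHomogeneous N p) ?_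
      refine (h.sub (eval_isBigO h1)).congr_left fun u => ?_
      rw [map_sub]; ring
    rwa [h2, sub_zero] at h1

namespace Tay

variable {F G : MvPowerSeries σ ℝ} {f g : (σ → ℝ) → ℝ}

theorem isBigO_iff (h : Tay F f) (N : ℕ) :
    f =O[𝓝 0] (fun u => ‖u‖ ^ N) ↔ F ∈ ordIdeal σ ℝ N := by
  obtain ⟨p, hF, hf⟩ := h N
  constructor
  · intro h1
    have h2 : (p : MvPowerSeries σ ℝ) ∈ ordIdeal σ ℝ N := by
      refine mem_ordIdeal_of_eval_isBigO ((h1.sub hf).congr_left fun u => ?_)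
      ring
    have := add_mem hF h2
    rwa [sub_add_cancel] at this
  · intro h1
    have h2 : (p : MvPowerSeries σ ℝ) ∈ ordIdeal σ ℝ N := by
      have := sub_mem h1 hF
      rwa [sub_sub_cancel] at this
    refine (hf.add (eval_isBigO h2)).congr_left fun u => ?_
    ring

theorem add (hF : Tay F f) (hG : Tay G g) : Tay (F + G) (fun u => f u + g u) := by
  intro N
  obtain ⟨p, h1, h2⟩ := hF N
  obtain ⟨q, h3, h4⟩ := hG N
  refine ⟨p + q, ?_, (h2.add h4).congr_left fun u => ?_⟩
  · convert add_mem h1 h3 using 1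
    rw [MvPolynomial.coe_add]; ring
  · rw [map_add]; ring

theorem of_poly (p : MvPolynomial σ ℝ) : Tay (p : MvPowerSeries σ ℝ)
    (fun u => MvPolynomial.eval u p) :=
  fun N => ⟨p, by rw [sub_self]; exact zero_mem _, by simpa using isBigO_zero _ _⟩

theorem const (c : ℝ) : Tay (C c : MvPowerSeries σ ℝ) (fun _ => c) := by
  simpa using of_poly (MvPolynomial.C c : MvPolynomial σ ℝ)

theorem coord (s : σ) : Tay (X s : MvPowerSeries σ ℝ) (fun u => u s) := by
  simpa using of_poly (MvPolynomial.X s : MvPolynomial σ ℝ)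

theorem congr (hF : Tay F f) (h : f =ᶠ[𝓝 0] g) : Tay F g := by
  intro N
  obtain ⟨p, h1, h2⟩ := hF N
  exact ⟨p, h1, h2.congr' (h.mono fun u hu => by simp only [hu]) EventuallyEq.rfl⟩

theorem tendsto_eval (p : MvPolynomial σ ℝ) :
    Tendsto (fun u => MvPolynomial.eval u p) (𝓝 0) (𝓝 (MvPolynomial.eval 0 p)) :=
  (MvPolynomial.continuous_eval p).tendsto 0

theorem isBigO_one (hF : Tay F f) : f =O[𝓝 0] (fun _ => (1 : ℝ)) := by
  simpa using (hF.isBigO_iff 0).2 (mem_ordIdeal_zero _)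

theorem mul (hF : Tay F f) (hG : Tay G g) : Tay (F * G) (fun u => f u * g u) := by
  intro N
  obtain ⟨p, h1, h2⟩ := hF N
  obtain ⟨q, h3, h4⟩ := hG N
  refine ⟨p * q, ?_, ?_⟩
  · convert add_mem (Ideal.mul_mem_left _ F h3)
      (Ideal.mul_mem_left _ (q : MvPowerSeries σ ℝ) h1) using 1
    rw [MvPolynomial.coe_mul]; ring
  · have h5 := (hF.isBigO_one.mul h4).add (((tendsto_eval q).isBigO_one ℝ).mul h2)
    simp only [one_mul] at h5
    refine h5.congr_left fun u => ?_
    rw [map_mul]; ring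

theorem neg (hF : Tay F f) : Tay (-F) (fun u => - f u) := by
  have := (const (-1)).mul hF
  simpa using this

theorem sub (hF : Tay F f) (hG : Tay G g) : Tay (F - G) (fun u => f u - g u) := by
  simpa [sub_eq_add_neg] using hF.add hG.neg

theorem eq (hF : Tay F f) (hG : Tay G f) : F = G := by
  refine sub_eq_zero.1 (eq_zero_of_forall_mem_ordIdeal fun N => ?_)
  rw [← (hF.sub hG).isBigO_iff N]
  simpa using isBigO_zero _ _

theorem apply_zero (hF : Tay F f) : f 0 = constantCoeff F := by
  have h := (hF.sub (const (constantCoeff F))).isBigO_iff 1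
  have h1 := h.2 (by rw [mem_ordIdeal_one]; simp)
  obtain ⟨c, hc⟩ := h1.bound
  have h2 := hc.self_of_nhds
  rw [norm_zero, pow_one, norm_zero, mul_zero, norm_le_zero_iff] at h2
  exact sub_eq_zero.1 h2

theorem tendsto_zero (hF : Tay F f) (h0 : constantCoeff F = 0) : Tendsto f (𝓝 0) (𝓝 0) := by
  have h := (hF.isBigO_iff 1).2 (mem_ordIdeal_one.2 h0)
  refine h.trans_tendsto ?_
  simp only [pow_one]
  exact tendsto_norm_zero

theorem subst {a : τ → MvPowerSeries σ ℝ} {α : τ → (σ → ℝ) → ℝ} (h0 : ∀ t, constantCoeff (a t) = 0)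
    (ha : ∀ t, Tay (a t) (α t)) {F : MvPowerSeries τ ℝ} {f : (τ → ℝ) → ℝ} (hF : Tay F f) :
    Tay (F.subst a) (fun u => f fun t => α t u) := by
  have hs := hasSubst_zero h0
  have htend : Tendsto (fun u t => α t u) (𝓝 0) (𝓝 (0 : τ → ℝ)) :=
    tendsto_pi_nhds.2 fun t => (ha t).tendsto_zero (h0 t)
  have hα : (fun u t => α t u) =O[𝓝 0] fun u : σ → ℝ => ‖u‖ := by
    refine isBigO_pi.2 fun t => ?_
    simpa using ((ha t).isBigO_iff 1).2 (mem_ordIdeal_one.2 (h0 t))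
  intro N
  obtain ⟨p, h1, h2⟩ := hF N
  have hp : Tay ((p : MvPowerSeries τ ℝ).subst a)
      (fun u => MvPolynomial.eval (fun t => α t u) p) := by
    rw [MvPowerSeries.subst_coe]
    clear h1 h2
    induction p using MvPolynomial.induction_on with
    | C r => simpa [MvPowerSeries.algebraMap_apply] using const r
    | add p q hp hq => simpa using hp.add hq
    | mul_X p t hp => simpa using hp.mul (ha t)
  obtain ⟨q, h3, h4⟩ := hp N
  refine ⟨q, ?_, ?_⟩
  · have := add_mem (subst_mem_ordIdeal h0 h1) h3
    rwa [subst_sub hs, sub_add_sub_cancel] at this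
  · have h5 := (h2.comp_tendsto htend).trans (hα.norm_left.pow N)
    refine (h5.add h4).congr_left fun u => ?_
    simp only [Function.comp]; ring

end Tay
end Taylor
end Artin

namespace Artin
open MvPowerSeries
open scoped Topology
open Asymptotics Filter

section Words

variable {σ : Type*} [Fintype σ]

/-- The exponent of the commutative monomial of a word. -/
def wordExp {σ : Type*} {n : ℕ} (w : Fin n → σ) : σ →₀ ℕ := ∑ i, Finsupp.single (w i) 1

theorem degree_wordExp {σ : Type*} {n : ℕ} (w : Fin n → σ) : (wordExp w).degree = n := by
  simp [wordExp, map_sum]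

theorem exists_wordExp {σ : Type*} (n : ℕ) (d : σ →₀ ℕ) (h : d.degree = n) :
    ∃ w : Fin n → σ, wordExp w = d := by
  induction n generalizing d with
  | zero =>
    rw [Finsupp.degree_eq_zero_iff] at h
    exact ⟨Fin.elim0, by simp [wordExp, h]⟩
  | succ n ih =>
    obtain ⟨s, hs⟩ : ∃ s, d s ≠ 0 := by
      by_contra! h0
      have : d = 0 := by ext s; exact h0 s
      rw [this, map_zero] at h
      omega
    have hle : Finsupp.single s 1 ≤ d := by
      rw [Finsupp.single_le_iff]; omega
    have e : d - Finsupp.single s 1 + Finsupp.single s 1 = d := tsub_add_cancel_of_le hle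
    obtain ⟨w, hw⟩ := ih (d - Finsupp.single s 1) (by
      have := congrArg Finsupp.degree e
      rw [map_add, Finsupp.degree_single] at this
      omega)
    refine ⟨Fin.cons s w, ?_⟩
    rw [wordExp, Fin.sum_univ_succ]
    simp only [Fin.cons_zero, Fin.cons_succ]
    change _ + wordExp w = d
    rw [hw, add_comm, e]

/-- The homogeneous polynomial with given noncommutative coefficients. -/
def wordPoly {n : ℕ} (c : (Fin n → σ) → ℝ) : MvPolynomial σ ℝ :=
  ∑ w, MvPolynomial.monomial (wordExp w) (c w)

open Classical in
theorem coeff_wordPoly {n : ℕ} (c : (Fin n → σ) → ℝ) (d : σ →₀ ℕ) :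
    MvPolynomial.coeff d (wordPoly c) = ∑ w, if wordExp w = d then c w else 0 := by
  simp only [wordPoly, MvPolynomial.coeff_sum, MvPolynomial.coeff_monomial]

theorem eval_wordPoly {n : ℕ} (c : (Fin n → σ) → ℝ) (u : σ → ℝ) :
    MvPolynomial.eval u (wordPoly c) = ∑ w, c w * ∏ i, u (w i) := by
  rw [wordPoly, map_sum]
  refine Finset.sum_congr rfl fun w _ => ?_
  have : (MvPolynomial.monomial (wordExp w) (c w) : MvPolynomial σ ℝ) =
      MvPolynomial.C (c w) * ∏ i, MvPolynomial.X (w i) := by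
    rw [MvPolynomial.monomial_eq, wordExp]
    congr 1
    change _ = ∏ i, MvPolynomial.X (w i)
    rw [← Finsupp.prod_finsetSum_index (fun _ => pow_zero _) (fun _ _ _ => pow_add _ _ _)]
    refine Finset.prod_congr rfl fun i _ => ?_
    exact (Finsupp.prod_single_index (h := fun s k => (MvPolynomial.X s : MvPolynomial σ ℝ) ^ k)
      (pow_zero _)).trans (pow_one _)
  rw [this, map_mul, map_prod, MvPolynomial.eval_C]
  simp only [MvPolynomial.eval_X]

theorem coeff_wordPoly_of_ne {n : ℕ} (c : (Fin n → σ) → ℝ) {d : σ →₀ ℕ} (h : d.degree ≠ n) :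
    MvPolynomial.coeff d (wordPoly c) = 0 := by
  classical
  rw [coeff_wordPoly]
  refine Finset.sum_eq_zero fun w _ => if_neg fun hw => h ?_
  rw [← hw, degree_wordExp]

/-- The power series with given noncommutative coefficients. -/
def wordSeries (c : ∀ n, (Fin n → σ) → ℝ) : MvPowerSeries σ ℝ :=
  fun d => MvPolynomial.coeff d (wordPoly (c d.degree))

theorem coeff_wordSeries (c : ∀ n, (Fin n → σ) → ℝ) (d : σ →₀ ℕ) :
    coeff d (wordSeries c) = MvPolynomial.coeff d (wordPoly (c d.degree)) := rfl

theorem tay_wordSeries {f : (σ → ℝ) → ℝ} {p : FormalMultilinearSeries ℝ (σ → ℝ) ℝ}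
    (hf : HasFPowerSeriesAt f p 0) {c : ∀ n, (Fin n → σ) → ℝ}
    (hp : ∀ n u, p n (fun _ => u) = MvPolynomial.eval u (wordPoly (c n))) :
    Tay (wordSeries c) f := by
  intro N
  refine ⟨∑ n ∈ Finset.range N, wordPoly (c n), ?_, ?_⟩
  · intro d hd
    rw [map_sub, coeff_wordSeries, MvPolynomial.coeff_coe, MvPolynomial.coeff_sum,
      Finset.sum_eq_single_of_mem d.degree (Finset.mem_range.2 hd), sub_self]
    intro n _ hn
    exact coeff_wordPoly_of_ne _ hn.symm
  · refine (hf.isBigO_sub_partialSum_pow N).congr_left fun u => ?_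
    rw [zero_add, map_sum, FormalMultilinearSeries.partialSum]
    simp only [hp]

/-- Power series with geometrically bounded coefficients. -/
def Conv {σ : Type*} (F : MvPowerSeries σ ℝ) : Prop :=
  ∃ M R : ℝ, ∀ d : σ →₀ ℕ, |coeff d F| ≤ M * R ^ d.degree

theorem Conv.exists_ge_one {σ : Type*} {F : MvPowerSeries σ ℝ} (h : Conv F) :
    ∃ M R : ℝ, 1 ≤ M ∧ 1 ≤ R ∧ ∀ d : σ →₀ ℕ, |coeff d F| ≤ M * R ^ d.degree := by
  obtain ⟨M, R, h⟩ := h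
  refine ⟨max 1 |M|, max 1 |R|, le_max_left _ _, le_max_left _ _, fun d => (h d).trans ?_⟩
  refine (le_abs_self _).trans ?_
  rw [abs_mul, abs_pow]
  gcongr
  · exact le_max_right _ _
  · exact le_max_right _ _

theorem exists_tay_of_analyticAt {f : (σ → ℝ) → ℝ} (hf : AnalyticAt ℝ f 0) :
    ∃ F, Conv F ∧ Tay F f := by
  classical
  obtain ⟨p, hp⟩ := hf
  obtain ⟨C, r, hC, hr, hb⟩ := p.le_mul_pow_of_radius_pos hp.radius_pos
  refine ⟨wordSeries fun n w => p n fun i => Pi.single (w i) 1, ?_, tay_wordSeries hp ?_⟩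
  · refine ⟨C, Fintype.card σ * r, fun d => ?_⟩
    rw [coeff_wordSeries, coeff_wordPoly]
    refine (Finset.abs_sum_le_sum_abs _ _).trans ?_
    have : ∀ w ∈ (Finset.univ : Finset (Fin d.degree → σ)),
        |if wordExp w = d then p d.degree fun i => Pi.single (w i) 1 else 0| ≤
          C * r ^ d.degree := by
      intro w _
      split_ifs
      · refine ((p d.degree).le_opNorm _).trans ?_
        have h1 : ∀ i, ‖(Pi.single (w i) 1 : σ → ℝ)‖ = 1 := fun i => by
          rw [Pi.norm_single, norm_one]
        simp only [h1, Finset.prod_const_one, mul_one]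
        exact hb _
      · rw [abs_zero]; positivity
    refine (Finset.sum_le_sum this).trans (le_of_eq ?_)
    rw [Finset.sum_const, Finset.card_univ, Fintype.card_fun, Fintype.card_fin, nsmul_eq_mul]
    push_cast
    ring
  · intro n u
    rw [eval_wordPoly]
    conv_lhs => rw [pi_eq_sum_univ' u]
    rw [ContinuousMultilinearMap.map_sum]
    refine Finset.sum_congr rfl fun w _ => ?_
    rw [ContinuousMultilinearMap.map_smul_univ, smul_eq_mul, mul_comm]

open Classical in
theorem exists_analyticAt_of_conv {F : MvPowerSeries σ ℝ} (hF : Conv F) :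
    ∃ f : (σ → ℝ) → ℝ, AnalyticAt ℝ f 0 ∧ Tay F f := by
  obtain ⟨M, R, hM, hR, hb⟩ := hF.exists_ge_one
  let num : ∀ n, (σ →₀ ℕ) → ℕ := fun n d =>
    (Finset.univ.filter fun w : Fin n → σ => wordExp w = d).card
  have hnum : ∀ n (w : Fin n → σ), 1 ≤ num n (wordExp w) := fun n w =>
    Finset.card_pos.2 ⟨w, by simp⟩
  let c : ∀ n, (Fin n → σ) → ℝ := fun n w => coeff (wordExp w) F / num n (wordExp w)
  have hc : ∀ n (w : Fin n → σ), |c n w| ≤ M * R ^ n := by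
    intro n w
    have h1 : (1 : ℝ) ≤ num n (wordExp w) := by exact_mod_cast hnum n w
    have h2 := hb (wordExp w)
    rw [degree_wordExp] at h2
    rw [abs_div, Nat.abs_cast]
    exact (div_le_self (abs_nonneg _) h1).trans h2
  let p : FormalMultilinearSeries ℝ (σ → ℝ) ℝ := fun n => ∑ w : Fin n → σ, c n w •
    (ContinuousMultilinearMap.mkPiAlgebra ℝ (Fin n) ℝ).compContinuousLinearMap
      fun i => ContinuousLinearMap.proj (R := ℝ) (φ := fun _ : σ => ℝ) (w i)
  have hp : ∀ n (m : Fin n → σ → ℝ), p n m = ∑ w, c n w * ∏ i, m i (w i) := by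
    intro n m
    simp [p]
  have hpn : ∀ n, ‖p n‖ ≤ M * (Fintype.card σ * R) ^ n := by
    intro n
    refine ContinuousMultilinearMap.opNorm_le_bound (by positivity) fun m => ?_
    rw [hp]
    refine (norm_sum_le _ _).trans ?_
    have : ∀ w ∈ (Finset.univ : Finset (Fin n → σ)), ‖c n w * ∏ i, m i (w i)‖ ≤
        M * R ^ n * ∏ i, ‖m i‖ := by
      intro w _
      rw [norm_mul, norm_prod]
      gcongr with i
      · exact hc n w
      · exact norm_le_pi_norm _ _
    refine (Finset.sum_le_sum this).trans (le_of_eq ?_)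
    rw [Finset.sum_const, Finset.card_univ, Fintype.card_fun, Fintype.card_fin, nsmul_eq_mul]
    push_cast
    ring
  have hrad : 0 < p.radius := by
    let r : NNReal := (⟨(Fintype.card σ + 1) * R, by positivity⟩)⁻¹
    have hr : (r : ℝ) = ((Fintype.card σ + 1) * R)⁻¹ := rfl
    refine lt_of_lt_of_le ?_ (p.le_radius_of_bound M (r := r) fun n => ?_)
    · rw [ENNReal.coe_pos, ← NNReal.coe_pos, hr]; positivity
    · have h1 : (Fintype.card σ * R) * (r : ℝ) ≤ 1 := by
        rw [hr, ← div_eq_mul_inv, div_le_one (by positivity)]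
        nlinarith
      calc ‖p n‖ * (r : ℝ) ^ n ≤ M * (Fintype.card σ * R) ^ n * (r : ℝ) ^ n := by
            gcongr; exact hpn n
        _ = M * (Fintype.card σ * R * r) ^ n := by rw [mul_pow _ (r : ℝ)]; ring
        _ ≤ M * 1 ^ n := by gcongr
        _ = M := by rw [one_pow, mul_one]
  have hs := (p.hasFPowerSeriesOnBall hrad).hasFPowerSeriesAt
  refine ⟨p.sum, ⟨p, hs⟩, ?_⟩
  have hFc : wordSeries c = F := by
    ext d
    rw [coeff_wordSeries, coeff_wordPoly, ← Finset.sum_filter]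
    have : ∀ w ∈ Finset.univ.filter (fun w : Fin d.degree → σ => wordExp w = d),
        c d.degree w = coeff d F / num d.degree d := by
      intro w hw
      have hw := (Finset.mem_filter.1 hw).2
      simp only [c, hw]
    rw [Finset.sum_congr rfl this, Finset.sum_const, nsmul_eq_mul]
    change (num d.degree d : ℝ) * _ = _
    obtain ⟨w, hw⟩ := exists_wordExp _ d rfl
    have h1 : (num d.degree d : ℝ) ≠ 0 := by
      have := hnum _ w
      rw [hw] at this
      exact_mod_cast (by omega : num d.degree d ≠ 0)
    field_simp
  rw [← hFc]
  refine tay_wordSeries hs fun n u => ?_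
  rw [hp, eval_wordPoly]

theorem eventually_eq_zero_of_tay {f : (σ → ℝ) → ℝ} (hf : AnalyticAt ℝ f 0) (h : Tay 0 f) :
    ∀ᶠ u in 𝓝 0, f u = 0 := by
  obtain ⟨p, r, hp⟩ := hf
  have hO : ∀ N : ℕ, f =O[𝓝 0] fun u => ‖u‖ ^ N := fun N => (h.isBigO_iff N).2 (zero_mem _)
  have h0 : ∀ n, ∀ u : σ → ℝ, p n (fun _ => u) = 0 := by
    intro n
    induction n using Nat.strong_induction_on with
    | _ n ih =>
      refine IsBigO.continuousMultilinearMap_apply_eq_zero ?_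
      have h1 := hp.hasFPowerSeriesAt.isBigO_sub_partialSum_pow (n + 1)
      refine ((hO (n + 1)).sub h1).congr_left fun u => ?_
      rw [zero_add, FormalMultilinearSeries.partialSum, Finset.sum_range_succ,
        Finset.sum_eq_zero fun k hk => ih k (Finset.mem_range.1 hk) u]
      ring
  filter_upwards [Metric.eball_mem_nhds (0 : σ → ℝ) hp.r_pos] with u hu
  have := hp.hasSum hu
  simp only [h0, zero_add] at this
  exact this.unique hasSum_zero

theorem conv_of_tay {F : MvPowerSeries σ ℝ} {f : (σ → ℝ) → ℝ} (hf : AnalyticAt ℝ f 0)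
    (h : Tay F f) : Conv F := by
  obtain ⟨G, hG, hGf⟩ := exists_tay_of_analyticAt hf
  rwa [h.eq hGf]

end Words
end Artin

namespace Artin
open MvPowerSeries
open scoped Topology ContDiff
open Asymptotics Filter

section Convergent

variable {σ τ ρ ι : Type*} [Fintype σ] [Fintype τ] [Fintype ρ] [Fintype ι]

/-- `F` is the Taylor series at the origin of the function `f`, analytic near the origin. -/
structure Ana (F : MvPowerSeries σ ℝ) (f : (σ → ℝ) → ℝ) : Prop where
  an : AnalyticAt ℝ f 0
  tay : Tay F f

theorem conv_iff {F : MvPowerSeries σ ℝ} : Conv F ↔ ∃ f, Ana F f :=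
  ⟨fun h => let ⟨f, h1, h2⟩ := exists_analyticAt_of_conv h; ⟨f, h1, h2⟩,
    fun ⟨_, h⟩ => conv_of_tay h.an h.tay⟩

theorem Conv.reindex {σ ρ : Type*} {F : MvPowerSeries σ ℝ} (hF : Conv F) {N : (ρ →₀ ℕ) → ℤ}
    {φ : (ρ →₀ ℕ) → (σ →₀ ℕ)} {B : ℕ} (hN : ∀ β, |N β| ≤ (B : ℤ) ^ (β.degree + 1))
    (hφ : ∀ β, (φ β).degree ≤ B * (β.degree + 1)) : Conv (reindex N φ F) := by
  obtain ⟨M, R, hM, hR, hb⟩ := hF.exists_ge_one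
  refine ⟨B * M * R ^ B, B * R ^ B, fun β => ?_⟩
  rw [coeff_reindex, abs_mul]
  have h1 : |((N β : ℤ) : ℝ)| ≤ (B : ℝ) ^ (β.degree + 1) := by exact_mod_cast hN β
  calc |((N β : ℤ) : ℝ)| * |coeff (φ β) F|
      ≤ (B : ℝ) ^ (β.degree + 1) * (M * R ^ (B * (β.degree + 1))) := by
        refine mul_le_mul h1 ((hb _).trans ?_) (abs_nonneg _) (by positivity)
        gcongr
        exact hφ β
    _ = _ := by rw [pow_mul, pow_succ, pow_succ, mul_pow]; ring

theorem Conv.shift {σ : Type*} (x : σ) {H : MvPowerSeries σ ℝ} (hH : Conv H) :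
    Conv (shift x H) := by
  obtain ⟨M, R, hM, hR, hb⟩ := hH.exists_ge_one
  refine ⟨M * R, R, fun d => ?_⟩
  rw [coeff_shift]
  refine (hb _).trans (le_of_eq ?_)
  rw [map_add, Finsupp.degree_single]; ring

theorem Conv.pderiv {σ : Type*} (s : σ) {F : MvPowerSeries σ ℝ} (hF : Conv F) :
    Conv (pderiv ℝ s F) := by
  obtain ⟨M, R, hM, hR, hb⟩ := hF.exists_ge_one
  refine ⟨M * R, 2 * R, fun d => ?_⟩
  have h1 : d s < 2 ^ d.degree := lt_of_le_of_lt (Finsupp.le_degree s d) Nat.lt_two_pow_self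
  have h2 : ((d s : ℝ) + 1) ≤ 2 ^ d.degree := by exact_mod_cast h1
  have h3 := hb (d + Finsupp.single s 1)
  rw [map_add, Finsupp.degree_single] at h3
  rw [coeff_pderiv, abs_mul, abs_of_nonneg (by positivity : (0 : ℝ) ≤ (d s : ℝ) + 1)]
  refine (mul_le_mul h3 h2 (by positivity) (by positivity)).trans (le_of_eq ?_)
  rw [pow_succ, mul_pow]; ring

namespace Ana

variable {F G : MvPowerSeries σ ℝ} {f g : (σ → ℝ) → ℝ}

theorem conv (h : Ana F f) : Conv F := conv_iff.2 ⟨f, h⟩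

theorem add (hF : Ana F f) (hG : Ana G g) : Ana (F + G) (fun u => f u + g u) :=
  ⟨hF.an.add hG.an, hF.tay.add hG.tay⟩

theorem sub (hF : Ana F f) (hG : Ana G g) : Ana (F - G) (fun u => f u - g u) :=
  ⟨hF.an.sub hG.an, hF.tay.sub hG.tay⟩

theorem mul (hF : Ana F f) (hG : Ana G g) : Ana (F * G) (fun u => f u * g u) :=
  ⟨hF.an.mul hG.an, hF.tay.mul hG.tay⟩

theorem const (c : ℝ) : Ana (C c : MvPowerSeries σ ℝ) (fun _ => c) :=
  ⟨analyticAt_const, Tay.const c⟩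

theorem coord (s : σ) : Ana (X s : MvPowerSeries σ ℝ) (fun u => u s) :=
  ⟨(ContinuousLinearMap.proj (R := ℝ) (φ := fun _ : σ => ℝ) s).analyticAt 0, Tay.coord s⟩

theorem congr' (hF : Ana F f) (h : F = G) : Ana G f := h ▸ hF

theorem congr (hF : Ana F f) (h : f =ᶠ[𝓝 0] g) : Ana F g :=
  ⟨hF.an.congr h, hF.tay.congr h⟩

theorem subst {a : τ → MvPowerSeries σ ℝ} {α : τ → (σ → ℝ) → ℝ} (h0 : ∀ t, constantCoeff (a t) = 0)
    (ha : ∀ t, Ana (a t) (α t)) {F : MvPowerSeries τ ℝ} {f : (τ → ℝ) → ℝ} (hF : Ana F f) :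
    Ana (F.subst a) (fun u => f fun t => α t u) := by
  refine ⟨?_, Tay.subst h0 (fun t => (ha t).tay) hF.tay⟩
  have h1 : AnalyticAt ℝ (fun u t => α t u) 0 := AnalyticAt.pi fun t => (ha t).an
  have h2 : (fun t => α t 0) = 0 := funext fun t => by rw [(ha t).tay.apply_zero, h0]; rfl
  exact AnalyticAt.comp (g := f) (f := fun u t => α t u) (by simp only [h2]; exact hF.an) h1

theorem eventuallyEq (hF : Ana F f) (hG : Ana F g) : f =ᶠ[𝓝 0] g := by
  have h := hF.sub hG
  rw [sub_self] at h
  filter_upwards [eventually_eq_zero_of_tay h.an h.tay] with u hu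
  exact sub_eq_zero.1 hu

theorem fderiv_single [DecidableEq σ] (hF : Ana F f) (s : σ) :
    Ana (pderiv ℝ s F) (fun u => fderiv ℝ f u (Pi.single s 1)) := by
  obtain ⟨d, hd⟩ := conv_iff.1 (hF.conv.pderiv s)
  let a : σ → MvPowerSeries (Option σ) ℝ := fun t => X (some t)
  let c : σ → MvPowerSeries (Option σ) ℝ := fun t => C ((Pi.single s 1 : σ → ℝ) t)
  have ha : ∀ t, constantCoeff (a t) = 0 := fun t => constantCoeff_X' _
  have hp : constantCoeff (X none : MvPowerSeries (Option σ) ℝ) = 0 := constantCoeff_X' _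
  have hapc : ∀ t, constantCoeff (a t + X none * c t) = 0 := fun t => by
    rw [map_add, map_mul, hp, ha, zero_mul, add_zero]
  -- the remainder is convergent
  have hrem : Conv (taylorRem a c (X none) F) := by
    have hl : ∀ t, Ana (line a c t) fun w : Option (Option σ) → ℝ =>
        w (some (some t)) + w none * (Pi.single s 1 : σ → ℝ) t := by
      intro t
      refine ((coord (some (some t))).add ((coord none).mul (const _))).congr' ?_
      simp only [line, ren, a, c]
      rw [subst_X (hasSubst_zero fun _ => constantCoeff_X' _), MvPowerSeries.subst_C]
    obtain ⟨r, hr⟩ := conv_iff.1 ((subst (constantCoeff_line ha c) hl hF).conv.shift none |>.shift none)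
    have hspec : ∀ o : Option (Option σ), Ana (spec (X none : MvPowerSeries (Option σ) ℝ) o)
        fun v : Option σ → ℝ => v (o.elim none id) := by
      rintro (_ | o)
      · exact coord none
      · exact coord o
    exact (subst (constantCoeff_spec hp) hspec hr).conv
  obtain ⟨r, hr⟩ := conv_iff.1 hrem
  have hsum : ∑ t, (MvPowerSeries.pderiv ℝ t F).subst a * c t =
      (MvPowerSeries.pderiv ℝ s F).subst a := by
    rw [Finset.sum_eq_single s]
    · simp only [c, Pi.single_eq_same, map_one, mul_one]
    · intro t _ ht
      simp only [c, Pi.single_eq_of_ne ht, map_zero, mul_zero]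
    · simp
  have h1 : Ana (F.subst fun t => a t + X none * c t) _ :=
    subst hapc (fun t => (coord (some t)).add ((coord none).mul (const _))) hF
  rw [taylor_two ha c hp, hsum] at h1
  have h2 := ((subst ha (fun t => coord (some t)) hF).add ((coord none).mul
    (subst ha (fun t => coord (some t)) hd))).add (((coord none).mul (coord none)).mul hr)
  rw [← sq] at h2
  have key := h1.eventuallyEq h2
  let v : (σ → ℝ) → ℝ → Option σ → ℝ := fun u t o => o.elim t u
  have hv : Continuous fun u => v u 0 := continuous_pi fun o => by
    cases o with
    | none => exact continuous_const
    | some x => exact continuous_apply x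
  have hv0 : v 0 0 = 0 := by funext o; cases o <;> rfl
  have hvt : Tendsto (fun u => v u 0) (𝓝 0) (𝓝 0) := by
    have := hv.tendsto 0; rwa [hv0] at this
  refine hd.congr ?_
  filter_upwards [hvt.eventually key.eventually_nhds,
    hvt.eventually hr.an.eventually_analyticAt, hF.an.eventually_analyticAt] with u hu hru hfu
  have hvd : HasDerivAt (v u) (fun o => o.elim 1 0) 0 := by
    refine hasDerivAt_pi.2 fun o => ?_
    cases o with
    | none => exact hasDerivAt_id 0
    | some x => exact hasDerivAt_const 0 (u x)
  have hrd : DifferentiableAt ℝ (fun t => r (v u t)) 0 :=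
    DifferentiableAt.comp (0 : ℝ) (g := r) hru.differentiableAt hvd.differentiableAt
  have hA : HasDerivAt (fun t : ℝ => f u + t * d u + t * t * r (v u t)) (d u) 0 := by
    have := (((hasDerivAt_id (0 : ℝ)).mul_const (d u)).const_add (f u)).add
      (((hasDerivAt_id (0 : ℝ)).mul (hasDerivAt_id (0 : ℝ))).mul hrd.hasDerivAt)
    exact this.congr_deriv (by simp)
  have hline : HasDerivAt (fun t : ℝ => u + t • (Pi.single s 1 : σ → ℝ)) (Pi.single s 1) 0 := by
    simpa using ((hasDerivAt_id (0 : ℝ)).smul_const (Pi.single s 1 : σ → ℝ)).const_add u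
  have hB : HasDerivAt (fun t : ℝ => f (u + t • (Pi.single s 1 : σ → ℝ)))
      (fderiv ℝ f u (Pi.single s 1)) 0 := by
    refine HasFDerivAt.comp_hasDerivAt (0 : ℝ) (l := f) ?_ hline
    rw [zero_smul, add_zero]
    exact hfu.differentiableAt.hasFDerivAt
  refine hA.unique (hB.congr_of_eventuallyEq ?_)
  filter_upwards [hvd.continuousAt.eventually hu] with t ht
  simp only [v, Option.elim] at ht
  exact ht.symm

end Ana

/-- The implicit function theorem for convergent power series. -/
theorem conv_of_iftData {G : ι → MvPowerSeries (ρ ⊕ ι) ℝ} (hG : IFTData G) (hc : ∀ i, Conv (G i))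
    {z : ι → MvPowerSeries ρ ℝ} (hz0 : ∀ i, constantCoeff (z i) = 0)
    (hz : ∀ i, z i = (G i).subst (Sum.elim X z)) (i : ι) : Conv (z i) := by
  classical
  choose g hg using fun i => conv_iff.1 (hc i)
  let J : (ρ → ℝ) × (ι → ℝ) →L[ℝ] (ρ ⊕ ι → ℝ) := ContinuousLinearMap.pi fun x =>
    Sum.elim (fun r => (ContinuousLinearMap.proj r).comp (ContinuousLinearMap.fst ℝ _ _))
      (fun i => (ContinuousLinearMap.proj i).comp (ContinuousLinearMap.snd ℝ _ _)) x
  have hJ : ∀ v, J v = Sum.elim v.1 v.2 := by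
    intro v; funext x; cases x <;> rfl
  let Φ : (ρ → ℝ) × (ι → ℝ) → (ι → ℝ) := fun v => v.2 - fun i => g i (J v)
  have hgJ : ∀ i, AnalyticAt ℝ (fun v => g i (J v)) 0 := fun i =>
    AnalyticAt.comp (g := g i) (f := J) (by rw [map_zero]; exact (hg i).an) (J.analyticAt 0)
  have hΦ : AnalyticAt ℝ Φ 0 := analyticAt_snd.sub (AnalyticAt.pi hgJ)
  have hcd : ContDiffAt ℝ ω Φ (0 : (ρ → ℝ) × (ι → ℝ)) := hΦ.contDiffAt
  have hg0 : ∀ i, HasFDerivAt (fun v => g i (J v)) ((fderiv ℝ (g i) 0).comp J) 0 := fun i => by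
    have h1 : HasFDerivAt (g i) (fderiv ℝ (g i) 0) (J 0) := by
      rw [map_zero]; exact (hg i).an.differentiableAt.hasFDerivAt
    exact h1.comp 0 J.hasFDerivAt
  have hd : HasFDerivAt Φ (ContinuousLinearMap.snd ℝ _ _ -
      ContinuousLinearMap.pi fun i => (fderiv ℝ (g i) 0).comp J) 0 :=
    hasFDerivAt_snd.sub (hasFDerivAt_pi.2 hg0)
  have hg1 : ∀ i (w : ι → ℝ), fderiv ℝ (g i) 0 (J (0, w)) = 0 := by
    intro i w
    have h1 : J (0, w) = ∑ j, w j • (Pi.single (Sum.inr j) 1 : ρ ⊕ ι → ℝ) := by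
      rw [hJ, pi_eq_sum_univ' (Sum.elim ((0, w) : (ρ → ℝ) × (ι → ℝ)).1 _), Fintype.sum_sum_type]
      simp
    rw [h1, map_sum]
    refine Finset.sum_eq_zero fun j _ => ?_
    rw [map_smul, ((hg i).fderiv_single (Sum.inr j)).tay.apply_zero, ← coeff_single_one, hG.lin,
      smul_zero]
  have hinv : (fderiv ℝ Φ 0 ∘L .inr ℝ (ρ → ℝ) (ι → ℝ)).IsInvertible := by
    have : fderiv ℝ Φ 0 ∘L .inr ℝ (ρ → ℝ) (ι → ℝ) = ContinuousLinearMap.id ℝ _ := by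
      rw [hd.fderiv]
      ext1 w
      funext i
      simp [hg1]
    rw [this]
    exact ⟨ContinuousLinearEquiv.refl ℝ _, rfl⟩
  let ψ := hcd.implicitFunction (by simp) hinv
  have hψ0 : ψ 0 = 0 := hcd.implicitFunction_apply_self (by simp) hinv
  have hψ : AnalyticAt ℝ ψ 0 :=
    (hcd.contDiffAt_implicitFunction (by simp) hinv).analyticAt
  have hψe : ∀ᶠ x in 𝓝 0, Φ (x, ψ x) = Φ 0 :=
    hcd.eventually_apply_implicitFunction (by simp) hinv
  have hψa : ∀ i, AnalyticAt ℝ (fun x => ψ x i) 0 := fun i => analyticAt_pi_iff.1 hψ i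
  choose Z hZc hZ using fun i => exists_tay_of_analyticAt (hψa i)
  have hZ0 : ∀ i, constantCoeff (Z i) = 0 := fun i => by
    rw [← (hZ i).apply_zero, hψ0]; rfl
  have hΦ0 : Φ 0 = 0 := by
    funext i
    simp only [Φ, map_zero, Prod.snd_zero, Pi.sub_apply, Pi.zero_apply, zero_sub]
    rw [(hg i).tay.apply_zero, hG.const, neg_zero]
  have hZe : ∀ i, Z i = (G i).subst (Sum.elim X Z) := by
    intro i
    have h1 : ∀ x : ρ ⊕ ι, Tay (Sum.elim (X : ρ → MvPowerSeries ρ ℝ) Z x)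
        (fun u => J (u, ψ u) x) := by
      rintro (r | i)
      · exact Tay.coord r
      · exact hZ i
    have h2 := Tay.subst (constantCoeff_elim_X hZ0) h1 (hg i).tay
    refine (hZ i).eq (h2.congr ?_)
    filter_upwards [hψe] with u hu
    rw [hΦ0] at hu
    have := congrFun hu i
    simp only [Φ, Pi.sub_apply, Pi.zero_apply] at this
    exact (sub_eq_zero.1 this).symm
  have : z = Z := hG.unique hz0 hZ0 hz hZe
  rw [this]
  exact hZc i

end Convergent
end Artin

namespace Artin
open MvPowerSeries
open Filter

section ConvClosure

variable {σ τ : Type*} [Finite σ] [Finite τ] {F G : MvPowerSeries σ ℝ}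

theorem Conv.add (hF : Conv F) (hG : Conv G) : Conv (F + G) := by
  have := Fintype.ofFinite σ
  obtain ⟨f, hf⟩ := conv_iff.1 hF
  obtain ⟨g, hg⟩ := conv_iff.1 hG
  exact (hf.add hg).conv

theorem Conv.mul (hF : Conv F) (hG : Conv G) : Conv (F * G) := by
  have := Fintype.ofFinite σ
  obtain ⟨f, hf⟩ := conv_iff.1 hF
  obtain ⟨g, hg⟩ := conv_iff.1 hG
  exact (hf.mul hg).conv

theorem conv_C (c : ℝ) : Conv (C c : MvPowerSeries σ ℝ) := by
  have := Fintype.ofFinite σ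
  exact (Ana.const c).conv

theorem conv_X (s : σ) : Conv (X s : MvPowerSeries σ ℝ) := by
  have := Fintype.ofFinite σ
  exact (Ana.coord s).conv

theorem Conv.subst {a : τ → MvPowerSeries σ ℝ} (h0 : ∀ t, constantCoeff (a t) = 0)
    (ha : ∀ t, Conv (a t)) {F : MvPowerSeries τ ℝ} (hF : Conv F) : Conv (F.subst a) := by
  have := Fintype.ofFinite σ
  have := Fintype.ofFinite τ
  obtain ⟨f, hf⟩ := conv_iff.1 hF
  choose α hα using fun t => conv_iff.1 (ha t)
  exact (Ana.subst h0 hα hf).conv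

theorem conv_of_iftData' {ρ ι : Type*} [Finite ρ] [Finite ι] {G : ι → MvPowerSeries (ρ ⊕ ι) ℝ}
    (hG : IFTData G) (hc : ∀ i, Conv (G i)) {z : ι → MvPowerSeries ρ ℝ}
    (hz0 : ∀ i, constantCoeff (z i) = 0) (hz : ∀ i, z i = (G i).subst (Sum.elim X z)) (i : ι) :
    Conv (z i) := by
  have := Fintype.ofFinite ρ
  have := Fintype.ofFinite ι
  exact conv_of_iftData hG hc hz0 hz i

end ConvClosure

/-- The coefficients of the power series under consideration: sequences of real numbers. -/
abbrev Seq : Type := ℕ → ℝ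

/-- The ultrapower of the field of real numbers. -/
abbrev Ultra : Type := Germ (hyperfilter ℕ : Filter ℕ) ℝ

/-- The class of a sequence in the ultrapower. -/
def toUltra : Seq →+* Ultra := Germ.coeRingHom _

/-- The terms of a sequence. -/
def term (i : ℕ) : Seq →+* ℝ := Pi.evalRingHom _ i

theorem toUltra_eq_zero {x : Seq} : toUltra x = 0 ↔ ∀ᶠ i in hyperfilter ℕ, term i x = 0 :=
  Germ.coe_eq (f := x) (g := 0)

theorem toUltra_surjective : Function.Surjective toUltra := fun x =>
  Germ.inductionOn x fun f => ⟨f, rfl⟩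

instance : CharZero Ultra := by
  have h : Function.Injective ((toUltra).comp (algebraMap ℝ Seq)) := RingHom.injective _
  exact ((RingHom.charZero_iff h).1 inferInstance)

/-- Sequences of power series that converge for most indices, and whose coefficients
belong to a finitely generated algebra. -/
def Adm {σ : Type} (F : MvPowerSeries σ Seq) : Prop :=
  (∃ s : Set Seq, s.Finite ∧ ∀ d, coeff d F ∈ Algebra.adjoin ℝ s) ∧
    ∀ᶠ i in hyperfilter ℕ, Conv (map (term i) F)

theorem exists_lift {σ : Type} {A : Subalgebra ℝ Seq} {F : MvPowerSeries σ Seq}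
    (h : ∀ d, coeff d F ∈ A) : ∃ F' : MvPowerSeries σ A, map (A.val : A →+* Seq) F' = F :=
  ⟨fun d => ⟨coeff d F, h d⟩, rfl⟩

theorem coeff_map_val_mem {σ : Type} {A : Subalgebra ℝ Seq} (F : MvPowerSeries σ A)
    (d : σ →₀ ℕ) : coeff d (map (A.val : A →+* Seq) F) ∈ A := (coeff d F).2

theorem exists_common {ι : Type} [Finite ι] {τ : ι → Type} {F : ∀ i, MvPowerSeries (τ i) Seq}
    (h : ∀ i, Adm (F i)) :
    ∃ s : Set Seq, s.Finite ∧ ∀ i d, coeff d (F i) ∈ Algebra.adjoin ℝ s := by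
  choose s hs hc using fun i => (h i).1
  exact ⟨⋃ i, s i, Set.finite_iUnion hs, fun i d =>
    Algebra.adjoin_mono (Set.subset_iUnion s i) (hc i d)⟩

namespace Adm

variable {σ τ ρ ι : Type} [Finite σ] [Finite τ] [Finite ρ] [Finite ι]

theorem common₂ {F : MvPowerSeries σ Seq} {G : MvPowerSeries τ Seq} (hF : Adm F) (hG : Adm G) :
    ∃ s : Set Seq, s.Finite ∧ (∀ d, coeff d F ∈ Algebra.adjoin ℝ s) ∧
      ∀ d, coeff d G ∈ Algebra.adjoin ℝ s := by
  obtain ⟨s, hs, h1⟩ := hF.1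
  obtain ⟨t, ht, h2⟩ := hG.1
  exact ⟨s ∪ t, hs.union ht, fun d => Algebra.adjoin_mono Set.subset_union_left (h1 d),
    fun d => Algebra.adjoin_mono Set.subset_union_right (h2 d)⟩

theorem add {F G : MvPowerSeries σ Seq} (hF : Adm F) (hG : Adm G) : Adm (F + G) := by
  obtain ⟨s, hs, h1, h2⟩ := hF.common₂ hG
  refine ⟨⟨s, hs, fun d => add_mem (h1 d) (h2 d)⟩, ?_⟩
  filter_upwards [hF.2, hG.2] with i h3 h4
  rw [map_add]
  exact h3.add h4

theorem mul {F G : MvPowerSeries σ Seq} (hF : Adm F) (hG : Adm G) : Adm (F * G) := by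
  classical
  obtain ⟨s, hs, h1, h2⟩ := hF.common₂ hG
  refine ⟨⟨s, hs, fun d => ?_⟩, ?_⟩
  · rw [coeff_mul]
    exact sum_mem fun p _ => mul_mem (h1 _) (h2 _)
  · filter_upwards [hF.2, hG.2] with i h3 h4
    rw [map_mul]
    exact h3.mul h4

theorem const (c : Seq) : Adm (C c : MvPowerSeries σ Seq) := by
  classical
  refine ⟨⟨{c}, Set.finite_singleton c, fun d => ?_⟩, Eventually.of_forall fun i => ?_⟩
  · rw [coeff_C]
    split_ifs
    · exact Algebra.subset_adjoin rfl
    · exact zero_mem _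
  · rw [map_C]; exact conv_C _

theorem coord (s : σ) : Adm (X s : MvPowerSeries σ Seq) := by
  classical
  refine ⟨⟨∅, Set.finite_empty, fun d => ?_⟩, Eventually.of_forall fun i => ?_⟩
  · rw [coeff_X]
    split_ifs
    · exact one_mem _
    · exact zero_mem _
  · rw [map_X]; exact conv_X _

theorem sub {F G : MvPowerSeries σ Seq} (hF : Adm F) (hG : Adm G) : Adm (F - G) := by
  have := hF.add ((const (-1)).mul hG)
  simpa [sub_eq_add_neg] using this

theorem sum {κ : Type} {s : Finset κ} {F : κ → MvPowerSeries σ Seq} (h : ∀ k ∈ s, Adm (F k)) :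
    Adm (∑ k ∈ s, F k) := by
  classical
  induction s using Finset.induction_on with
  | empty => simpa using const (σ := σ) 0
  | insert k s hk ih =>
    rw [Finset.sum_insert hk]
    exact (h k (Finset.mem_insert_self _ _)).add (ih fun j hj => h j (Finset.mem_insert_of_mem hj))

theorem subst {a : τ → MvPowerSeries σ Seq} (h0 : ∀ t, constantCoeff (a t) = 0)
    (ha : ∀ t, Adm (a t)) {F : MvPowerSeries τ Seq} (hF : Adm F) : Adm (F.subst a) := by
  refine ⟨?_, ?_⟩
  · obtain ⟨s, hs, h1⟩ := exists_common ha
    obtain ⟨t, ht, h2⟩ := hF.1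
    refine ⟨s ∪ t, hs.union ht, ?_⟩
    set A := Algebra.adjoin ℝ (s ∪ t) with hA
    have h1' : ∀ x d, coeff d (a x) ∈ A := fun x d =>
      Algebra.adjoin_mono Set.subset_union_left (h1 x d)
    have h2' : ∀ d, coeff d F ∈ A := fun d => Algebra.adjoin_mono Set.subset_union_right (h2 d)
    choose a' ha' using fun x => exists_lift (h1' x)
    obtain ⟨F', hF'⟩ := exists_lift h2'
    have h0' : ∀ x, constantCoeff (a' x) = 0 := fun x => by
      have := h0 x
      rw [← ha' x] at this
      exact Subtype.ext this
    have : F.subst a = map (A.val : A →+* Seq) (F'.subst a') := by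
      rw [map_subst (hasSubst_zero h0'), hF']
      congr 1
      funext x
      exact (ha' x).symm
    intro d
    rw [this]
    exact coeff_map_val_mem _ d
  · filter_upwards [hF.2, eventually_all.2 fun t => (ha t).2] with i h1 h2
    rw [map_subst (hasSubst_zero h0)]
    refine Conv.subst (fun t => ?_) h2 h1
    rw [← coeff_zero_eq_constantCoeff_apply, coeff_map, coeff_zero_eq_constantCoeff_apply, h0,
      map_zero]

theorem reindex (N : (ρ →₀ ℕ) → ℤ) (φ : (ρ →₀ ℕ) → (σ →₀ ℕ)) (B : ℕ)
    (hN : ∀ β, |N β| ≤ (B : ℤ) ^ (β.degree + 1)) (hφ : ∀ β, (φ β).degree ≤ B * (β.degree + 1))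
    {F : MvPowerSeries σ Seq} (hF : Adm F) : Adm (reindex N φ F) := by
  obtain ⟨s, hs, h1⟩ := hF.1
  refine ⟨⟨s, hs, fun d => ?_⟩, ?_⟩
  · rw [coeff_reindex]
    exact mul_mem (intCast_mem _ _) (h1 _)
  · filter_upwards [hF.2] with i hi
    convert hi.reindex hN hφ using 1
    ext d
    rw [coeff_map, coeff_reindex, coeff_reindex, coeff_map, map_mul, map_intCast]

theorem eventually_eq_zero {F : MvPowerSeries σ Seq} (hF : Adm F) (h : map toUltra F = 0) :
    ∀ᶠ i in hyperfilter ℕ, map (term i) F = 0 := by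
  obtain ⟨s, hs, h1⟩ := hF.1
  let A := Algebra.adjoin ℝ s
  have hA : A.FG := Subalgebra.fg_def.2 ⟨s, hs, rfl⟩
  have : Algebra.FiniteType ℝ A := A.fg_iff_finiteType.1 hA
  have : IsNoetherianRing A := Algebra.FiniteType.isNoetherianRing ℝ A
  let I : Ideal A := RingHom.ker (toUltra.comp (A.val : A →+* Seq))
  obtain ⟨t, ht⟩ := (IsNoetherian.noetherian I : I.FG)
  have h2 : ∀ᶠ i in hyperfilter ℕ, ∀ x ∈ t, term i x = 0 := by
    rw [Filter.eventually_all_finset]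
    intro x hx
    have : x ∈ I := ht ▸ Ideal.subset_span hx
    exact toUltra_eq_zero.1 this
  filter_upwards [h2] with i hi
  have h3 : I ≤ RingHom.ker ((term i).comp (A.val : A →+* Seq)) := by
    rw [← ht]
    exact Ideal.span_le.2 hi
  ext d
  exact h3 (show (⟨coeff d F, h1 d⟩ : A) ∈ I from congrArg (coeff d) h)

theorem ift {G : ι → MvPowerSeries (ρ ⊕ ι) Seq} (hG : IFTData G) (hGA : ∀ i, Adm (G i)) :
    ∃ z : ι → MvPowerSeries ρ Seq, (∀ i, Adm (z i)) ∧ (∀ i, constantCoeff (z i) = 0) ∧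
      ∀ i, z i = (G i).subst (Sum.elim X z) := by
  obtain ⟨s, hs, h1⟩ := exists_common hGA
  set A := Algebra.adjoin ℝ s with hA
  choose G' hG' using fun i => exists_lift (h1 i)
  have hGd : IFTData G' := by
    refine ⟨fun i => ?_, fun i j => ?_⟩
    · have := hG.const i
      rw [← hG' i] at this
      exact Subtype.ext this
    · have := hG.lin i j
      rw [← hG' i] at this
      exact Subtype.ext this
  obtain ⟨z, hz0, hz⟩ := hGd.exists_solution
  have hmap : ∀ {R : Type} [CommRing R] (f : A →+* R),
      (∀ i, constantCoeff (map f (z i)) = 0) ∧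
      ∀ i, map f (z i) = (map f (G' i)).subst (Sum.elim X fun i => map f (z i)) := by
    intro R _ f
    refine ⟨fun i => ?_, fun i => ?_⟩
    · rw [← coeff_zero_eq_constantCoeff_apply, coeff_map, coeff_zero_eq_constantCoeff_apply, hz0,
        map_zero]
    · conv_lhs => rw [hz i, map_subst (hasSubst_zero (constantCoeff_elim_X hz0))]
      congr 1
      funext x
      cases x <;> simp
  obtain ⟨h2, h3⟩ := hmap (A.val : A →+* Seq)
  refine ⟨fun i => map (A.val : A →+* Seq) (z i), fun i => ⟨⟨s, hs, fun d =>
    coeff_map_val_mem _ d⟩, ?_⟩, h2, fun i => ?_⟩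
  · filter_upwards [eventually_all.2 fun i => (hGA i).2] with k hk
    obtain ⟨h4, h5⟩ := hmap ((term k).comp (A.val : A →+* Seq))
    have h6 : ∀ i, map ((term k).comp (A.val : A →+* Seq)) (G' i) = map (term k) (G i) :=
      fun i => by rw [← hG' i]; rfl
    simp only [h6] at h5
    refine conv_of_iftData' ?_ hk h4 h5 i
    refine ⟨fun i => ?_, fun i j => ?_⟩
    · rw [← coeff_zero_eq_constantCoeff_apply, coeff_map, coeff_zero_eq_constantCoeff_apply,
        hG.const, map_zero]
    · rw [coeff_map, hG.lin, map_zero]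
  · rw [← hG' i]; exact h3 i

end Adm

end Artin

namespace Artin
open MvPowerSeries
open Filter

theorem constantCoeff_map' {σ : Type*} {R S : Type*} [CommRing R] [CommRing S] (f : R →+* S)
    (F : MvPowerSeries σ R) : constantCoeff (map f F) = f (constantCoeff F) := by
  rw [← coeff_zero_eq_constantCoeff_apply, coeff_map, coeff_zero_eq_constantCoeff_apply]

theorem map_reindex {σ ρ : Type*} {R S : Type*} [CommRing R] [CommRing S] (f : R →+* S)
    (N : (ρ →₀ ℕ) → ℤ) (φ : (ρ →₀ ℕ) → (σ →₀ ℕ)) (F : MvPowerSeries σ R) :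
    map f (reindex N φ F) = reindex N φ (map f F) := by
  ext d
  rw [coeff_map, coeff_reindex, coeff_reindex, coeff_map, map_mul, map_intCast]

/-- Series over the ultrapower that are classes of sequences as in `Adm`. -/
def UAdm {σ : Type} (x : MvPowerSeries σ Ultra) : Prop := ∃ F, Adm F ∧ map toUltra F = x

theorem UAdm.exists_const_zero {σ : Type} [Finite σ] {x : MvPowerSeries σ Ultra} (hx : UAdm x)
    (h0 : constantCoeff x = 0) : ∃ F, Adm F ∧ map toUltra F = x ∧ constantCoeff F = 0 := by
  obtain ⟨F, hF, rfl⟩ := hx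
  rw [constantCoeff_map'] at h0
  refine ⟨F - C (constantCoeff F), hF.sub (Adm.const _), ?_, by simp⟩
  rw [map_sub, map_C, h0, map_zero, sub_zero]

theorem UAdm.exists_iftData {ρ ι : Type} [Finite ρ] [Finite ι]
    {G : ι → MvPowerSeries (ρ ⊕ ι) Ultra} (hG : IFTData G) (hGA : ∀ i, UAdm (G i)) :
    ∃ Γ : ι → MvPowerSeries (ρ ⊕ ι) Seq, IFTData Γ ∧ (∀ i, Adm (Γ i)) ∧
      ∀ i, map toUltra (Γ i) = G i := by
  classical
  have := Fintype.ofFinite ι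
  choose F hF hFG hF0 using fun i => (hGA i).exists_const_zero (hG.const i)
  have hlin : ∀ i j, toUltra (coeff (Finsupp.single (Sum.inr j) 1) (F i)) = 0 := fun i j => by
    rw [← coeff_map, hFG, hG.lin]
  refine ⟨fun i => F i - ∑ j, C (coeff (Finsupp.single (Sum.inr j) 1) (F i)) * X (Sum.inr j),
    ⟨fun i => ?_, fun i j => ?_⟩, fun i => (hF i).sub (Adm.sum fun j _ =>
      (Adm.const _).mul (Adm.coord _)), fun i => ?_⟩
  · simp [hF0, map_sum]
  · rw [map_sub, map_sum, Finset.sum_eq_single j]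
    · rw [coeff_C_mul, coeff_X, if_pos rfl, mul_one, sub_self]
    · intro k _ hk
      rw [coeff_C_mul, coeff_X, if_neg, mul_zero]
      intro h
      exact hk (Sum.inr_injective (Finsupp.single_left_injective one_ne_zero h)).symm
    · simp
  · rw [map_sub, hFG, map_sum, Finset.sum_eq_zero, sub_zero]
    intro j _
    rw [map_mul, map_C, hlin, map_zero, zero_mul]

/-- The system of the series `UAdm`. -/
def ultraSystem : System Ultra where
  A σ _ :=
    { carrier := {x | UAdm x}
      mul_mem' := by
        rintro _ _ ⟨F, hF, rfl⟩ ⟨G, hG, rfl⟩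
        exact ⟨F * G, hF.mul hG, map_mul _ _ _⟩
      add_mem' := by
        rintro _ _ ⟨F, hF, rfl⟩ ⟨G, hG, rfl⟩
        exact ⟨F + G, hF.add hG, map_add _ _ _⟩
      algebraMap_mem' := by
        intro r
        obtain ⟨c, rfl⟩ := toUltra_surjective r
        exact ⟨C c, Adm.const c, map_C _ _⟩ }
  X_mem s := ⟨X s, Adm.coord s, map_X _ _⟩
  subst_mem := by
    intro σ τ _ _ a ha h0 F hF
    obtain ⟨F, hF, rfl⟩ := hF
    choose α hα hαa hα0 using fun t => UAdm.exists_const_zero (ha t) (h0 t)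
    refine ⟨F.subst α, Adm.subst hα0 hα hF, ?_⟩
    rw [map_subst (hasSubst_zero hα0)]
    congr 1
    funext t
    exact hαa t
  reindex_mem := by
    rintro σ ρ _ _ N φ B hN hφ _ ⟨F, hF, rfl⟩
    exact ⟨reindex N φ F, hF.reindex N φ B hN hφ, map_reindex _ _ _ _⟩
  ift_mem := by
    intro ρ ι _ _ G hG hGA z hz0 hz i
    obtain ⟨Γ, hΓ, hΓA, hΓG⟩ := UAdm.exists_iftData hG hGA
    obtain ⟨ζ, hζA, hζ0, hζ⟩ := Adm.ift hΓ hΓA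
    refine ⟨ζ i, hζA i, ?_⟩
    have h0 : ∀ i, constantCoeff (map toUltra (ζ i)) = 0 := fun i => by
      rw [constantCoeff_map', hζ0, map_zero]
    refine congrFun (hG.unique (z := fun i => map toUltra (ζ i)) h0 hz0 (fun i => ?_) hz) i
    conv_lhs => rw [hζ i, map_subst (hasSubst_zero (constantCoeff_elim_X hζ0)), hΓG]
    congr 1
    funext x
    cases x <;> simp

end Artin

namespace Artin
open MvPowerSeries
open scoped Topology ContDiff
open Filter

/-- Iterated partial derivatives of a power series. -/
def pderivList {σ : Type*} : List σ → MvPowerSeries σ ℝ → MvPowerSeries σ ℝ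
  | [], F => F
  | s :: l, F => pderivList l (pderiv ℝ s F)

theorem constantCoeff_pderivList {σ : Type*} [Fintype σ] [DecidableEq σ] {E : Type*}
    [NormedAddCommGroup E] [NormedSpace ℝ E] (L : (σ → ℝ) →L[ℝ] E) (e : E) (l : List σ) :
    ∀ {F : MvPowerSeries σ ℝ} {h : E → ℝ}, AnalyticAt ℝ h e → Ana F (fun u => h (e + L u)) →
      constantCoeff (pderivList l F) = iterDerivR (l.map fun s => L (Pi.single s 1)) h e := by
  induction l with
  | nil =>
    intro F h _ hF
    simpa [pderivList, iterDerivR] using hF.tay.apply_zero.symm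
  | cons s l ih =>
    intro F h hh hF
    refine ih (h := fun x => fderiv ℝ h x (L (Pi.single s 1))) ?_ ?_
    · exact ((ContinuousLinearMap.apply ℝ ℝ (L (Pi.single s 1))).analyticAt _).comp hh.fderiv
    · refine (hF.fderiv_single s).congr ?_
      have hc : Tendsto (fun u => e + L u) (𝓝 0) (𝓝 e) := by
        have : Continuous (fun u => e + L u) := by fun_prop
        simpa using this.tendsto 0
      filter_upwards [hc.eventually hh.eventually_analyticAt] with u hu
      have h1 : HasFDerivAt (fun u => e + L u) L u := L.hasFDerivAt.const_add e
      have h2 := hu.differentiableAt.hasFDerivAt.comp u h1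
      have h3 : fderiv ℝ (fun u => h (e + L u)) u = (fderiv ℝ h (e + L u)).comp L := h2.fderiv
      rw [h3]
      rfl

theorem exists_coeff_eq_pderivList {σ : Type*} (n : ℕ) : ∀ d : σ →₀ ℕ, d.degree = n →
    ∃ (l : List σ) (r : ℝ), ∀ F, coeff d F = r * constantCoeff (pderivList l F) := by
  classical
  induction n with
  | zero =>
    intro d hd
    rw [Finsupp.degree_eq_zero_iff] at hd
    subst hd
    exact ⟨[], 1, fun F => by simp [pderivList]⟩
  | succ n ih =>
    intro d hd
    have hd0 : d ≠ 0 := by rintro rfl; simp at hd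
    obtain ⟨s, hs⟩ := Finsupp.ne_iff.1 hd0
    obtain ⟨e, rfl⟩ : ∃ e, d = e + Finsupp.single s 1 := by
      refine ⟨d - Finsupp.single s 1, (tsub_add_cancel_of_le ?_).symm⟩
      rw [Finsupp.single_le_iff]
      exact Nat.one_le_iff_ne_zero.2 hs
    rw [map_add, Finsupp.degree_single] at hd
    obtain ⟨l, r, h⟩ := ih e (by omega)
    refine ⟨s :: l, ((e s : ℝ) + 1)⁻¹ * r, fun F => ?_⟩
    have h1 := h (pderiv ℝ s F)
    rw [coeff_pderiv] at h1
    have h2 : ((e s : ℝ) + 1) ≠ 0 := by positivity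
    rw [pderivList, mul_assoc, ← h1]
    field_simp

theorem mem_adjoin_of_isPolyFunR {a : ℕ} {P : (Fin a → ℝ) → ℝ} (hP : IsPolyFunR P)
    (c : ℕ → Fin a → ℝ) :
    (fun i => P (c i) : Seq) ∈ Algebra.adjoin ℝ (Set.range fun (k : Fin a) (i : ℕ) => c i k) := by
  induction hP with
  | const r => exact Subalgebra.algebraMap_mem _ r
  | linear φ =>
    have : (fun i => φ (c i) : Seq) =
        ∑ k, algebraMap ℝ Seq (φ (Pi.single k 1)) * fun i => c i k := by
      funext i
      rw [Finset.sum_apply]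
      conv_lhs => rw [LinearMap.pi_apply_eq_sum_univ φ (c i)]
      refine Finset.sum_congr rfl fun k _ => ?_
      rw [smul_eq_mul, mul_comm]
      simp only [Pi.mul_apply, Pi.algebraMap_apply, Algebra.algebraMap_self, RingHom.id_apply]
      congr 2
      funext j
      simp [Pi.single_apply, eq_comm]
    rw [this]
    exact sum_mem fun k _ => mul_mem (Subalgebra.algebraMap_mem _ _)
      (Algebra.subset_adjoin ⟨k, rfl⟩)
  | add _ _ h1 h2 => exact add_mem h1 h2
  | mul _ _ h1 h2 => exact mul_mem h1 h2

end Artin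

namespace Artin
open MvPowerSeries
open scoped Topology ContDiff
open Filter Asymptotics

variable {a b g : ℕ}

/-- The coordinates of a triple of vectors. -/
abbrev Coord (a b g : ℕ) : Type := (Fin a ⊕ Fin b) ⊕ Fin g

/-- The triple of vectors with given coordinates. -/
def ofCoord (a b g : ℕ) :
    (Coord a b g → ℝ) →L[ℝ] (Fin a → ℝ) × ((Fin b → ℝ) × (Fin g → ℝ)) :=
  (ContinuousLinearMap.pi fun k => ContinuousLinearMap.proj (.inl (.inl k))).prod
    ((ContinuousLinearMap.pi fun k => ContinuousLinearMap.proj (.inl (.inr k))).prod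
      (ContinuousLinearMap.pi fun k => ContinuousLinearMap.proj (.inr k)))

theorem map_subst_elim {R S : Type*} [CommRing R] [CommRing S] (f : R →+* S) {σ τ : Type*}
    [Finite σ] [Finite τ] {z : τ → MvPowerSeries σ R} (hz : ∀ t, constantCoeff (z t) = 0)
    (F : MvPowerSeries (τ ⊕ σ) R) :
    map f (F.subst (Sum.elim z X)) = (map f F).subst (Sum.elim (fun t => map f (z t)) X) := by
  have h : HasSubst (Sum.elim z X : τ ⊕ σ → MvPowerSeries σ R) :=
    hasSubst_zero (constantCoeff_elim_X' hz)
  rw [map_subst h]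
  congr 1
  funext t
  cases t <;> simp

/-- The power series over sequences with given terms. -/
def ofTerms {σ : Type} (F : ℕ → MvPowerSeries σ ℝ) : MvPowerSeries σ Seq :=
  fun d => fun i => coeff d (F i)

theorem map_term_ofTerms {σ : Type} (F : ℕ → MvPowerSeries σ ℝ) (i : ℕ) :
    map (term i) (ofTerms F) = F i := rfl

theorem coeff_ofTerms {σ : Type} (F : ℕ → MvPowerSeries σ ℝ) (d : σ →₀ ℕ) :
    coeff d (ofTerms F) = fun i => coeff d (F i) := rfl

theorem exists_adm {h : (Fin a → ℝ) × ((Fin b → ℝ) × (Fin g → ℝ)) → ℝ}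
    (hh : MemRingR (Fin a → ℝ) ((Fin b → ℝ) × (Fin g → ℝ)) h) (c : ℕ → Fin a → ℝ) :
    ∃ H : MvPowerSeries (Coord a b g) Seq, Adm H ∧
      ∀ i, Ana (map (term i) H) (fun w => h ((c i, 0) + ofCoord a b g w)) := by
  classical
  obtain ⟨⟨Ω, _, hΩ, hA⟩, hpoly⟩ := hh
  have han : ∀ i, AnalyticAt ℝ h (c i, 0) := fun i => hA _ (hΩ _)
  have hcomp : ∀ i, AnalyticAt ℝ (fun w => h ((c i, 0) + ofCoord a b g w)) 0 := fun i => by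
    have h1 : AnalyticAt ℝ (fun w => ((c i, 0) : (Fin a → ℝ) × ((Fin b → ℝ) × (Fin g → ℝ))) +
        ofCoord a b g w) 0 := analyticAt_const.add ((ofCoord a b g).analyticAt 0)
    refine AnalyticAt.comp (g := h) ?_ h1
    simpa using han i
  choose F hFc hFt using fun i => exists_tay_of_analyticAt (hcomp i)
  have hF : ∀ i, Ana (F i) (fun w => h ((c i, 0) + ofCoord a b g w)) := fun i => ⟨hcomp i, hFt i⟩
  refine ⟨ofTerms F, ⟨⟨Set.range fun (k : Fin a) (i : ℕ) => c i k,
    Set.finite_range _, fun d => ?_⟩, ?_⟩, fun i => ?_⟩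
  · obtain ⟨l, r, hlr⟩ := exists_coeff_eq_pderivList _ d rfl
    have h2 : (fun i => coeff d (F i) : Seq) = algebraMap ℝ Seq r *
        fun i => iterDerivR (l.map fun s => ofCoord a b g (Pi.single s 1)) h (c i, 0) := by
      funext i
      rw [hlr, constantCoeff_pderivList (ofCoord a b g) (c i, 0) l (han i) (hF i)]
      rfl
    rw [coeff_ofTerms, h2]
    exact mul_mem (Subalgebra.algebraMap_mem _ _) (mem_adjoin_of_isPolyFunR (hpoly _) c)
  · exact Eventually.of_forall fun i => by rw [map_term_ofTerms]; exact hFc i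
  · rw [map_term_ofTerms]; exact hF i

theorem exists_bound_of_isBigO {E F : Type*} [NormedAddCommGroup E] [NormedAddCommGroup F]
    {f : E → F} {n : ℕ} (h : f =O[𝓝 0] fun u => ‖u‖ ^ n) :
    ∃ C ε : ℝ, 0 < ε ∧ ∀ u, ‖u‖ < ε → ‖f u‖ ≤ C * ‖u‖ ^ n := by
  obtain ⟨C, hC⟩ := h.bound
  obtain ⟨ε, hε, h1⟩ := Metric.eventually_nhds_iff.1 hC
  refine ⟨C, ε, hε, fun u hu => ?_⟩
  simpa using h1 (by simpa using hu)

theorem isBigO_of_exists_bound {E : Type*} [NormedAddCommGroup E] {f : E → ℝ} {n : ℕ}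
    (h : ∃ C ε : ℝ, 0 < ε ∧ ∀ u, ‖u‖ < ε → |f u| ≤ C * ‖u‖ ^ n) :
    f =O[𝓝 0] fun u => ‖u‖ ^ n := by
  obtain ⟨C, ε, hε, h1⟩ := h
  refine IsBigO.of_bound C (Metric.eventually_nhds_iff.2 ⟨ε, hε, fun u hu => ?_⟩)
  simpa using h1 u (by simpa using hu)

/-- The coordinates of a pair of maps `u ↦ (c + x(u), y(u))`. -/
def pairFun (x : (Fin g → ℝ) → Fin a → ℝ) (y : (Fin g → ℝ) → Fin b → ℝ) (c : Fin a → ℝ) :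
    Fin a ⊕ Fin b → (Fin g → ℝ) → ℝ
  | .inl k => fun u => x u k - c k
  | .inr k => fun u => y u k

theorem exists_ana_pairFun {x : (Fin g → ℝ) → Fin a → ℝ} {y : (Fin g → ℝ) → Fin b → ℝ}
    (hx : AnalyticAt ℝ x 0) (hy : AnalyticAt ℝ y 0) (hy0 : y 0 = 0) :
    ∃ Y : Fin a ⊕ Fin b → MvPowerSeries (Fin g) ℝ,
      (∀ t, Ana (Y t) (pairFun x y (x 0) t)) ∧ ∀ t, constantCoeff (Y t) = 0 := by
  have h : ∀ t, AnalyticAt ℝ (pairFun x y (x 0) t) 0 := by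
    rintro (k | k)
    · exact (analyticAt_pi_iff.1 hx k).sub analyticAt_const
    · exact analyticAt_pi_iff.1 hy k
  choose Y _ hY using fun t => exists_tay_of_analyticAt (h t)
  refine ⟨Y, fun t => ⟨h t, hY t⟩, fun t => ?_⟩
  rw [← (hY t).apply_zero]
  cases t
  · simp [pairFun]
  · simp [pairFun, hy0]

theorem ana_subst_pair {h : (Fin a → ℝ) × ((Fin b → ℝ) × (Fin g → ℝ)) → ℝ} {c : Fin a → ℝ}
    {H : MvPowerSeries (Coord a b g) ℝ} (hH : Ana H fun w => h ((c, 0) + ofCoord a b g w))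
    {x : (Fin g → ℝ) → Fin a → ℝ} {y : (Fin g → ℝ) → Fin b → ℝ}
    {Y : Fin a ⊕ Fin b → MvPowerSeries (Fin g) ℝ} (hY : ∀ t, Ana (Y t) (pairFun x y c t))
    (hY0 : ∀ t, constantCoeff (Y t) = 0) :
    Ana (H.subst (Sum.elim Y X)) fun u => h (x u, (y u, u)) := by
  have h1 : ∀ t, Ana (Sum.elim Y X t : MvPowerSeries (Fin g) ℝ)
      (Sum.elim (pairFun x y c) (fun s u => u s) t) := by
    rintro (t | s)
    · exact hY t
    · exact Ana.coord s
  have h2 := Ana.subst (constantCoeff_elim_X' hY0) h1 hH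
  refine h2.congr (Eventually.of_forall fun u => congrArg h ?_)
  refine Prod.ext ?_ (Prod.ext ?_ ?_) <;> funext k <;> simp [ofCoord, pairFun]

theorem exists_correction {ι : Type*} {h : ι → (Fin a → ℝ) × ((Fin b → ℝ) × (Fin g → ℝ)) → ℝ}
    {c : Fin a → ℝ} {H : ι → MvPowerSeries (Coord a b g) ℝ}
    (hH : ∀ j, Ana (H j) fun w => h j ((c, 0) + ofCoord a b g w))
    {x : (Fin g → ℝ) → Fin a → ℝ} {y : (Fin g → ℝ) → Fin b → ℝ}
    {Y Z : Fin a ⊕ Fin b → MvPowerSeries (Fin g) ℝ} (hY : ∀ t, Ana (Y t) (pairFun x y c t))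
    (hZ0 : ∀ t, constantCoeff (Z t) = 0) (hZc : ∀ t, Conv (Z t))
    (hHZ : ∀ j, (H j).subst (Sum.elim Z X) = 0) {κ : ℕ}
    (hZY : ∀ t, Z t - Y t ∈ ordIdeal (Fin g) ℝ κ) :
    ∃ (xc : (Fin g → ℝ) → (Fin a → ℝ)) (yc : (Fin g → ℝ) → (Fin b → ℝ)),
      AnalyticAt ℝ xc 0 ∧ AnalyticAt ℝ yc 0 ∧
      (∃ C ε : ℝ, 0 < ε ∧ ∀ u : Fin g → ℝ, ‖u‖ < ε → ‖xc u - x u‖ ≤ C * ‖u‖ ^ κ) ∧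
      (∃ C ε : ℝ, 0 < ε ∧ ∀ u : Fin g → ℝ, ‖u‖ < ε → ‖yc u - y u‖ ≤ C * ‖u‖ ^ κ) ∧
      ∀ j, ∀ᶠ u in 𝓝 (0 : Fin g → ℝ), h j (xc u, (yc u, u)) = 0 := by
  choose ζ hζ using fun t => conv_iff.1 (hZc t)
  have hp : ∀ t, Ana (Z t) (pairFun (fun u k => c k + ζ (.inl k) u) (fun u k => ζ (.inr k) u) c t) := by
    rintro (k | k)
    · exact (hζ _).congr (Eventually.of_forall fun u => by simp [pairFun])
    · exact hζ _
  have hO : ∀ t, (fun u => ζ t u - pairFun x y c t u) =O[𝓝 0] fun u => ‖u‖ ^ κ := fun t =>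
    (((hζ t).sub (hY t)).tay.isBigO_iff κ).2 (hZY t)
  refine ⟨fun u k => c k + ζ (.inl k) u, fun u k => ζ (.inr k) u, ?_, ?_, ?_, ?_, fun j => ?_⟩
  · exact analyticAt_pi_iff.2 fun k => analyticAt_const.add (hζ _).an
  · exact analyticAt_pi_iff.2 fun k => (hζ _).an
  · refine exists_bound_of_isBigO (isBigO_pi.2 fun k => (hO (.inl k)).congr_left fun u => ?_)
    simp only [pairFun, Pi.sub_apply]
    ring
  · exact exists_bound_of_isBigO (isBigO_pi.2 fun k => hO (.inr k))
  · have h1 := ana_subst_pair (hH j) hp hZ0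
    rw [hHZ j] at h1
    exact eventually_eq_zero_of_tay h1.an h1.tay

/-- A sequence of approximate solutions to increasing order contains an approximate solution
that is close to an exact one. -/
theorem exists_exact_of_approximate {j₀ : ℕ}
    {h : Fin j₀ → (Fin a → ℝ) × ((Fin b → ℝ) × (Fin g → ℝ)) → ℝ}
    (hmem : ∀ j, MemRingR (Fin a → ℝ) ((Fin b → ℝ) × (Fin g → ℝ)) (h j)) (κ : ℕ)
    {x : ℕ → (Fin g → ℝ) → (Fin a → ℝ)} {y : ℕ → (Fin g → ℝ) → (Fin b → ℝ)}
    (hx : ∀ i, AnalyticAt ℝ (x i) 0) (hy : ∀ i, AnalyticAt ℝ (y i) 0) (hy0 : ∀ i, y i 0 = 0)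
    (hO : ∀ i j, ∃ C ε : ℝ, 0 < ε ∧ ∀ u : Fin g → ℝ, ‖u‖ < ε →
      |h j (x i u, (y i u, u))| ≤ C * ‖u‖ ^ (i + 1)) :
    ∃ i, ∃ (xc : (Fin g → ℝ) → (Fin a → ℝ)) (yc : (Fin g → ℝ) → (Fin b → ℝ)),
      AnalyticAt ℝ xc 0 ∧ AnalyticAt ℝ yc 0 ∧
      (∃ C ε : ℝ, 0 < ε ∧ ∀ u : Fin g → ℝ, ‖u‖ < ε → ‖xc u - x i u‖ ≤ C * ‖u‖ ^ κ) ∧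
      (∃ C ε : ℝ, 0 < ε ∧ ∀ u : Fin g → ℝ, ‖u‖ < ε → ‖yc u - y i u‖ ≤ C * ‖u‖ ^ κ) ∧
      ∀ j, ∀ᶠ u in 𝓝 (0 : Fin g → ℝ), h j (xc u, (yc u, u)) = 0 := by
  choose H hHA hH using fun j => exists_adm (hmem j) fun i => x i 0
  choose Y hY hY0 using fun i => exists_ana_pairFun (hx i) (hy i) (hy0 i)
  obtain ⟨Ys, hYs⟩ : ∃ Ys : Fin a ⊕ Fin b → MvPowerSeries (Fin g) Seq,
      ∀ i t, map (term i) (Ys t) = Y i t := ⟨fun t => ofTerms fun i => Y i t, fun i t => rfl⟩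
  have hYs0 : ∀ t, constantCoeff (Ys t) = 0 := fun t => funext fun i => by
    have h1 := hY0 i t
    rwa [← hYs, constantCoeff_map'] at h1
  have hord : ∀ i j, (map (term i) (H j)).subst (Sum.elim (Y i) X) ∈
      ordIdeal (Fin g) ℝ (i + 1) :=
    fun i j => ((ana_subst_pair (hH j i) (hY i) (hY0 i)).tay.isBigO_iff _).1
      (isBigO_of_exists_bound (hO i j))
  have hzero : ∀ j,
      (map toUltra (H j)).subst (Sum.elim (fun t => map toUltra (Ys t)) X) = 0 := by
    intro j
    rw [← map_subst_elim toUltra hYs0]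
    ext d
    rw [coeff_map, coeff_zero, toUltra_eq_zero]
    refine Filter.Eventually.filter_mono Nat.hyperfilter_le_atTop ?_
    filter_upwards [eventually_ge_atTop d.degree] with i hi
    rw [← coeff_map, map_subst_elim (term i) hYs0]
    simp only [hYs]
    exact hord i j d (Nat.lt_succ_of_le hi)
  obtain ⟨z, hzA, hz0, hz, hzY⟩ := approx ultraSystem (Fin g) (Fin a ⊕ Fin b) (Fin j₀)
    (fun j => map toUltra (H j)) (fun j => ⟨H j, hHA j, rfl⟩) (fun t => map toUltra (Ys t))
    (fun t => by rw [constantCoeff_map', hYs0, map_zero]) hzero κ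
  choose Z hZA hZz hZ0 using fun t => UAdm.exists_const_zero (hzA t) (hz0 t)
  have hE : ∀ x, constantCoeff ((Sum.elim Z X : _ → MvPowerSeries (Fin g) Seq) x) = 0 :=
    constantCoeff_elim_X' hZ0
  have hEA : ∀ x, Adm ((Sum.elim Z X : _ → MvPowerSeries (Fin g) Seq) x) := by
    rintro (t | s)
    · exact hZA t
    · exact Adm.coord s
  have hsol : ∀ j, ∀ᶠ i in (hyperfilter ℕ : Filter ℕ), map (term i) ((H j).subst (Sum.elim Z X)) = 0 := by
    intro j
    refine Adm.eventually_eq_zero (Adm.subst hE hEA (hHA j)) ?_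
    rw [map_subst_elim toUltra hZ0]
    simpa only [hZz] using hz j
  have hclose : ∀ t, ∀ᶠ i in (hyperfilter ℕ : Filter ℕ),
      map (term i) (Z t) - Y i t ∈ ordIdeal (Fin g) ℝ κ := by
    intro t
    have hfin : {d : Fin g →₀ ℕ | d.degree < κ}.Finite := Finsupp.finite_of_degree_lt κ
    have h1 : ∀ᶠ i in (hyperfilter ℕ : Filter ℕ), ∀ d ∈ {d : Fin g →₀ ℕ | d.degree < κ},
        coeff d (map (term i) (Z t) - Y i t) = 0 := by
      rw [eventually_all_finite hfin]
      intro d hd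
      have h2 := hzY t d hd
      rw [← hZz, ← map_sub, coeff_map, toUltra_eq_zero] at h2
      filter_upwards [h2] with i hi
      rw [← coeff_map, map_sub, hYs] at hi
      exact hi
    filter_upwards [h1] with i hi d hd using hi d hd
  obtain ⟨i, h1, h2, h3⟩ := ((eventually_all.2 hsol).and ((eventually_all.2 hclose).and
    (eventually_all.2 fun t => (hZA t).2))).exists
  refine ⟨i, exists_correction (fun j => hH j i) (hY i) (fun t => ?_) h3 (fun j => ?_) h2⟩
  · rw [constantCoeff_map', hZ0, map_zero]
  · rw [← map_subst_elim (term i) hZ0]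
    exact h1 j

end Artin

theorem statement15 (a b g j₀ : ℕ)
    (h : Fin j₀ → ((Fin a → ℝ) × ((Fin b → ℝ) × (Fin g → ℝ))) → ℝ)
    -- the `h_j` belong to `R_ℝ(X × Y × U, X)`
    (hmem : ∀ j, MemRingR (Fin a → ℝ) ((Fin b → ℝ) × (Fin g → ℝ)) (h j))
    (κ : ℕ) (hκ : 1 ≤ κ) :
    ∃ η : ℕ, 1 ≤ η ∧
      ∀ (xa : (Fin g → ℝ) → (Fin a → ℝ)) (ya : (Fin g → ℝ) → (Fin b → ℝ)),
        AnalyticAt ℝ xa 0 → AnalyticAt ℝ ya 0 → ya 0 = 0 →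
        -- `h_j(x^a(u), y^a(u), u) = O(|u|^η)`
        (∀ j : Fin j₀, ∃ C ε : ℝ, 0 < ε ∧ ∀ u : Fin g → ℝ, ‖u‖ < ε →
          |h j (xa u, (ya u, u))| ≤ C * ‖u‖ ^ η) →
        ∃ (xc : (Fin g → ℝ) → (Fin a → ℝ)) (yc : (Fin g → ℝ) → (Fin b → ℝ)),
          AnalyticAt ℝ xc 0 ∧ AnalyticAt ℝ yc 0 ∧
          -- `x^c = x^a + O(|u|^κ)`, `y^c = y^a + O(|u|^κ)`
          (∃ C ε : ℝ, 0 < ε ∧ ∀ u : Fin g → ℝ, ‖u‖ < ε →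
            ‖xc u - xa u‖ ≤ C * ‖u‖ ^ κ) ∧
          (∃ C ε : ℝ, 0 < ε ∧ ∀ u : Fin g → ℝ, ‖u‖ < ε →
            ‖yc u - ya u‖ ≤ C * ‖u‖ ^ κ) ∧
          -- `h_j(x^c(u), y^c(u), u) ≡ 0`
          ∀ j : Fin j₀, ∀ᶠ u in nhds (0 : Fin g → ℝ), h j (xc u, (yc u, u)) = 0 := by
  by_contra hcon
  have hcon' : ∀ i : ℕ, ¬ _ := fun i hi => hcon ⟨i + 1, Nat.le_add_left _ _, hi⟩
  simp only [not_forall] at hcon'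
  choose x y hx hy hy0 hO hno using hcon'
  obtain ⟨i, hi⟩ := Artin.exists_exact_of_approximate hmem κ hx hy hy0 hO
  exact hno i hi
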